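/- Let $A$ be an analytically unramified Noetherian local ring and $I$ an ideal of positive height. Then the Rees algebra $\mathfrak R(I;A) = A[It]$ and its integral closure $\overline{\mathfrak R(I;A)} = \bigoplus_{n\ge 0}\overline{I^n}t^n$ in $A[t]$ have the same multiplicity: $e(\overline{\mathfrak R(I;A)}) = e(\mathfrak R(I;A))$, where the multiplicities are taken with respect to the respective maximal homogeneous ideals. -/

import Mathlib

open Polynomial

set_option maxHeartbeats 1000000
set_option synthInstance.maxHeartbeats 1000000

/-- `ModuleLengthIs A N l` : the `A`-module `N` has finite length `l`. -/
def ModuleLengthIs (A : Type*) [Ring A] (N : Type*) [AddCommGroup N] [Module A N]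
    (l : ℕ) : Prop :=
  ∃ s : CompositionSeries (Submodule A N), s.head = ⊥ ∧ s.last = ⊤ ∧ s.length = l

/-- `IsHSMultiplicity A q M d e` : the Hilbert–Samuel multiplicity of the `A`-module `M`
with respect to the ideal `q`, normalized in dimension `d`, equals `e`. -/
def IsHSMultiplicity (A : Type*) [CommRing A] (q : Ideal A) (M : Type*) [AddCommGroup M]
    [Module A M] (d : ℕ) (e : ℝ) : Prop :=
  ∃ c : ℕ → ℕ, (∀ n : ℕ, ModuleLengthIs A (M ⧸ (q ^ n • ⊤ : Submodule A M)) (c n)) ∧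
    Filter.Tendsto (fun n : ℕ => (Nat.factorial d : ℝ) / (n : ℝ) ^ d * (c n : ℝ))
      Filter.atTop (nhds e)

/-- The maximal homogeneous ideal `(𝔪, S₊)` of a graded subalgebra `S` of `A[X]` over a
local ring `A`: the elements of `S` whose degree-zero coefficient lies in `𝔪`. -/
def maxHomIdeal {A : Type*} [CommRing A] [IsLocalRing A] {R : Type*} [CommRing R]
    [Algebra R A[X]] (S : Subalgebra R A[X]) : Ideal S where
  carrier := {f : S | (f : A[X]).coeff 0 ∈ IsLocalRing.maximalIdeal A}
  zero_mem' := by simp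
  add_mem' := by
    intro f g hf hg
    show ((f + g : S) : A[X]).coeff 0 ∈ IsLocalRing.maximalIdeal A
    rw [AddMemClass.coe_add, coeff_add]
    exact (IsLocalRing.maximalIdeal A).add_mem hf hg
  smul_mem' := by
    intro c f hf
    show ((c • f : S) : A[X]).coeff 0 ∈ IsLocalRing.maximalIdeal A
    rw [smul_eq_mul, MulMemClass.coe_mul, mul_coeff_zero]
    exact Ideal.mul_mem_left _ _ hf

universe u

section AdicNoetherian

open AdicCompletion

lemma factorPow_comp_quotientMap_evalₐ {P R : Type*} [CommRing P] [CommRing R] (g : P →+* R)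
    (J : Ideal P) (M : Ideal R) (h : ∀ n, J ^ n ≤ (M ^ n).comap g) {m n : ℕ} (hle : m ≤ n) :
    (Ideal.Quotient.factorPow M hle).comp ((Ideal.quotientMap (M ^ n) g (h n)).comp
      (evalₐ J n : AdicCompletion J P →+* P ⧸ J ^ n)) =
    (Ideal.quotientMap (M ^ m) g (h m)).comp
      (evalₐ J m : AdicCompletion J P →+* P ⧸ J ^ m) := by
  ext x
  obtain ⟨y, rfl⟩ := AdicCompletion.mk_surjective J P x
  simp only [RingHom.comp_apply, RingHom.coe_coe, evalₐ_mk, Ideal.quotientMap_mk]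
  change Ideal.Quotient.mk (M ^ m) _ = Ideal.Quotient.mk (M ^ m) _
  rw [Ideal.Quotient.mk_eq_mk_iff_sub_mem, ← map_sub]
  refine h m ?_
  have := y.2 hle
  rw [SModEq.comm, SModEq.sub_mem] at this
  simpa using this

lemma Ideal.pow_le_comap_pow {P R : Type*} [CommRing P] [CommRing R] {g : P →+* R}
    {J : Ideal P} {M : Ideal R} (h : J ≤ M.comap g) (n : ℕ) : J ^ n ≤ (M ^ n).comap g :=
  (Ideal.pow_right_mono h n).trans (Ideal.le_comap_pow g n)

/-- The map of completed rings induced by a ring map `g : P →+* R` with `g J ⊆ M`. -/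
noncomputable def adicCompletionRingMap {P R : Type*} [CommRing P] [CommRing R] (g : P →+* R)
    (J : Ideal P) (M : Ideal R) (h : J ≤ M.comap g) :
    AdicCompletion J P →+* AdicCompletion M R :=
  AdicCompletion.liftRingHom M _
    (factorPow_comp_quotientMap_evalₐ g J M (Ideal.pow_le_comap_pow h))

lemma adicCompletionRingMap_of {P R : Type*} [CommRing P] [CommRing R] (g : P →+* R)
    (J : Ideal P) (M : Ideal R) (h : J ≤ M.comap g) (x : P) :
    adicCompletionRingMap g J M h (algebraMap P _ x) = algebraMap R _ (g x) := by
  apply AdicCompletion.ext_evalₐ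
  intro n
  refine (AdicCompletion.evalₐ_liftRingHom M _
    (factorPow_comp_quotientMap_evalₐ g J M (Ideal.pow_le_comap_pow h)) n _).trans ?_
  simp [AdicCompletion.algebraMap_apply]

theorem isNoetherianRing_adicCompletion {R : Type*} [CommRing R] [IsNoetherianRing R]
    (M : Ideal R) : IsNoetherianRing (AdicCompletion M R) := by
  classical
  obtain ⟨r, m, hm⟩ := Submodule.fg_iff_exists_fin_generating_family.mp
    (IsNoetherian.noetherian M)
  let P := MvPolynomial (Fin r) R
  let J : Ideal P := MvPolynomial.idealOfVars (Fin r) R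
  let g : P →+* R := (MvPolynomial.aeval m : P →ₐ[R] R).toRingHom
  have hJM : J.map g = M := by
    rw [← hm]
    simp only [J, MvPolynomial.idealOfVars, Ideal.map_span, ← Set.range_comp]
    congr 2
    ext1
    exact MvPolynomial.aeval_X m _
  have h : J ≤ M.comap g := Ideal.map_le_iff_le_comap.mp hJM.le
  have hJ : J.FG := MvPolynomial.idealOfVars_fg _ _
  have : IsAdicComplete (J.map (algebraMap P (AdicCompletion J P))) (AdicCompletion J P) :=
    isAdicComplete_self J hJ
  have := isAdicComplete_self M (IsNoetherian.noetherian M : M.FG)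
  have : IsNoetherianRing (AdicCompletion J P) :=
    isNoetherianRing_of_ringEquiv _ (MvPowerSeries.toAdicCompletionAlgEquiv (Fin r) R).toRingEquiv
  have hcomp : (adicCompletionRingMap g J M h).comp (algebraMap P (AdicCompletion J P)) =
      (algebraMap R (AdicCompletion M R)).comp g :=
    RingHom.ext fun x => adicCompletionRingMap_of g J M h x
  have key : (J.map (algebraMap P (AdicCompletion J P))).map (adicCompletionRingMap g J M h) =
      M.map (algebraMap R (AdicCompletion M R)) := by
    rw [Ideal.map_map, hcomp, ← Ideal.map_map, hJM]
  have : IsHausdorff ((J.map (algebraMap P (AdicCompletion J P))).map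
      (adicCompletionRingMap g J M h)) (AdicCompletion M R) := by
    rw [key]; infer_instance
  refine isNoetherianRing_of_surjective _ _ (adicCompletionRingMap g J M h)
    (surjective_of_mk_map_comp_surjective
      (I := J.map (algebraMap P (AdicCompletion J P))) _ ?_)
  intro y
  obtain ⟨y, rfl⟩ := Ideal.Quotient.mk_surjective y
  obtain ⟨a, ha⟩ := Ideal.Quotient.mk_surjective (evalOneₐ M y)
  refine ⟨algebraMap P _ (algebraMap R P a), ?_⟩
  rw [RingHom.comp_apply, adicCompletionRingMap_of, Ideal.Quotient.mk_eq_mk_iff_sub_mem, key,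
    ← ker_evalOneₐ_eq_map M (IsNoetherian.noetherian M), RingHom.mem_ker, map_sub, sub_eq_zero]
  change evalOneₐ M (algebraMap R _ (g (algebraMap R P a))) = evalOneₐ M y
  rw [← ha, AdicCompletion.algebraMap_apply]
  have hga : g (algebraMap R P a) = a := (MvPolynomial.aeval m : P →ₐ[R] R).commutes a
  rw [hga]
  rfl

end AdicNoetherian

section Normalization

lemma exists_notMem_mul_mem_of_aeval_eq_zero {C K : Type*} [CommRing C] [CommRing K] [Algebra C K]
    (hC : ∀ z : K, IsIntegral C z → ∃ c, algebraMap C K c = z) (u : K) (Q : Ideal C)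
    (hQ : ∀ c c' : C, algebraMap C K c = algebraMap C K c' * u → c ∈ Q) (n : ℕ) :
    ∀ f : C[X], f.natDegree ≤ n → aeval u f = 0 → (∃ i, f.coeff i ∉ Q) →
      ∃ b ∉ Q, ∃ c, algebraMap C K c = algebraMap C K b * u := by
  induction n with
  | zero =>
    rintro f hf h0 ⟨i, hi⟩
    rw [Polynomial.eq_C_of_natDegree_le_zero hf] at h0 hi
    rw [aeval_C] at h0
    rw [coeff_C] at hi
    split_ifs at hi
    · exact absurd (hQ _ 0 (by rw [h0, map_zero, zero_mul])) hi
    · exact absurd Q.zero_mem hi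
  | succ n ih =>
    rintro f hf h0 ⟨i, hi⟩
    by_cases hlt : f.natDegree ≤ n
    · exact ih f hlt h0 ⟨i, hi⟩
    have hdeg : f.natDegree = n + 1 := by lia
    obtain ⟨c, hc⟩ := hC _ (isIntegral_leadingCoeff_smul f u h0)
    rw [Algebra.smul_def] at hc
    by_cases hb : f.leadingCoeff ∈ Q
    swap
    · exact ⟨_, hb, c, hc⟩
    have hcQ : c ∈ Q := hQ _ _ hc
    have hne : i ≠ n + 1 := by
      rintro rfl
      exact hi (by rwa [← hdeg])
    refine ih (f.eraseLead + monomial n c) ?_ ?_ ⟨i, ?_⟩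
    · refine (natDegree_add_le _ _).trans (max_le ?_ (natDegree_monomial_le _))
      exact (eraseLead_natDegree_le f).trans (by lia)
    · have h1 := congrArg (aeval u) (eraseLead_add_monomial_natDegree_leadingCoeff f)
      rw [h0, map_add, aeval_monomial, hdeg, pow_succ'] at h1
      rw [map_add, aeval_monomial, hc, mul_assoc]
      exact h1
    · rw [coeff_add, eraseLead_coeff_of_ne _ (by rwa [hdeg]), coeff_monomial]
      split_ifs
      · exact fun h => hi ((Q.add_mem_iff_left hcQ).mp h)
      · rwa [add_zero]

/-- If every polynomial relation of `u` over `E` has coefficients in the prime `P`, then the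
extension of `P` to `E[u]` is prime and does not contain `u`. -/
lemma exists_prime_adjoin_of_relations {E K : Type*} [CommRing E] [CommRing K] [Algebra E K]
    (u : K) (P : Ideal E) [P.IsPrime]
    (h : ∀ f : E[X], aeval u f = 0 → ∀ i, f.coeff i ∈ P) :
    ∃ p : Ideal (Algebra.adjoin E {u}), p.IsPrime ∧
      p = P.map (algebraMap E (Algebra.adjoin E {u})) ∧
      ⟨u, Algebra.self_mem_adjoin_singleton E u⟩ ∉ p := by
  let φ : E[X] →ₐ[E] Algebra.adjoin E {u} :=
    aeval (⟨u, Algebra.self_mem_adjoin_singleton E u⟩ : Algebra.adjoin E {u})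
  have hφ : ∀ f, ((φ f : Algebra.adjoin E {u}) : K) = aeval u f := fun f => by
    have := aeval_algHom_apply (Algebra.adjoin E {u}).val
      (⟨u, Algebra.self_mem_adjoin_singleton E u⟩ : Algebra.adjoin E {u}) f
    exact this.symm
  have hsurj : Function.Surjective φ := by
    rintro ⟨y, hy⟩
    have hy' := hy
    rw [Algebra.adjoin_singleton_eq_range_aeval] at hy'
    obtain ⟨f, rfl⟩ := hy'
    exact ⟨f, Subtype.ext (hφ f)⟩
  have hker : RingHom.ker φ ≤ P.map (C : E →+* E[X]) := by
    intro f hf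
    rw [Ideal.mem_map_C_iff]
    refine h f ?_
    rw [← hφ, (RingHom.mem_ker).mp hf]
    rfl
  have := Ideal.isPrime_map_C_of_isPrime (P := P)
  have heq : (P.map (C : E →+* E[X])).map φ = P.map (algebraMap E (Algebra.adjoin E {u})) := by
    have : (P.map (C : E →+* E[X])).map φ = (P.map (C : E →+* E[X])).map (φ : E[X] →+* _) := rfl
    rw [this, Ideal.map_map]
    congr 1
    exact φ.comp_algebraMap
  refine ⟨(P.map (C : E →+* E[X])).map φ, Ideal.map_isPrime_of_surjective hsurj hker, heq, ?_⟩
  intro hmem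
  obtain ⟨f, hf, hfu⟩ := (Ideal.mem_map_iff_of_surjective φ hsurj).mp hmem
  have h1 : (X - f : E[X]) ∈ P.map (C : E →+* E[X]) := by
    apply hker
    rw [RingHom.mem_ker, map_sub, hfu, sub_eq_zero]
    exact aeval_X _
  have h2 : (X : E[X]) ∈ P.map (C : E →+* E[X]) := by
    simpa using add_mem h1 hf
  have := (Ideal.mem_map_C_iff.mp h2) 1
  rw [coeff_X_one] at this
  exact Ideal.IsPrime.ne_top' ((Ideal.eq_top_iff_one _).mpr this)

lemma isIntegral_of_mul_eq_one_of_mem_adjoin {E K : Type*} [CommRing E] [Nontrivial E] [Field K] [Algebra E K]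
    {u z : K} (huz : u * z = 1) (hz : z ∈ Algebra.adjoin E {u}) : IsIntegral E z := by
  rw [Algebra.adjoin_singleton_eq_range_aeval] at hz
  obtain ⟨f, hf⟩ := hz
  change aeval u f = z at hf
  let g : E[X] := X * f - 1
  have hg : aeval u g = 0 := by simp [g, hf, huz]
  have hg0 : g.coeff 0 = -1 := by simp [g]
  have htr : g.trailingCoeff = -1 := by
    rw [trailingCoeff, natTrailingDegree_eq_zero.mpr (Or.inr (by simp [hg0])), hg0]
  have hu : z = u⁻¹ := eq_inv_of_mul_eq_one_right huz
  have h2 : aeval z g.reverse = 0 := by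
    have : Invertible u := invertibleOfNonzero (left_ne_zero_of_mul_eq_one huz)
    have := (eval₂_reverse_eq_zero_iff (algebraMap E K) u g).mpr hg
    rwa [invOf_eq_inv, ← hu] at this
  have h3 := isIntegral_leadingCoeff_smul g.reverse z h2
  rw [reverse_leadingCoeff, htr, neg_smul, one_smul] at h3
  simpa using h3.neg

lemma exists_pow_mul_mem_of_mem_adjoin {E K : Type*} [CommRing E] [CommRing K] [Algebra E K]
    (C : Subalgebra E K) {u b : K} (hb : b ∈ C) (hbu : b * u ∈ C) {f : K}
    (hf : f ∈ Algebra.adjoin E ((C : Set K) ∪ {u})) : ∃ N, b ^ N * f ∈ C := by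
  induction hf using Algebra.adjoin_induction with
  | mem x hx =>
    rcases hx with hx | rfl
    · exact ⟨0, by simpa using hx⟩
    · exact ⟨1, by simpa using hbu⟩
  | algebraMap r => exact ⟨0, by simp⟩
  | add x y _ _ hx hy =>
    obtain ⟨m, hm⟩ := hx
    obtain ⟨n, hn⟩ := hy
    refine ⟨m + n, ?_⟩
    have : b ^ (m + n) * (x + y) = b ^ n * (b ^ m * x) + b ^ m * (b ^ n * y) := by ring
    rw [this]
    exact C.add_mem (C.mul_mem (C.pow_mem hb _) hm) (C.mul_mem (C.pow_mem hb _) hn)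
  | mul x y _ _ hx hy =>
    obtain ⟨m, hm⟩ := hx
    obtain ⟨n, hn⟩ := hy
    refine ⟨m + n, ?_⟩
    have : b ^ (m + n) * (x * y) = (b ^ m * x) * (b ^ n * y) := by ring
    rw [this]
    exact C.mul_mem hm hn

theorem mem_span_of_forall_minimalPrimes {E K : Type*} [CommRing E] [IsDomain E]
    [IsNoetherianRing E] [Field K] [Algebra E K] [FaithfulSMul E K] (x : E) (hx : x ≠ 0)
    (y : integralClosure E K)
    (h : ∀ Q ∈ (Ideal.span {algebraMap E (integralClosure E K) x}).minimalPrimes,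
      ∃ s ∉ Q, s * y ∈ Ideal.span {algebraMap E (integralClosure E K) x}) :
    y ∈ Ideal.span {algebraMap E (integralClosure E K) x} := by
  let C := integralClosure E K
  have hxK : algebraMap E K x ≠ 0 := by
    rwa [Ne, FaithfulSMul.algebraMap_eq_zero_iff]
  by_cases hy0 : y = 0
  · rw [hy0]; exact zero_mem _
  have hyK : (y : K) ≠ 0 := fun h => hy0 (Subtype.ext h)
  by_contra hcon
  set u : K := algebraMap E K x / y with hu
  set z : K := y / algebraMap E K x with hz
  have huz : u * z = 1 := by rw [hu, hz]; field_simp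
  have hxu : algebraMap E K x = u * y := by rw [hu]; field_simp
  have hzC : z ∉ C := by
    intro hzC
    refine hcon (Ideal.mem_span_singleton.mpr ⟨⟨z, hzC⟩, Subtype.ext ?_⟩)
    change (y : K) = algebraMap E K x * z
    rw [hz]; field_simp
  let Eu := Algebra.adjoin E {u}
  let uE : Eu := ⟨u, Algebra.self_mem_adjoin_singleton E u⟩
  have hnu : ¬ IsUnit uE := by
    intro hun
    obtain ⟨v, hv⟩ := hun.exists_right_inv
    have hv' : u * (v : K) = 1 := congrArg Subtype.val hv
    have : (v : K) = z := mul_left_cancel₀ (left_ne_zero_of_mul_eq_one huz) (hv'.trans huz.symm)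
    exact hzC (isIntegral_of_mul_eq_one_of_mem_adjoin huz (this ▸ v.2))
  have : IsNoetherianRing Eu := by
    have : Algebra.FiniteType E Eu := (Subalgebra.fg_iff_finiteType _).mp ⟨{u}, by simp [Eu]⟩
    exact Algebra.FiniteType.isNoetherianRing E Eu
  obtain ⟨n, hn⟩ := Ideal.nonempty_minimalPrimes (I := Ideal.span {uE})
    (by rwa [Ne, Ideal.span_singleton_eq_top])
  have hnp : n.IsPrime := hn.1.1
  have hun : uE ∈ n := hn.1.2 (Ideal.mem_span_singleton_self _)
  have hnh : ∀ p : Ideal Eu, p.IsPrime → p < n → p = ⊥ := by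
    intro p hp hpn
    have h1 := Ideal.height_le_one_of_isPrincipal_of_mem_minimalPrimes _ n hn
    have h2 := (Ideal.height_le_iff (n := 1)).mp h1 p hp hpn
    have h3 : p.height = 0 := by
      rw [← Order.lt_one_iff]
      exact_mod_cast h2
    by_contra hbot
    have h4 := (Ideal.height_le_iff (n := 0)).mp h3.le ⊥ Ideal.isPrime_bot
      (bot_lt_iff_ne_bot.mpr hbot)
    exact not_lt_zero (α := ℕ∞) (by exact_mod_cast h4)
  let Cu := Algebra.adjoin E ((C : Set K) ∪ {u})
  have hle : Eu ≤ Cu := Algebra.adjoin_mono Set.subset_union_right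
  have hleC : C ≤ Cu := fun c hc => Algebra.subset_adjoin (Or.inl hc)
  let _ : Algebra Eu Cu := (Subalgebra.inclusion hle).toRingHom.toAlgebra
  have : IsScalarTower Eu Cu K := IsScalarTower.of_algebraMap_eq fun _ => rfl
  have hInteg : Algebra.IsIntegral Eu Cu := by
    refine ⟨fun f => ?_⟩
    rw [← isIntegral_algebraMap_iff (B := K) (Subtype.val_injective)]
    change IsIntegral Eu (f : K)
    have hsub : Cu ≤ (integralClosure Eu K).restrictScalars E := by
      refine Algebra.adjoin_le ?_
      rintro w (hw | rfl)
      · exact IsIntegral.tower_top (R := E) hw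
      · exact isIntegral_algebraMap (x := uE)
    exact hsub f.2
  have hker : RingHom.ker (algebraMap Eu Cu) ≤ n := by
    have hinj : Function.Injective (algebraMap Eu Cu) := Subalgebra.inclusion_injective hle
    rw [(RingHom.injective_iff_ker_eq_bot _).mp hinj]
    exact bot_le
  obtain ⟨n', hn'p, hn'⟩ := Ideal.exists_ideal_over_prime_of_isIntegral_of_isDomain n hker
  have hn'h : ∀ p : Ideal Cu, p.IsPrime → p ≤ n' → p ≠ ⊥ → p = n' := by
    intro p hp hpn hpb
    by_contra hne
    have h1 := Ideal.IsIntegral.comap_lt_comap (R := Eu) (lt_of_le_of_ne hpn hne)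
    rw [hn'] at h1
    exact hpb (Ideal.eq_bot_of_comap_eq_bot (hnh _ (Ideal.IsPrime.comap _) h1))
  have hu' : (⟨u, hle uE.2⟩ : Cu) ∈ n' := by
    have : uE ∈ n'.comap (algebraMap Eu Cu) := hn' ▸ hun
    exact this
  let ι : C →+* Cu := (Subalgebra.inclusion hleC).toRingHom
  let Q : Ideal C := n'.comap ι
  have hQp : Q.IsPrime := Ideal.IsPrime.comap ι
  have hQu : ∀ c c' : C, (c : K) = c' * u → c ∈ Q := by
    intro c c' hcc
    have : ι c = ι c' * ⟨u, hle uE.2⟩ := Subtype.ext hcc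
    change ι c ∈ n'
    rw [this]
    exact Ideal.mul_mem_left _ _ hu'
  have hxQ : algebraMap E C x ∈ Q := hQu _ y (by rw [mul_comm]; exact hxu)
  let P : Ideal E := Q.comap (algebraMap E C)
  have hPp : P.IsPrime := Ideal.IsPrime.comap _
  have hrel : ∃ f : E[X], aeval u f = 0 ∧ ∃ i, f.coeff i ∉ P := by
    by_contra! hno
    obtain ⟨p, hp, hpe, hup⟩ := exists_prime_adjoin_of_relations u P hno
    have hpn : p ≤ n := by
      rw [hpe, Ideal.map_le_iff_le_comap, ← hn']
      exact fun a ha => ha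
    have hlt : p < n := lt_of_le_of_ne hpn (fun h => hup (h ▸ hun))
    have hxp : algebraMap E Eu x ∈ p := hpe ▸ Ideal.mem_map_of_mem _ hxQ
    rw [hnh p hp hlt, Ideal.mem_bot] at hxp
    exact hxK (congrArg Subtype.val hxp)
  obtain ⟨f, hf, i, hi⟩ := hrel
  obtain ⟨b, hbQ, c, hc⟩ := exists_notMem_mul_mem_of_aeval_eq_zero (C := C) (K := K)
    (fun z hz => ⟨⟨z, isIntegral_trans (A := C) z hz⟩, rfl⟩) u Q (fun c c' => hQu c c') _
    (f.map (algebraMap E C)) le_rfl (by rwa [aeval_map_algebraMap])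
    ⟨i, by rw [coeff_map]; exact hi⟩
  have hbu : (b : K) * u ∈ C := by
    have : (b : K) * u = c := hc.symm
    exact this ▸ c.2
  have hmin : Q ∈ (Ideal.span {algebraMap E C x}).minimalPrimes := by
    refine ⟨⟨hQp, (Ideal.span_singleton_le_iff_mem _).mpr hxQ⟩, ?_⟩
    rintro q ⟨hq, hxq⟩ hqQ
    rw [Ideal.span_singleton_le_iff_mem] at hxq
    have hbq : b ∉ q := fun h => hbQ (hqQ h)
    let r : Ideal Cu :=
      { carrier := {f | ∃ N, ∃ a ∈ q, (a : K) = b ^ N * f}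
        zero_mem' := ⟨0, 0, q.zero_mem, by simp⟩
        add_mem' := by
          rintro f g ⟨N, a, ha, hf⟩ ⟨N', a', ha', hg⟩
          refine ⟨N + N', b ^ N' * a + b ^ N * a',
            q.add_mem (q.mul_mem_left _ ha) (q.mul_mem_left _ ha'), ?_⟩
          push_cast
          rw [hf, hg]
          ring
        smul_mem' := by
          rintro g f ⟨N, a, ha, hf⟩
          obtain ⟨N', hN'⟩ := exists_pow_mul_mem_of_mem_adjoin C b.2 hbu g.2
          refine ⟨N' + N, ⟨_, hN'⟩ * a, q.mul_mem_left _ ha, ?_⟩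
          simp only [smul_eq_mul]
          push_cast
          rw [hf]
          ring }
    have hrC : ∀ c : C, ι c ∈ r → c ∈ q := by
      rintro c ⟨N, a, ha, hac⟩
      have h1 : a = b ^ N * c := Subtype.ext hac
      rw [h1] at ha
      exact (hq.mem_or_mem ha).resolve_left (fun h => hbq (hq.mem_of_pow_mem _ h))
    have hrp : r.IsPrime := by
      refine ⟨?_, ?_⟩
      · rw [Ne, Ideal.eq_top_iff_one]
        intro h1
        exact hq.ne_top ((Ideal.eq_top_iff_one _).mpr (hrC 1 (by rwa [map_one])))
      · rintro f g ⟨N, a, ha, hfg⟩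
        obtain ⟨k, hk⟩ := exists_pow_mul_mem_of_mem_adjoin C b.2 hbu f.2
        obtain ⟨l, hl⟩ := exists_pow_mul_mem_of_mem_adjoin C b.2 hbu g.2
        have h1 : (⟨_, hk⟩ * ⟨_, hl⟩ * b ^ N : C) = b ^ (k + l) * a := by
          apply Subtype.ext
          push_cast
          rw [hfg]
          push_cast
          ring
        have h2 : (⟨_, hk⟩ * ⟨_, hl⟩ * b ^ N : C) ∈ q := h1 ▸ q.mul_mem_left _ ha
        rcases hq.mem_or_mem ((hq.mem_or_mem h2).resolve_right
          (fun h => hbq (hq.mem_of_pow_mem _ h))) with h3 | h3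
        · exact Or.inl ⟨k, _, h3, rfl⟩
        · exact Or.inr ⟨l, _, h3, rfl⟩
    have hrn : r ≤ n' := by
      rintro f ⟨N, a, ha, haf⟩
      have h1 : ι a = ι b ^ N * f := Subtype.ext haf
      have h2 : ι b ^ N * f ∈ n' := h1 ▸ (hqQ ha : a ∈ Q)
      exact (hn'p.mem_or_mem h2).resolve_left (fun h => hbQ (hn'p.mem_of_pow_mem _ h))
    have hr0 : r ≠ ⊥ := by
      intro hr0
      have h1 : ι (algebraMap E C x) ∈ r := ⟨0, _, hxq, by simp; rfl⟩
      rw [hr0, Ideal.mem_bot] at h1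
      exact hxK (congrArg Subtype.val h1)
    intro c hc
    refine hrC c ?_
    rw [hn'h r hrp hrn hr0]
    exact hc
  obtain ⟨s, hs, hsy⟩ := h Q hmin
  obtain ⟨w, hw⟩ := Ideal.mem_span_singleton.mp hsy
  refine hs (hQu s w ?_)
  have hw' : (s : K) * y = algebraMap E K x * w := congrArg Subtype.val hw
  have : (s : K) * y = (w * u) * y := by rw [hw', hxu]; ring
  exact mul_right_cancel₀ hyK this

end Normalization

section Lengths

lemma length_ne_top_of_pow_le_annihilator {R N : Type*} [CommRing R] [IsNoetherianRing R]
    [AddCommGroup N] [Module R N] [Module.Finite R N] (m : Ideal R) [m.IsMaximal] (j : ℕ)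
    (h : ∀ a ∈ m ^ j, ∀ v : N, a • v = 0) : Module.length R N ≠ ⊤ := by
  have hart : IsArtinianRing (R ⧸ m ^ j) := by
    rw [isArtinianRing_iff_isNoetherianRing_krullDimLE_zero]
    refine ⟨inferInstance, ?_⟩
    rw [Ring.krullDimLE_zero_iff]
    intro p hp
    have h1 : m ^ j ≤ p.comap (Ideal.Quotient.mk (m ^ j)) := fun a ha => by
      rw [Ideal.mem_comap, Ideal.Quotient.eq_zero_iff_mem.mpr ha]
      exact zero_mem _
    have h2 : m ≤ p.comap (Ideal.Quotient.mk (m ^ j)) := Ideal.IsPrime.le_of_pow_le h1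
    have h3 : m = p.comap (Ideal.Quotient.mk (m ^ j)) :=
      Ideal.IsMaximal.eq_of_le inferInstance (Ideal.IsPrime.comap _).ne_top h2
    have h4 : p = m.map (Ideal.Quotient.mk (m ^ j)) :=
      (Ideal.map_comap_of_surjective _ Ideal.Quotient.mk_surjective p).symm.trans
        (congrArg _ h3.symm)
    have h5 := Ideal.map_eq_top_or_isMaximal_of_surjective _
      (Ideal.Quotient.mk_surjective (I := m ^ j)) (I := m) inferInstance
    rw [← h4] at h5
    exact h5.resolve_left hp.ne_top
  have ht : Module.IsTorsionBySet R N (m ^ j : Ideal R) := fun v a => h a a.2 v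
  let _ := ht.module
  have := ht.isScalarTower (S := R)
  have : Module.Finite (R ⧸ m ^ j) N := Module.Finite.of_restrictScalars_finite R _ N
  rw [Module.length_eq_of_surjective (S := R) (R := R ⧸ m ^ j) Ideal.Quotient.mk_surjective]
  exact Module.length_ne_top

/-- A module all of whose finitely generated submodules have length at most `h`
has length at most `h`. -/
lemma length_le_of_forall_fg {R N : Type*} [CommRing R] [AddCommGroup N] [Module R N] (h : ℕ)
    (H : ∀ F : Submodule R N, F.FG → Module.length R F ≤ h) : Module.length R N ≤ h := by
  classical
  obtain ⟨F, hF, hmax⟩ : ∃ F : Submodule R N, F.FG ∧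
      ∀ G : Submodule R N, G.FG → Module.length R G ≤ Module.length R F := by
    by_contra! hcon
    have : ∀ n : ℕ, ∃ F : Submodule R N, F.FG ∧ (n : ℕ∞) ≤ Module.length R F := by
      intro n
      induction n with
      | zero => exact ⟨⊥, Submodule.fg_bot, by simp⟩
      | succ n ih =>
        obtain ⟨F, hF, hn⟩ := ih
        obtain ⟨G, hG, hlt⟩ := hcon F hF
        refine ⟨G, hG, ?_⟩
        push_cast
        exact Order.add_one_le_of_lt (hn.trans_lt hlt)
    obtain ⟨F, hF, hn⟩ := this (h + 1)
    have := hn.trans (H F hF)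
    norm_cast at this
    lia
  have htop : F = ⊤ := by
    rw [eq_top_iff]
    intro v _
    by_contra hv
    let G := F ⊔ Submodule.span R {v}
    have hG : G.FG := hF.sup (Submodule.fg_span_singleton v)
    have hGne : Module.length R G ≠ ⊤ := ne_top_of_le_ne_top (ENat.natCast_ne_top h) (H G hG)
    have hfin := isFiniteLength_iff_isNoetherian_isArtinian.mp (Module.length_ne_top_iff.mp hGne)
    have := hfin.1
    have := hfin.2
    have hlt := Submodule.length_lt (N := F.comap G.subtype) (by
      intro htop
      rw [Submodule.comap_subtype_eq_top] at htop
      exact hv (htop (Submodule.mem_sup_right (Submodule.mem_span_singleton_self v))))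
    rw [(Submodule.comapSubtypeEquivOfLe (le_sup_left : F ≤ G)).length_eq] at hlt
    exact absurd (hmax G hG) (not_le.mpr hlt)
  rw [← Module.length_top (R := R) (M := N), ← htop]
  exact H F hF

/-- The submodule of elements killed by a power of `m`. -/
def powTorsion {R : Type*} [CommRing R] (m : Ideal R) (N : Type*) [AddCommGroup N] [Module R N] :
    Submodule R N where
  carrier := {v | ∃ j, ∀ a ∈ m ^ j, a • v = 0}
  zero_mem' := ⟨0, by simp⟩
  add_mem' := by
    rintro v w ⟨i, hi⟩ ⟨j, hj⟩
    refine ⟨i + j, fun a ha => ?_⟩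
    rw [smul_add, hi a (Ideal.pow_le_pow_right (Nat.le_add_right i j) ha),
      hj a (Ideal.pow_le_pow_right (Nat.le_add_left j i) ha), add_zero]
  smul_mem' := by
    rintro c v ⟨i, hi⟩
    exact ⟨i, fun a ha => by rw [smul_comm, hi a ha, smul_zero]⟩

lemma map_mem_powTorsion {R : Type*} [CommRing R] {m : Ideal R} {N P : Type*} [AddCommGroup N]
    [Module R N] [AddCommGroup P] [Module R P] (f : N →ₗ[R] P) {v : N}
    (hv : v ∈ powTorsion m N) : f v ∈ powTorsion m P := by
  obtain ⟨j, hj⟩ := hv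
  exact ⟨j, fun a ha => by rw [← map_smul, hj a ha, map_zero]⟩

lemma length_powTorsion_ne_top {R N : Type*} [CommRing R] [IsNoetherianRing R]
    [AddCommGroup N] [Module R N] [Module.Finite R N] (m : Ideal R) [m.IsMaximal] :
    Module.length R (powTorsion m N) ≠ ⊤ := by
  classical
  obtain ⟨T, hT⟩ := IsNoetherian.noetherian (powTorsion m N)
  have h1 : ∀ v : N, ∃ j, v ∈ T → ∀ a ∈ m ^ j, a • v = 0 := fun v => by
    by_cases hv : v ∈ T
    · have : v ∈ powTorsion m N := hT ▸ Submodule.subset_span hv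
      obtain ⟨j, hj⟩ := this
      exact ⟨j, fun _ => hj⟩
    · exact ⟨0, fun h => absurd h hv⟩
  choose j hj using h1
  refine length_ne_top_of_pow_le_annihilator m (T.sup j) ?_
  rintro a ha ⟨v, hv⟩
  apply Subtype.ext
  change a • v = 0
  rw [← hT] at hv
  induction hv using Submodule.span_induction with
  | mem x hx => exact hj x hx a (Ideal.pow_le_pow_right (Finset.le_sup hx) ha)
  | zero => simp
  | add x y _ _ hx hy => rw [smul_add, hx, hy, add_zero]
  | smul c x _ hx => rw [smul_comm, hx, smul_zero]

lemma length_powTorsion_le {R : Type*} [CommRing R] (m : Ideal R) {N' N N'' : Type*}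
    [AddCommGroup N'] [Module R N'] [AddCommGroup N] [Module R N] [AddCommGroup N''] [Module R N'']
    (f : N' →ₗ[R] N) (g : N →ₗ[R] N'') (hf : Function.Injective f) (hfg : Function.Exact f g) :
    Module.length R (powTorsion m N) ≤
      Module.length R (powTorsion m N') + Module.length R (powTorsion m N'') := by
  let f' : powTorsion m N' →ₗ[R] powTorsion m N :=
    f.restrict fun v hv => map_mem_powTorsion f hv
  let g' : powTorsion m N →ₗ[R] powTorsion m N'' :=
    g.restrict fun v hv => map_mem_powTorsion g hv
  have hf' : Function.Injective f' := fun v w h => Subtype.ext (hf (congrArg Subtype.val h))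
  have hex : Function.Exact f' g'.rangeRestrict := by
    rintro ⟨v, hv⟩
    constructor
    · intro h
      have h0 : g v = 0 := congrArg (fun t => ((t : LinearMap.range g') : powTorsion m N'').1) h
      obtain ⟨w, rfl⟩ := (hfg v).mp h0
      obtain ⟨j, hj⟩ := hv
      exact ⟨⟨w, j, fun a ha => hf (by rw [map_smul, hj a ha, map_zero])⟩, rfl⟩
    · rintro ⟨w, hw⟩
      apply Subtype.ext
      apply Subtype.ext
      change g v = 0
      have hv' : f w = v := congrArg Subtype.val hw
      exact (hfg _).mpr ⟨w, hv'⟩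
  rw [Module.length_eq_add_of_exact f' g'.rangeRestrict hf' g'.surjective_rangeRestrict hex]
  exact add_le_add_right (Module.length_le_of_injective (LinearMap.range g').subtype
    (Submodule.subtype_injective _)) _

lemma length_powTorsion_quotient_pow_le {R : Type*} [CommRing R] [IsDomain R] (m : Ideal R) {x : R}
    (hx : x ≠ 0) (n : ℕ) : Module.length R (powTorsion m (R ⧸ Ideal.span {x ^ n})) ≤
      n * Module.length R (powTorsion m (R ⧸ Ideal.span {x})) := by
  induction n with
  | zero =>
    have : Subsingleton (R ⧸ Ideal.span {x ^ 0}) := by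
      rw [pow_zero, Ideal.span_singleton_one]
      infer_instance
    simp
  | succ n ih =>
    let f : (R ⧸ Ideal.span {x ^ n}) →ₗ[R] (R ⧸ Ideal.span {x ^ (n + 1)}) :=
      Submodule.mapQ _ _ (LinearMap.mulLeft R x) (by
        intro a ha
        obtain ⟨b, rfl⟩ := Ideal.mem_span_singleton.mp ha
        exact Ideal.mem_span_singleton.mpr ⟨b, by simp; ring⟩)
    let g : (R ⧸ Ideal.span {x ^ (n + 1)}) →ₗ[R] (R ⧸ Ideal.span {x}) :=
      Submodule.mapQ _ _ LinearMap.id (by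
        intro a ha
        obtain ⟨b, rfl⟩ := Ideal.mem_span_singleton.mp ha
        exact Ideal.mem_span_singleton.mpr ⟨x ^ n * b, by ring⟩)
    have hf : Function.Injective f := by
      rw [injective_iff_map_eq_zero]
      intro v hv
      obtain ⟨a, rfl⟩ := Submodule.Quotient.mk_surjective _ v
      have h1 : x * a ∈ Ideal.span {x ^ (n + 1)} := (Submodule.Quotient.mk_eq_zero _).mp hv
      obtain ⟨b, hb⟩ := Ideal.mem_span_singleton.mp h1
      rw [Submodule.Quotient.mk_eq_zero]
      exact Ideal.mem_span_singleton.mpr ⟨b, mul_left_cancel₀ hx (by rw [hb]; ring)⟩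
    have hex : Function.Exact f g := by
      intro v
      obtain ⟨a, rfl⟩ := Submodule.Quotient.mk_surjective _ v
      constructor
      · intro h
        have h1 : a ∈ Ideal.span {x} := (Submodule.Quotient.mk_eq_zero _).mp h
        obtain ⟨b, rfl⟩ := Ideal.mem_span_singleton.mp h1
        exact ⟨Submodule.Quotient.mk b, rfl⟩
      · rintro ⟨w, hw⟩
        obtain ⟨b, rfl⟩ := Submodule.Quotient.mk_surjective _ w
        rw [← hw]
        exact (Submodule.Quotient.mk_eq_zero _).mpr (Ideal.mem_span_singleton.mpr ⟨b, rfl⟩)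
    refine (length_powTorsion_le m f g hf hex).trans ?_
    push_cast
    rw [add_mul, one_mul]
    exact add_le_add_left ih _

end Lengths

section Saturation

/-- The contraction to `R` of the extension of `J` to the localization at `q`. -/
def satur {R : Type*} [CommRing R] (J : Ideal R) (q : PrimeSpectrum R) : Ideal R where
  carrier := {d | ∃ s ∉ q.asIdeal, s * d ∈ J}
  zero_mem' := ⟨1, (Ideal.ne_top_iff_one _).mp q.isPrime.ne_top, by simp⟩
  add_mem' := by
    rintro d e ⟨s, hs, hsd⟩ ⟨t, ht, hte⟩
    refine ⟨s * t, fun h => (q.isPrime.mem_or_mem h).elim hs ht, ?_⟩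
    rw [show s * t * (d + e) = t * (s * d) + s * (t * e) by ring]
    exact J.add_mem (J.mul_mem_left _ hsd) (J.mul_mem_left _ hte)
  smul_mem' := by
    rintro c d ⟨s, hs, hsd⟩
    refine ⟨s, hs, ?_⟩
    rw [smul_eq_mul, mul_left_comm]
    exact J.mul_mem_left _ hsd

lemma exists_mul_pow_mem_of_forall_prime {R : Type*} [CommRing R] (J : Ideal R)
    (q : PrimeSpectrum R) (y : R)
    (h : ∀ P : Ideal R, P.IsPrime → J ≤ P → P ≤ q.asIdeal → y ∈ P) :
    ∃ s ∉ q.asIdeal, ∃ b, s * y ^ b ∈ J := by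
  by_contra! hcon
  obtain ⟨P, hP, hJP, hd⟩ := Ideal.exists_le_prime_disjoint J
    (q.asIdeal.primeCompl ⊔ Submonoid.powers y) (by
      rw [Set.disjoint_left]
      intro a ha ha'
      obtain ⟨s, hs, t, ⟨b, rfl⟩, rfl⟩ := Submonoid.mem_sup.mp ha'
      exact hcon s hs b ha)
  rw [Set.disjoint_left] at hd
  have hle : P ≤ q.asIdeal := fun a ha => by
    by_contra hq
    exact hd ha (Submonoid.mem_sup_left (show a ∈ q.asIdeal.primeCompl from hq))
  exact hd (h P hP hJP hle) (Submonoid.mem_sup_right (Submonoid.mem_powers y))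

lemma exists_notMem_forall_mul_mem_of_le_satur {R : Type*} [CommRing R] (J : Ideal R)
    (q : PrimeSpectrum R) (a : Ideal R) (ha : a.FG) (h : a ≤ satur J q) :
    ∃ s ∉ q.asIdeal, ∀ v ∈ a, s * v ∈ J := by
  induction a, ha using Submodule.fg_induction with
  | singleton v =>
    obtain ⟨s, hs, hsv⟩ := h (Ideal.mem_span_singleton_self v)
    refine ⟨s, hs, fun w hw => ?_⟩
    obtain ⟨c, rfl⟩ := Ideal.mem_span_singleton.mp hw
    rw [← mul_assoc]
    exact J.mul_mem_right _ hsv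
  | sup a b ha hb iha ihb =>
    obtain ⟨s, hs, hsv⟩ := iha (le_sup_left.trans h)
    obtain ⟨t, ht, htv⟩ := ihb (le_sup_right.trans h)
    refine ⟨s * t, fun h => (q.isPrime.mem_or_mem h).elim hs ht, fun v hv => ?_⟩
    obtain ⟨c, hc, d, hd, rfl⟩ := Submodule.mem_sup.mp hv
    rw [show s * t * (c + d) = t * (s * c) + s * (t * d) by ring]
    exact J.add_mem (J.mul_mem_left _ (hsv _ hc)) (J.mul_mem_left _ (htv _ hd))

/-- The intersection of the `satur J q` for `q` in a finite set, as a submodule over a base. -/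
def saturAll (L : Type*) {D : Type*} [CommRing L] [CommRing D] [Algebra L D] (J : Ideal D)
    (S : Finset (PrimeSpectrum D)) : Submodule L D :=
  (⨅ q ∈ S, satur J q).restrictScalars L

lemma mem_saturAll {L D : Type*} [CommRing L] [CommRing D] [Algebra L D] {J : Ideal D}
    {S : Finset (PrimeSpectrum D)} {d : D} :
    d ∈ saturAll L J S ↔ ∀ q ∈ S, ∃ s ∉ q.asIdeal, s * d ∈ J := by
  rw [saturAll, Submodule.restrictScalars_mem]
  simp only [Submodule.mem_iInf]
  rfl

lemma eq_of_le_of_mem_minimalPrimes_span {D : Type*} [CommRing D] [IsDomain D]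
    [IsNoetherianRing D] (x : D) (q P : Ideal D) (hq : q ∈ (Ideal.span {x}).minimalPrimes)
    [hP : P.IsPrime] (hP0 : P ≠ ⊥) (hle : P ≤ q) : P = q := by
  have hqp : q.IsPrime := hq.1.1
  by_contra hne
  have h1 : q.height ≤ 1 :=
    Ideal.height_le_one_of_isPrincipal_of_mem_minimalPrimes (Ideal.span {x}) q hq
  have h2 := (Ideal.height_le_iff (n := 1)).mp h1 P hP (lt_of_le_of_ne hle hne)
  have h3 : P.height = 0 := by simpa using h2
  have h4 : P ≤ ⊥ := (Ideal.height_eq_zero_iff.mp h3).2 ⟨Ideal.isPrime_bot, bot_le⟩ bot_le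
  exact hP0 (le_bot_iff.mp h4)

lemma mul_length_quotient_saturAll_le {L D : Type*} [CommRing L] [CommRing D] [IsDomain D]
    [Algebra L D] (x : D) (hx : x ≠ 0) (S : Finset (PrimeSpectrum D)) (k : ℕ) :
    k * Module.length L (D ⧸ saturAll L (Ideal.span {x}) S) ≤
      Module.length L (D ⧸ saturAll L (Ideal.span {x ^ k}) S) := by
  induction k with
  | zero => simp
  | succ k ih =>
    let f : (D ⧸ saturAll L (Ideal.span {x}) S) →ₗ[L] (D ⧸ saturAll L (Ideal.span {x ^ (k + 1)}) S) :=
      Submodule.mapQ _ _ (LinearMap.mulLeft L (x ^ k)) (by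
        intro d hd
        rw [Submodule.mem_comap, mem_saturAll]
        rw [mem_saturAll] at hd
        intro q hq
        obtain ⟨s, hs, hsd⟩ := hd q hq
        obtain ⟨e, he⟩ := Ideal.mem_span_singleton.mp hsd
        refine ⟨s, hs, Ideal.mem_span_singleton.mpr ⟨e, ?_⟩⟩
        rw [LinearMap.mulLeft_apply, mul_left_comm, he]
        ring)
    have hf : Function.Injective f := by
      rw [injective_iff_map_eq_zero]
      intro v hv
      obtain ⟨d, rfl⟩ := Submodule.Quotient.mk_surjective _ v
      have h1 : x ^ k * d ∈ saturAll L (Ideal.span {x ^ (k + 1)}) S :=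
        (Submodule.Quotient.mk_eq_zero _).mp hv
      rw [Submodule.Quotient.mk_eq_zero, mem_saturAll]
      rw [mem_saturAll] at h1
      intro q hq
      obtain ⟨s, hs, hsd⟩ := h1 q hq
      obtain ⟨e, he⟩ := Ideal.mem_span_singleton.mp hsd
      exact ⟨s, hs, Ideal.mem_span_singleton.mpr
        ⟨e, mul_left_cancel₀ (pow_ne_zero k hx) (by rw [mul_left_comm, he]; ring)⟩⟩
    rw [Module.length_eq_add_of_exact f (LinearMap.range f).mkQ hf (Submodule.mkQ_surjective _)
      (LinearMap.exact_map_mkQ_range f)]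
    push_cast
    rw [add_mul, one_mul, add_comm]
    refine add_le_add le_rfl (ih.trans ?_)
    let g : (D ⧸ saturAll L (Ideal.span {x ^ (k + 1)}) S) →ₗ[L] (D ⧸ saturAll L (Ideal.span {x ^ k}) S) :=
      Submodule.mapQ _ _ LinearMap.id (by
        intro d hd
        rw [Submodule.mem_comap, mem_saturAll]
        rw [mem_saturAll] at hd
        intro q hq
        obtain ⟨s, hs, hsd⟩ := hd q hq
        obtain ⟨e, he⟩ := Ideal.mem_span_singleton.mp hsd
        refine ⟨s, hs, Ideal.mem_span_singleton.mpr ⟨x * e, ?_⟩⟩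
        rw [LinearMap.id_apply, he]
        ring)
    have hg : Function.Surjective g := by
      intro v
      obtain ⟨d, rfl⟩ := Submodule.Quotient.mk_surjective _ v
      exact ⟨Submodule.Quotient.mk d, rfl⟩
    have hle : LinearMap.range f ≤ LinearMap.ker g := by
      rintro _ ⟨v, rfl⟩
      obtain ⟨d, rfl⟩ := Submodule.Quotient.mk_surjective _ v
      have : x ^ k * d ∈ saturAll L (Ideal.span {x ^ k}) S := mem_saturAll.mpr fun q _ =>
        ⟨1, (Ideal.ne_top_iff_one _).mp q.isPrime.ne_top,
          Ideal.mem_span_singleton.mpr ⟨d, one_mul _⟩⟩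
      exact (Submodule.Quotient.mk_eq_zero _).mpr this
    refine Module.length_le_of_surjective ((LinearMap.range f).liftQ g hle) fun v => ?_
    obtain ⟨w, rfl⟩ := hg v
    exact ⟨Submodule.Quotient.mk w, rfl⟩

lemma exists_length_quotient_saturAll_le {L D : Type*} [CommRing L] [IsDomain L]
    [IsNoetherianRing L] (m : Ideal L) [CommRing D] [IsDomain D] [Algebra L D]
    [Module.Finite L D] [FaithfulSMul L D] (x : L) (hx : x ≠ 0) (c : L) (hc : c ≠ 0)
    (hcD : ∀ d : D, ∃ l, algebraMap L D l = algebraMap L D c * d) (S : Finset (PrimeSpectrum D))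
    (hS : ∀ q ∈ S, q.asIdeal ∈ (Ideal.span {algebraMap L D x}).minimalPrimes ∧
      q.asIdeal.comap (algebraMap L D) = m) :
    ∃ b : ℕ, ∀ n : ℕ, Module.length L (D ⧸ saturAll L (Ideal.span {algebraMap L D x ^ n}) S) ≤
      Module.length L (powTorsion m (L ⧸ Ideal.span {x ^ (n + b)})) := by
  classical
  have hinj : Function.Injective (algebraMap L D) := FaithfulSMul.algebraMap_injective L D
  have hcD0 : algebraMap L D c ≠ 0 := by
    rwa [Ne, map_eq_zero_iff _ hinj]
  have hxD0 : algebraMap L D x ≠ 0 := by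
    rwa [Ne, map_eq_zero_iff _ hinj]
  have hnoeth : IsNoetherianRing D := isNoetherian_of_isNoetherianRing_of_finite L D |>
    fun h => isNoetherian_of_tower L h
  choose l hl using hcD
  let l' : D →ₗ[L] L :=
    { toFun := l
      map_add' := fun d e => hinj (by rw [map_add, hl, hl, hl, mul_add])
      map_smul' := fun a d => hinj (by
        rw [hl, RingHom.id_apply, smul_eq_mul, map_mul, hl, Algebra.smul_def]; ring) }
  have hl' : ∀ d, algebraMap L D (l' d) = algebraMap L D c * d := hl
  have hconductor : ∀ q : PrimeSpectrum D, ∃ b : ℕ, q ∈ S →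
      ∃ s ∉ q.asIdeal, s * algebraMap L D x ^ b ∈ Ideal.span {algebraMap L D c} := by
    intro q
    by_cases hq : q ∈ S
    · obtain ⟨s, hs, b, hb⟩ := exists_mul_pow_mem_of_forall_prime
        (Ideal.span {algebraMap L D c}) q (algebraMap L D x) (fun P hP hcP hPq => by
          have hP0 : P ≠ ⊥ := fun h => hcD0 (by
            have := hcP (Ideal.mem_span_singleton_self _)
            rwa [h, Ideal.mem_bot] at this)
          rw [eq_of_le_of_mem_minimalPrimes_span _ _ P (hS q hq).1 hP0 hPq]
          exact (hS q hq).1.1.2 (Ideal.mem_span_singleton_self _))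
      exact ⟨b, fun _ => ⟨s, hs, hb⟩⟩
    · exact ⟨0, fun h => absurd h hq⟩
  choose b hb using hconductor
  have hidem : ∀ q : PrimeSpectrum D, ∃ j : ℕ, ∃ e : D, q ∈ S → e ∉ q.asIdeal ∧
      (∀ q' ∈ S, q' ≠ q → e ∈ q'.asIdeal) ∧
      m.map (algebraMap L D) ^ j * Ideal.span {e} ≤ Ideal.span {algebraMap L D x} := by
    intro q
    by_cases hq : q ∈ S
    swap
    · exact ⟨0, 0, fun h => absurd h hq⟩
    have hrad : m.map (algebraMap L D) ≤ (satur (Ideal.span {algebraMap L D x}) q).radical := by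
      rw [Ideal.map_le_iff_le_comap]
      intro a ha
      obtain ⟨s, hs, k, hk⟩ := exists_mul_pow_mem_of_forall_prime
        (Ideal.span {algebraMap L D x}) q (algebraMap L D a) (fun P hP hxP hPq => by
          have : q.asIdeal ≤ P := (hS q hq).1.2 ⟨hP, hxP⟩ hPq
          apply this
          rw [← (hS q hq).2] at ha
          exact ha)
      exact ⟨k, s, hs, hk⟩
    obtain ⟨j, hj⟩ := Ideal.exists_pow_le_of_le_radical_of_fg hrad (IsNoetherian.noetherian _)
    obtain ⟨t, ht, htm⟩ := exists_notMem_forall_mul_mem_of_le_satur _ q _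
      (IsNoetherian.noetherian _) hj
    have hnle : ¬ (S.erase q).inf (fun q' => q'.asIdeal) ≤ q.asIdeal := by
      intro hle
      obtain ⟨q', hq', hle'⟩ := (Ideal.IsPrime.inf_le' q.isPrime).mp hle
      obtain ⟨hne, hq'S⟩ := Finset.mem_erase.mp hq'
      exact hne (PrimeSpectrum.ext (le_antisymm hle'
        ((hS q hq).1.2 ⟨q'.isPrime, (hS q' hq'S).1.1.2⟩ hle')))
    obtain ⟨u, hu, huq⟩ := SetLike.not_le_iff_exists.mp hnle
    refine ⟨j, t * u, fun _ => ⟨fun h => (q.isPrime.mem_or_mem h).elim ht huq,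
      fun q' hq' hne => ?_, ?_⟩⟩
    · exact Ideal.mul_mem_left _ _ ((Finset.inf_le (Finset.mem_erase.mpr ⟨hne, hq'⟩) :
        (S.erase q).inf (fun q' => q'.asIdeal) ≤ q'.asIdeal) hu)
    · rw [Ideal.mul_le]
      intro v hv w hw
      obtain ⟨z, rfl⟩ := Ideal.mem_span_singleton.mp hw
      rw [show v * (t * u * z) = (u * z) * (t * v) by ring]
      exact Ideal.mul_mem_left _ _ (htm v hv)
  choose j e he using hidem
  refine ⟨S.sup b + 1, fun n => ?_⟩
  let N := n + (S.sup b + 1)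
  let E : D := ∑ q ∈ S, e q ^ N
  have hE : ∀ q ∈ S, E ∉ q.asIdeal := by
    intro q hq hEq
    have h1 : E = e q ^ N + ∑ q' ∈ S.erase q, e q' ^ N := (Finset.add_sum_erase S _ hq).symm
    have h2 : ∑ q' ∈ S.erase q, e q' ^ N ∈ q.asIdeal := by
      refine Ideal.sum_mem _ fun q' hq' => Ideal.pow_mem_of_mem _ ?_ _ (by lia)
      obtain ⟨hne, hq'S⟩ := Finset.mem_erase.mp hq'
      exact (he q' hq'S).2.1 q hq hne.symm
    rw [h1] at hEq
    exact (he q hq).1 (q.isPrime.mem_of_pow_mem _ ((Ideal.add_mem_iff_left _ h2).mp hEq))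
  have hmE : ∀ a ∈ m ^ (S.sup j * N), algebraMap L D a * E ∈ Ideal.span {algebraMap L D x ^ N} := by
    intro a ha
    rw [Finset.mul_sum]
    refine Ideal.sum_mem _ fun q hq => ?_
    have h1 : (m.map (algebraMap L D) ^ (S.sup j) * Ideal.span {e q}) ^ N ≤
        Ideal.span {algebraMap L D x} ^ N :=
      Ideal.pow_right_mono ((Ideal.mul_mono_left (Ideal.pow_le_pow_right
        (Finset.le_sup (f := j) hq))).trans (he q hq).2.2) N
    rw [mul_pow, ← pow_mul, Ideal.span_singleton_pow, Ideal.span_singleton_pow,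
      ← Ideal.map_pow] at h1
    exact h1 (Ideal.mul_mem_mul (Ideal.mem_map_of_mem _ ha) (Ideal.mem_span_singleton_self _))
  let φ : D →ₗ[L] (L ⧸ Ideal.span {x ^ N}) :=
    (Submodule.mkQ (Ideal.span {x ^ N})) ∘ₗ l' ∘ₗ LinearMap.mulLeft L E
  have hφ : ∀ d, φ d ∈ powTorsion m (L ⧸ Ideal.span {x ^ N}) := by
    intro d
    refine ⟨S.sup j * N, fun a ha => ?_⟩
    obtain ⟨z, hz⟩ := Ideal.mem_span_singleton.mp (hmE a ha)
    change Submodule.Quotient.mk (a • l' (E * d)) = 0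
    rw [Submodule.Quotient.mk_eq_zero]
    refine Ideal.mem_span_singleton.mpr ⟨l' (z * d), hinj ?_⟩
    rw [smul_eq_mul, map_mul, hl', map_mul, hl', map_pow]
    linear_combination (algebraMap L D c * d) * hz
  have hker : LinearMap.ker φ ≤ saturAll L (Ideal.span {algebraMap L D x ^ n}) S := by
    intro d hd
    rw [mem_saturAll]
    intro q hq
    obtain ⟨z, hz⟩ := Ideal.mem_span_singleton.mp ((Submodule.Quotient.mk_eq_zero _).mp hd :
      l' (E * d) ∈ Ideal.span {x ^ N})
    obtain ⟨s, hs, hsb⟩ := hb q hq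
    obtain ⟨w, hw⟩ := Ideal.mem_span_singleton.mp hsb
    have h1 := congrArg (algebraMap L D) hz
    rw [hl', map_mul, map_pow] at h1
    refine ⟨s * E, fun h => (q.isPrime.mem_or_mem h).elim hs (hE q hq),
      Ideal.mem_span_singleton.mpr ⟨w * algebraMap L D x ^ (N - n - b q) * algebraMap L D z,
        mul_left_cancel₀ (pow_ne_zero (b q) hxD0) ?_⟩⟩
    have hN : N = n + b q + (N - n - b q) := by
      have := Finset.le_sup (f := b) hq
      lia
    have h2 : algebraMap L D x ^ N =
        algebraMap L D x ^ n * algebraMap L D x ^ b q * algebraMap L D x ^ (N - n - b q) := by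
      rw [← pow_add, ← pow_add, ← hN]
    rw [h2] at h1
    linear_combination (E * d) * hw + w * h1
  let φ' : D →ₗ[L] powTorsion m (L ⧸ Ideal.span {x ^ N}) := φ.codRestrict _ hφ
  have hker' : LinearMap.ker φ' ≤ saturAll L (Ideal.span {algebraMap L D x ^ n}) S := by
    rw [LinearMap.ker_codRestrict]
    exact hker
  refine (Module.length_le_of_surjective (Submodule.factor hker')
    (Submodule.factor_surjective hker')).trans ?_
  exact Module.length_le_of_injective ((LinearMap.ker φ').liftQ φ' le_rfl)
    (LinearMap.ker_eq_bot.mp (Submodule.ker_liftQ_eq_bot _ _ _ le_rfl))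

lemma length_quotient_saturAll_le {L D : Type*} [CommRing L] [IsDomain L]
    [IsNoetherianRing L] (m : Ideal L) [CommRing D] [IsDomain D] [Algebra L D]
    [Module.Finite L D] [FaithfulSMul L D] (x : L) (hx : x ≠ 0) (h : ℕ)
    (hh : Module.length L (powTorsion m (L ⧸ Ideal.span {x})) ≤ h) (c : L) (hc : c ≠ 0)
    (hcD : ∀ d : D, ∃ l, algebraMap L D l = algebraMap L D c * d) (S : Finset (PrimeSpectrum D))
    (hS : ∀ q ∈ S, q.asIdeal ∈ (Ideal.span {algebraMap L D x}).minimalPrimes ∧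
      q.asIdeal.comap (algebraMap L D) = m) :
    Module.length L (D ⧸ saturAll L (Ideal.span {algebraMap L D x}) S) ≤ h := by
  obtain ⟨b, hb⟩ := exists_length_quotient_saturAll_le m x hx c hc hcD S hS
  have hxD0 : algebraMap L D x ≠ 0 := by
    rwa [Ne, map_eq_zero_iff _ (FaithfulSMul.algebraMap_injective L D)]
  by_contra! hlt
  have h1 : ((h + 1 : ℕ) : ℕ∞) ≤ Module.length L (D ⧸ saturAll L (Ideal.span {algebraMap L D x}) S) := by
    push_cast
    exact Order.add_one_le_of_lt hlt
  let k := b * h + 1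
  have h2 : ((k * (h + 1) : ℕ) : ℕ∞) ≤ ((k + b) * h : ℕ) := by
    push_cast
    calc (k : ℕ∞) * (h + 1) ≤ k * Module.length L (D ⧸ saturAll L (Ideal.span {algebraMap L D x}) S) := by
          gcongr
          exact_mod_cast h1
      _ ≤ _ := mul_length_quotient_saturAll_le _ hxD0 S k
      _ ≤ _ := hb k
      _ ≤ _ := length_powTorsion_quotient_pow_le m hx (k + b)
      _ ≤ ((k + b : ℕ) : ℕ∞) * h := by gcongr
      _ = _ := by push_cast; rfl
  have h3 : k * (h + 1) ≤ (k + b) * h := by exact_mod_cast h2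
  have h4 : k = b * h + 1 := rfl
  nlinarith

end Saturation

section SaturationIntegral

lemma exists_common_denominator {L C : Type*} [CommRing L] [IsDomain L] [CommRing C] [Algebra L C]
    (hden : ∀ c : C, ∃ l : L, l ≠ 0 ∧ ∃ l', algebraMap L C l' = algebraMap L C l * c)
    (N : Submodule L C) (hN : N.FG) :
    ∃ l : L, l ≠ 0 ∧ ∀ c ∈ N, ∃ l', algebraMap L C l' = algebraMap L C l * c := by
  induction N, hN using Submodule.fg_induction with
  | singleton v =>
    obtain ⟨l, hl, l', hl'⟩ := hden v
    refine ⟨l, hl, fun c hc => ?_⟩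
    obtain ⟨a, rfl⟩ := Submodule.mem_span_singleton.mp hc
    exact ⟨a * l', by rw [map_mul, hl', Algebra.smul_def]; ring⟩
  | sup a b ha hb iha ihb =>
    obtain ⟨s, hs, hsv⟩ := iha
    obtain ⟨t, ht, htv⟩ := ihb
    refine ⟨s * t, mul_ne_zero hs ht, fun v hv => ?_⟩
    obtain ⟨c, hc, d, hd, rfl⟩ := Submodule.mem_sup.mp hv
    obtain ⟨c', hc'⟩ := hsv c hc
    obtain ⟨d', hd'⟩ := htv d hd
    refine ⟨t * c' + s * d', ?_⟩
    rw [map_add, map_mul, map_mul, map_mul, hc', hd']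
    ring

lemma length_quotient_saturAll_le_of_isIntegral {L C : Type*} [CommRing L] [IsDomain L]
    [IsNoetherianRing L] (m : Ideal L) [CommRing C] [IsDomain C] [Algebra L C]
    [Algebra.IsIntegral L C] [FaithfulSMul L C] (x : L) (hx : x ≠ 0) (h : ℕ)
    (hh : Module.length L (powTorsion m (L ⧸ Ideal.span {x})) ≤ h)
    (hden : ∀ c : C, ∃ l : L, l ≠ 0 ∧ ∃ l', algebraMap L C l' = algebraMap L C l * c)
    (S : Finset (PrimeSpectrum C))
    (hS : ∀ q ∈ S, q.asIdeal ∈ (Ideal.span {algebraMap L C x}).minimalPrimes ∧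
      q.asIdeal.comap (algebraMap L C) = m) :
    Module.length L (C ⧸ saturAll L (Ideal.span {algebraMap L C x}) S) ≤ h := by
  classical
  refine length_le_of_forall_fg h fun F hF => ?_
  obtain ⟨T, rfl⟩ := hF
  obtain ⟨G, hG⟩ := IsNoetherian.noetherian m
  let T' : Finset C := T.image (Function.surjInv (Submodule.Quotient.mk_surjective _))
  have hwit : ∀ (Q : PrimeSpectrum C) (g : L), ∃ s w : C, ∃ a : ℕ, Q ∈ S → g ∈ G →
      s ∉ Q.asIdeal ∧ s * algebraMap L C g ^ a = algebraMap L C x * w := by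
    intro Q g
    by_cases hQ : Q ∈ S
    swap
    · exact ⟨0, 0, 0, fun h => absurd h hQ⟩
    by_cases hg : g ∈ G
    swap
    · exact ⟨0, 0, 0, fun _ h => absurd h hg⟩
    obtain ⟨s, hs, a, ha⟩ := exists_mul_pow_mem_of_forall_prime
      (Ideal.span {algebraMap L C x}) Q (algebraMap L C g) (fun P hP hxP hPQ => by
        have h1 : Q.asIdeal ≤ P := (hS Q hQ).1.2 ⟨hP, hxP⟩ hPQ
        apply h1
        have h2 : g ∈ m := hG ▸ Submodule.subset_span hg
        rw [← (hS Q hQ).2] at h2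
        exact h2)
    obtain ⟨w, hw⟩ := Ideal.mem_span_singleton.mp ha
    exact ⟨s, w, a, fun _ _ => ⟨hs, hw⟩⟩
  choose s w a hsw using hwit
  let V : Finset C := T' ∪ ((S ×ˢ G).image (fun p => s p.1 p.2) ∪ (S ×ˢ G).image fun p => w p.1 p.2)
  let D : Subalgebra L C := Algebra.adjoin L (V : Set C)
  have hVD : ∀ v ∈ V, v ∈ D := fun v hv => Algebra.subset_adjoin hv
  have hsD : ∀ Q ∈ S, ∀ g ∈ G, s Q g ∈ D := fun Q hQ g hg => hVD _ (Finset.mem_union_right _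
    (Finset.mem_union_left _ (Finset.mem_image.mpr ⟨(Q, g), Finset.mk_mem_product hQ hg, rfl⟩)))
  have hwD : ∀ Q ∈ S, ∀ g ∈ G, w Q g ∈ D := fun Q hQ g hg => hVD _ (Finset.mem_union_right _
    (Finset.mem_union_right _ (Finset.mem_image.mpr ⟨(Q, g), Finset.mk_mem_product hQ hg, rfl⟩)))
  have hDfg : (Subalgebra.toSubmodule D).FG := fg_adjoin_of_finite V.finite_toSet
    fun v _ => Algebra.IsIntegral.isIntegral v
  have hDfin : Module.Finite L D := Module.Finite.iff_fg.mpr hDfg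
  have hDint : Algebra.IsIntegral L D := inferInstance
  have hDfaith : FaithfulSMul L D := (faithfulSMul_iff_algebraMap_injective L D).mpr
    fun u v huv => FaithfulSMul.algebraMap_injective L C (congrArg Subtype.val huv)
  obtain ⟨c, hc, hcD⟩ := exists_common_denominator hden _ hDfg
  have hcD' : ∀ d : D, ∃ l, algebraMap L D l = algebraMap L D c * d := fun d => by
    obtain ⟨l, hl⟩ := hcD d d.2
    exact ⟨l, Subtype.ext hl⟩
  let S' : Finset (PrimeSpectrum D) := S.image (PrimeSpectrum.comap (algebraMap D C))
  have hS' : ∀ q ∈ S', q.asIdeal ∈ (Ideal.span {algebraMap L D x}).minimalPrimes ∧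
      q.asIdeal.comap (algebraMap L D) = m := by
    intro q hq
    obtain ⟨Q, hQ, rfl⟩ := Finset.mem_image.mp hq
    have hcomap : (PrimeSpectrum.comap (algebraMap D C) Q).asIdeal.comap (algebraMap L D) = m :=
      (hS Q hQ).2
    refine ⟨⟨⟨(PrimeSpectrum.comap (algebraMap D C) Q).isPrime, ?_⟩, ?_⟩, hcomap⟩
    · rw [Ideal.span_singleton_le_iff_mem]
      exact (hS Q hQ).1.1.2 (Ideal.mem_span_singleton_self _)
    · rintro p ⟨hp, hxp⟩ hpq
      rw [Ideal.span_singleton_le_iff_mem] at hxp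
      have hmp : m ≤ p.comap (algebraMap L D) := by
        rw [← hG, Ideal.submodule_span_eq, Ideal.span_le]
        intro g hg
        obtain ⟨h1, h2⟩ := hsw Q g hQ hg
        have h3 : (⟨s Q g, hsD Q hQ g hg⟩ : D) * algebraMap L D g ^ a Q g ∈ p := by
          have h4 : (⟨s Q g, hsD Q hQ g hg⟩ : D) * algebraMap L D g ^ a Q g =
              algebraMap L D x * ⟨w Q g, hwD Q hQ g hg⟩ := Subtype.ext h2
          rw [h4]
          exact Ideal.mul_mem_right _ _ hxp
        refine hp.mem_of_pow_mem _ ((hp.mem_or_mem h3).resolve_left fun h5 => h1 (hpq h5))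
      by_contra hne
      have hlt := Ideal.IsIntegral.comap_lt_comap (R := L) (lt_of_le_not_ge hpq hne)
      rw [hcomap] at hlt
      exact absurd hmp (not_le_of_gt hlt)
  have hD := length_quotient_saturAll_le (D := D) m x hx h hh c hc hcD' S' hS'
  let ψ : (D ⧸ saturAll L (Ideal.span {algebraMap L D x}) S') →ₗ[L]
      (C ⧸ saturAll L (Ideal.span {algebraMap L C x}) S) :=
    Submodule.mapQ _ _ D.val.toLinearMap (by
      intro d hd
      rw [Submodule.mem_comap, mem_saturAll]
      rw [mem_saturAll] at hd
      intro Q hQ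
      obtain ⟨t, ht, htd⟩ := hd _ (Finset.mem_image_of_mem _ hQ)
      obtain ⟨z, hz⟩ := Ideal.mem_span_singleton.mp htd
      exact ⟨t, ht, Ideal.mem_span_singleton.mpr ⟨z, congrArg Subtype.val hz⟩⟩)
  have hle : Submodule.span L (T : Set _) ≤ LinearMap.range ψ := by
    rw [Submodule.span_le]
    intro v hv
    have hv' : Function.surjInv (Submodule.Quotient.mk_surjective _) v ∈ D :=
      hVD _ (Finset.mem_union_left _ (Finset.mem_image_of_mem _ hv))
    exact ⟨Submodule.Quotient.mk ⟨_, hv'⟩, Function.surjInv_eq _ v⟩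
  calc _ ≤ Module.length L (LinearMap.range ψ) :=
        Module.length_le_of_injective (Submodule.inclusion hle) (Submodule.inclusion_injective hle)
    _ ≤ _ := Module.length_le_of_surjective _ ψ.surjective_rangeRestrict
    _ ≤ h := hD

end SaturationIntegral

section LocalizationAtPrime

lemma disjoint_algebraMapSubmonoid_primeCompl {E C : Type*} [CommRing E] [CommRing C]
    [Algebra E C] (p : Ideal E) [p.IsPrime] {Q : Ideal C} (hQ : Q.comap (algebraMap E C) = p) :
    Disjoint (Algebra.algebraMapSubmonoid C p.primeCompl : Set C) Q := by
  rw [Set.disjoint_left]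
  rintro _ ⟨s, hs, rfl⟩ hsQ
  apply hs
  rw [← hQ]
  exact hsQ

lemma exists_localized_minimalPrime {E C : Type*} [CommRing E] [CommRing C]
    [Algebra E C] (p : Ideal E) [p.IsPrime]
    (L CL : Type*) [CommRing L] [CommRing CL] [Algebra E L]
    [IsLocalization p.primeCompl L] [Algebra C CL]
    [IsLocalization (Algebra.algebraMapSubmonoid C p.primeCompl) CL] [Algebra L CL] [Algebra E CL]
    [IsScalarTower E L CL] [IsScalarTower E C CL]
    (x : E) (Q : PrimeSpectrum C)
    (hQ : Q.asIdeal ∈ (Ideal.span {algebraMap E C x}).minimalPrimes)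
    (hQp : Q.asIdeal.comap (algebraMap E C) = p) :
    ∃ QL : PrimeSpectrum CL, QL.asIdeal.comap (algebraMap C CL) = Q.asIdeal ∧
      QL.asIdeal ∈ (Ideal.span {algebraMap L CL (algebraMap E L x)}).minimalPrimes ∧
      QL.asIdeal.comap (algebraMap L CL) = p.map (algebraMap E L) := by
  have hd := disjoint_algebraMapSubmonoid_primeCompl p hQp
  have hx : algebraMap L CL (algebraMap E L x) = algebraMap C CL (algebraMap E C x) := by
    rw [← IsScalarTower.algebraMap_apply, ← IsScalarTower.algebraMap_apply]
  have hcomap := IsLocalization.under_map_of_isPrime_disjoint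
    (Algebra.algebraMapSubmonoid C p.primeCompl) CL Q.isPrime hd
  refine ⟨⟨Q.asIdeal.map (algebraMap C CL), IsLocalization.isPrime_of_isPrime_disjoint
    (Algebra.algebraMapSubmonoid C p.primeCompl) CL Q.asIdeal Q.isPrime hd⟩, hcomap,
    ⟨⟨IsLocalization.isPrime_of_isPrime_disjoint
    (Algebra.algebraMapSubmonoid C p.primeCompl) CL Q.asIdeal Q.isPrime hd, ?_⟩, ?_⟩, ?_⟩
  · rw [Ideal.span_singleton_le_iff_mem, hx]
    exact Ideal.mem_map_of_mem _ (hQ.1.2 (Ideal.mem_span_singleton_self _))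
  · rintro P ⟨hP, hxP⟩ hPQ
    rw [Ideal.span_singleton_le_iff_mem, hx] at hxP
    rw [Ideal.map_le_iff_le_comap]
    refine hQ.2 ⟨Ideal.IsPrime.comap _, ?_⟩ ?_
    · rw [Ideal.span_singleton_le_iff_mem]
      exact hxP
    · rw [← hcomap]
      exact Ideal.comap_mono hPQ
  · rw [← IsLocalization.map_under p.primeCompl L
      ((Q.asIdeal.map (algebraMap C CL)).comap (algebraMap L CL))]
    congr 1
    rw [Ideal.under_def, Ideal.comap_comap, ← IsScalarTower.algebraMap_eq,
      IsScalarTower.algebraMap_eq E C CL, ← Ideal.comap_comap]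
    rw [Ideal.under_def] at hcomap
    rw [hcomap, hQp]

lemma length_quotient_saturAll_localization_le {E C : Type*} [CommRing E] [IsDomain E]
    [CommRing C] [IsDomain C] [Algebra E C] [Algebra.IsIntegral E C] [FaithfulSMul E C]
    (p : Ideal E) [p.IsPrime]
    (L CL : Type*) [CommRing L] [CommRing CL] [Algebra E L]
    [IsLocalization p.primeCompl L] [Algebra C CL]
    [IsLocalization (Algebra.algebraMapSubmonoid C p.primeCompl) CL] [Algebra L CL] [Algebra E CL]
    [IsScalarTower E L CL] [IsScalarTower E C CL]
    [IsNoetherianRing E]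
    (hden : ∀ c : C, ∃ l : E, l ≠ 0 ∧ ∃ l', algebraMap E C l' = algebraMap E C l * c)
    (x : E) (hx : x ≠ 0) (S : Finset (PrimeSpectrum CL))
    (hS : ∀ q ∈ S,
      q.asIdeal ∈ (Ideal.span {algebraMap L CL (algebraMap E L x)}).minimalPrimes ∧
      q.asIdeal.comap (algebraMap L CL) = p.map (algebraMap E L)) :
    Module.length L (CL ⧸ saturAll L (Ideal.span {algebraMap L CL (algebraMap E L x)}) S) ≤
      Module.length L (powTorsion (p.map (algebraMap E L))
        (L ⧸ Ideal.span {algebraMap E L x})) := by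
  have hM : p.primeCompl ≤ nonZeroDivisors E := p.primeCompl_le_nonZeroDivisors
  have hMC : Algebra.algebraMapSubmonoid C p.primeCompl ≤ nonZeroDivisors C :=
    algebraMapSubmonoid_le_nonZeroDivisors_of_faithfulSMul C hM
  have : IsDomain L := IsLocalization.isDomain_of_le_nonZeroDivisors L hM
  have : IsDomain CL := IsLocalization.isDomain_of_le_nonZeroDivisors CL hMC
  have : IsNoetherianRing L := IsLocalization.isNoetherianRing p.primeCompl L inferInstance
  have hiEL : Function.Injective (algebraMap E L) := IsLocalization.injective L hM
  have hiCL : Function.Injective (algebraMap C CL) := IsLocalization.injective CL hMC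
  have hiEC : Function.Injective (algebraMap E C) := FaithfulSMul.algebraMap_injective E C
  have hiECL : Function.Injective (algebraMap E CL) := by
    rw [IsScalarTower.algebraMap_eq E C CL]
    exact hiCL.comp hiEC
  have hiL : Function.Injective (algebraMap L CL) := by
    rw [injective_iff_map_eq_zero]
    intro l hl
    obtain ⟨⟨a, s⟩, has⟩ := IsLocalization.surj p.primeCompl l
    have h1 := congrArg (algebraMap L CL) has
    rw [map_mul, hl, zero_mul, ← IsScalarTower.algebraMap_apply] at h1
    have h2 : a = 0 := hiECL (by rw [← h1, map_zero])
    simp only [h2, map_zero] at has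
    exact (mul_eq_zero.mp has).resolve_right (IsLocalization.map_units L s).ne_zero
  have : FaithfulSMul L CL := (faithfulSMul_iff_algebraMap_injective L CL).mpr hiL
  have : Algebra.IsIntegral L CL := by
    constructor
    intro z
    obtain ⟨⟨c, ⟨_, s, hs, rfl⟩⟩, hcs⟩ :=
      IsLocalization.surj (Algebra.algebraMapSubmonoid C p.primeCompl) z
    have h1 : IsIntegral L (algebraMap C CL c) :=
      ((Algebra.IsIntegral.isIntegral (R := E) c).map (IsScalarTower.toAlgHom E C CL)).tower_top
    obtain ⟨u, hu⟩ := IsLocalization.map_units L (⟨s, hs⟩ : p.primeCompl)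
    have h2 : z = algebraMap L CL (u⁻¹ : Lˣ) * algebraMap C CL c := by
      change z * algebraMap C CL (algebraMap E C s) = algebraMap C CL c at hcs
      rw [← hcs, ← IsScalarTower.algebraMap_apply, IsScalarTower.algebraMap_apply E L CL,
        mul_left_comm, ← map_mul]
      change (u : L) = algebraMap E L s at hu
      rw [← hu, Units.inv_mul, map_one, mul_one]
    rw [h2]
    exact isIntegral_algebraMap.mul h1
  have hdenL : ∀ z : CL, ∃ l : L, l ≠ 0 ∧ ∃ l', algebraMap L CL l' = algebraMap L CL l * z := by
    intro z
    obtain ⟨⟨c, ⟨_, s, hs, rfl⟩⟩, hcs⟩ :=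
      IsLocalization.surj (Algebra.algebraMapSubmonoid C p.primeCompl) z
    change z * algebraMap C CL (algebraMap E C s) = algebraMap C CL c at hcs
    obtain ⟨l, hl, l', hl'⟩ := hden c
    refine ⟨algebraMap E L (l * s), ?_, algebraMap E L l', ?_⟩
    · rw [Ne, map_eq_zero_iff _ hiEL]
      exact mul_ne_zero hl fun h => hs (h ▸ p.zero_mem)
    · rw [← IsScalarTower.algebraMap_apply, ← IsScalarTower.algebraMap_apply,
        IsScalarTower.algebraMap_apply E C CL, IsScalarTower.algebraMap_apply E C CL, hl',
        map_mul, map_mul, map_mul, ← hcs]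
      ring
  have : IsLocalRing L := IsLocalization.AtPrime.isLocalRing L p
  have hmax : (p.map (algebraMap E L)).IsMaximal := by
    have : IsLocalization.AtPrime L p := ‹_›
    rw [IsLocalization.AtPrime.map_eq_maximalIdeal p L]
    infer_instance
  have hne := length_powTorsion_ne_top (N := L ⧸ Ideal.span {algebraMap E L x})
    (p.map (algebraMap E L))
  obtain ⟨h, hh⟩ := ENat.ne_top_iff_exists.mp hne
  rw [← hh]
  exact length_quotient_saturAll_le_of_isIntegral _ _
    (by rwa [Ne, map_eq_zero_iff _ hiEL]) h hh.symm.le hdenL S hS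

end LocalizationAtPrime

section LocalConsequences

lemma card_le_length_quotient_saturAll {L C : Type*} [CommRing L] [CommRing C] [Algebra L C]
    (J : Ideal C) (S : Finset (PrimeSpectrum C))
    (hS : ∀ q ∈ S, J ≤ q.asIdeal ∧ q.asIdeal.IsMaximal) :
    (S.card : ℕ∞) ≤ Module.length L (C ⧸ saturAll L J S) := by
  classical
  let I : S → Ideal C := fun q => q.1.asIdeal
  have hI : Pairwise (Function.onFun IsCoprime I) := by
    intro q q' hne
    have h1 := (hS q.1 q.2).2
    have h2 := (hS q'.1 q'.2).2
    exact Ideal.isCoprime_of_isMaximal fun h => hne (Subtype.ext (PrimeSpectrum.ext h))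
  let f : C →ₗ[L] (∀ q : S, C ⧸ I q) := (LinearMap.pi fun q => (I q).mkQ).restrictScalars L
  have hf : Function.Surjective f := Ideal.pi_mkQ_surjective hI
  have hker : saturAll L J S ≤ LinearMap.ker f := by
    intro d hd
    rw [mem_saturAll] at hd
    rw [LinearMap.mem_ker]
    ext q
    obtain ⟨s, hs, hsd⟩ := hd q.1 q.2
    exact (Submodule.Quotient.mk_eq_zero _).mpr
      ((q.1.isPrime.mem_or_mem ((hS q.1 q.2).1 hsd)).resolve_left hs)
  have h1 : Module.length L (∀ q : S, C ⧸ I q) ≤ Module.length L (C ⧸ saturAll L J S) :=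
    Module.length_le_of_surjective ((saturAll L J S).liftQ f hker) fun v => by
      obtain ⟨w, rfl⟩ := hf v
      exact ⟨Submodule.Quotient.mk w, rfl⟩
  refine le_trans ?_ h1
  rw [Module.length_pi_of_fintype]
  calc (S.card : ℕ∞) = ∑ _q : S, 1 := by simp
    _ ≤ _ := Finset.sum_le_sum fun q _ => by
      have : Nontrivial (C ⧸ I q) := Ideal.Quotient.nontrivial_iff.mpr q.1.isPrime.ne_top
      rw [Order.one_le_iff_pos]
      exact Module.length_pos

lemma card_le_length_powTorsion {E C : Type*} [CommRing E] [IsDomain E]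
    [CommRing C] [IsDomain C] [Algebra E C] [Algebra.IsIntegral E C] [FaithfulSMul E C]
    (p : Ideal E) [p.IsPrime] [IsNoetherianRing E]
    (hden : ∀ c : C, ∃ l : E, l ≠ 0 ∧ ∃ l', algebraMap E C l' = algebraMap E C l * c)
    (x : E) (hx : x ≠ 0) (S : Finset (PrimeSpectrum C))
    (hS : ∀ q ∈ S, q.asIdeal ∈ (Ideal.span {algebraMap E C x}).minimalPrimes ∧
      q.asIdeal.comap (algebraMap E C) = p) :
    (S.card : ℕ∞) ≤ Module.length (Localization p.primeCompl)
      (powTorsion (p.map (algebraMap E (Localization p.primeCompl)))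
        (Localization p.primeCompl ⧸
          Ideal.span {algebraMap E (Localization p.primeCompl) x})) := by
  classical
  let L := Localization p.primeCompl
  let CL := Localization (Algebra.algebraMapSubmonoid C p.primeCompl)
  have hInteg : Algebra.IsIntegral L CL := inferInstance
  have : IsLocalRing L := IsLocalization.AtPrime.isLocalRing L p
  have hmax : (p.map (algebraMap E L)).IsMaximal := by
    rw [IsLocalization.AtPrime.map_eq_maximalIdeal p L]
    infer_instance
  have hex : ∀ Q : S, ∃ QL : PrimeSpectrum CL,
      QL.asIdeal.comap (algebraMap C CL) = Q.1.asIdeal ∧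
      QL.asIdeal ∈ (Ideal.span {algebraMap L CL (algebraMap E L x)}).minimalPrimes ∧
      QL.asIdeal.comap (algebraMap L CL) = p.map (algebraMap E L) := fun Q =>
    exists_localized_minimalPrime p L CL x Q.1 (hS Q.1 Q.2).1 (hS Q.1 Q.2).2
  choose f hf using hex
  let SL : Finset (PrimeSpectrum CL) := Finset.univ.image f
  have hcard : SL.card = S.card := by
    rw [Finset.card_image_of_injective, Finset.card_univ, Fintype.card_coe]
    intro Q Q' h
    apply Subtype.ext
    apply PrimeSpectrum.ext
    rw [← (hf Q).1, h, (hf Q').1]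
  have hSL : ∀ q ∈ SL,
      q.asIdeal ∈ (Ideal.span {algebraMap L CL (algebraMap E L x)}).minimalPrimes ∧
      q.asIdeal.comap (algebraMap L CL) = p.map (algebraMap E L) := by
    intro q hq
    obtain ⟨Q, _, rfl⟩ := Finset.mem_image.mp hq
    exact (hf Q).2
  rw [← hcard]
  refine (card_le_length_quotient_saturAll (L := L)
    (Ideal.span {algebraMap L CL (algebraMap E L x)}) SL fun q hq => ⟨(hSL q hq).1.1.2, ?_⟩).trans
    (length_quotient_saturAll_localization_le (C := C) p L CL hden x hx SL hSL)
  refine Ideal.isMaximal_of_isIntegral_of_isMaximal_comap (R := L) _ ?_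
  rw [(hSL q hq).2]
  exact hmax

lemma finite_minimalPrimes_of_comap_eq {E C : Type*} [CommRing E] [IsDomain E]
    [CommRing C] [IsDomain C] [Algebra E C] [Algebra.IsIntegral E C] [FaithfulSMul E C]
    (p : Ideal E) [p.IsPrime] [IsNoetherianRing E]
    (hden : ∀ c : C, ∃ l : E, l ≠ 0 ∧ ∃ l', algebraMap E C l' = algebraMap E C l * c)
    (x : E) (hx : x ≠ 0) :
    {q : PrimeSpectrum C | q.asIdeal ∈ (Ideal.span {algebraMap E C x}).minimalPrimes ∧
      q.asIdeal.comap (algebraMap E C) = p}.Finite := by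
  by_contra hinf
  let L := Localization p.primeCompl
  have : IsLocalRing L := IsLocalization.AtPrime.isLocalRing L p
  have : IsNoetherianRing L := IsLocalization.isNoetherianRing p.primeCompl L inferInstance
  have hmax : (p.map (algebraMap E L)).IsMaximal := by
    rw [IsLocalization.AtPrime.map_eq_maximalIdeal p L]
    infer_instance
  obtain ⟨h, hh⟩ := ENat.ne_top_iff_exists.mp (length_powTorsion_ne_top
    (N := L ⧸ Ideal.span {algebraMap E L x}) (p.map (algebraMap E L)))
  obtain ⟨S, hS, hcard⟩ := Set.Infinite.exists_subset_card_eq hinf (h + 1)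
  have h1 := card_le_length_powTorsion p hden x hx S fun q hq => hS hq
  rw [← hh, hcard] at h1
  norm_cast at h1
  lia

lemma comap_mem_associatedPrimes {E C : Type*} [CommRing E] [IsDomain E]
    [CommRing C] [IsDomain C] [Algebra E C] [Algebra.IsIntegral E C] [FaithfulSMul E C]
    [IsNoetherianRing E]
    (hden : ∀ c : C, ∃ l : E, l ≠ 0 ∧ ∃ l', algebraMap E C l' = algebraMap E C l * c)
    (x : E) (hx : x ≠ 0) (Q : Ideal C) (hQ : Q ∈ (Ideal.span {algebraMap E C x}).minimalPrimes) :
    Q.comap (algebraMap E C) ∈ associatedPrimes E (E ⧸ Ideal.span {x}) := by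
  classical
  have hQp : Q.IsPrime := hQ.1.1
  let p := Q.comap (algebraMap E C)
  let L := Localization p.primeCompl
  have h1 := card_le_length_powTorsion p hden x hx {⟨Q, hQp⟩} fun q hq => by
    rw [Finset.mem_singleton] at hq
    rw [hq]
    exact ⟨hQ, rfl⟩
  have h2 : Nontrivial (powTorsion (p.map (algebraMap E L)) (L ⧸ Ideal.span {algebraMap E L x})) := by
    rw [← Module.length_pos_iff (R := L)]
    exact lt_of_lt_of_le (by simp) h1
  obtain ⟨⟨v, j, hj⟩, hv⟩ := exists_ne (0 : powTorsion (p.map (algebraMap E L))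
    (L ⧸ Ideal.span {algebraMap E L x}))
  have hv' : v ≠ 0 := fun h => hv (Subtype.ext h)
  obtain ⟨l, rfl⟩ := Submodule.Quotient.mk_surjective _ v
  obtain ⟨⟨a, s⟩, has⟩ := IsLocalization.surj p.primeCompl l
  have hu := IsLocalization.map_units L s
  have key : ∀ b : E, algebraMap E L b ∈ Ideal.span {algebraMap E L x} ↔
      b ∈ satur (Ideal.span {x}) (⟨p, inferInstance⟩ : PrimeSpectrum E) := by
    intro b
    rw [← Set.image_singleton, ← Ideal.map_span,
      IsLocalization.algebraMap_mem_map_algebraMap_iff p.primeCompl]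
    constructor
    · rintro ⟨t, ht, h⟩
      exact ⟨t, ht, h⟩
    · rintro ⟨t, ht, h⟩
      exact ⟨t, ht, h⟩
  have ha : a ∉ satur (Ideal.span {x}) (⟨p, inferInstance⟩ : PrimeSpectrum E) := by
    rw [← key, ← has, Ideal.mul_unit_mem_iff_mem _ hu]
    exact fun h => hv' ((Submodule.Quotient.mk_eq_zero _).mpr h)
  have hpa : p ^ j ≤ satur ((Ideal.span {x}).colon {a}) (⟨p, inferInstance⟩ : PrimeSpectrum E) := by
    intro b hb
    have h3 : algebraMap E L b ∈ p.map (algebraMap E L) ^ j := by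
      rw [← Ideal.map_pow]
      exact Ideal.mem_map_of_mem _ hb
    have h4 : algebraMap E L b * l ∈ Ideal.span {algebraMap E L x} :=
      (Submodule.Quotient.mk_eq_zero _).mp (hj _ h3)
    have h5 : algebraMap E L (b * a) ∈ Ideal.span {algebraMap E L x} := by
      rw [map_mul, ← has, ← mul_assoc]
      exact Ideal.mul_mem_right _ _ h4
    obtain ⟨t, ht, htb⟩ := (key _).mp h5
    refine ⟨t, ht, ?_⟩
    rw [Submodule.mem_colon_singleton, smul_eq_mul, mul_assoc]
    exact htb
  obtain ⟨t, ht, htp⟩ := exists_notMem_forall_mul_mem_of_le_satur _ _ _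
    (IsNoetherian.noetherian _) hpa
  let N : Submodule E (E ⧸ Ideal.span {x}) := Submodule.span E {Submodule.Quotient.mk (t * a)}
  have hann : ∀ b : E, b ∈ Module.annihilator E N ↔ b * (t * a) ∈ Ideal.span {x} := by
    intro b
    change b ∈ Submodule.annihilator (Submodule.span E _) ↔ _
    rw [Submodule.mem_annihilator_span_singleton, ← Submodule.Quotient.mk_smul,
      Submodule.Quotient.mk_eq_zero, smul_eq_mul]
  have hmin : p ∈ (Module.annihilator E N).minimalPrimes := by
    refine ⟨⟨inferInstance, fun b hb => ?_⟩, ?_⟩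
    · by_contra hbp
      refine ha ⟨b * t, fun h => ?_, ?_⟩
      · exact ((inferInstance : p.IsPrime).mem_or_mem h).elim hbp ht
      · rw [mul_assoc]
        exact (hann b).mp hb
    · rintro P ⟨hP, hle⟩ _
      refine Ideal.IsPrime.le_of_pow_le (n := j) fun b hb => hle ((hann b).mpr ?_)
      have := htp b hb
      rw [Submodule.mem_colon_singleton, smul_eq_mul] at this
      rwa [← mul_assoc, mul_comm b t]
  exact associatedPrimes.subset_of_injective (f := N.subtype) (Submodule.subtype_injective _)
    (Module.associatedPrimes.minimalPrimes_annihilator_subset_associatedPrimes _ _ hmin)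

lemma finite_minimalPrimes_span {E C : Type*} [CommRing E] [IsDomain E]
    [CommRing C] [IsDomain C] [Algebra E C] [Algebra.IsIntegral E C] [FaithfulSMul E C]
    [IsNoetherianRing E]
    (hden : ∀ c : C, ∃ l : E, l ≠ 0 ∧ ∃ l', algebraMap E C l' = algebraMap E C l * c)
    (x : E) (hx : x ≠ 0) : (Ideal.span {algebraMap E C x}).minimalPrimes.Finite := by
  have h1 : {q : PrimeSpectrum C |
      q.asIdeal ∈ (Ideal.span {algebraMap E C x}).minimalPrimes}.Finite := by
    refine Set.Finite.subset (Set.Finite.biUnion (associatedPrimes.finite E (E ⧸ Ideal.span {x}))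
      (t := fun p => {q : PrimeSpectrum C |
        q.asIdeal ∈ (Ideal.span {algebraMap E C x}).minimalPrimes ∧
        q.asIdeal.comap (algebraMap E C) = p}) fun p hp => ?_) fun q hq => ?_
    · have := hp.isPrime
      exact finite_minimalPrimes_of_comap_eq p hden x hx
    · exact Set.mem_biUnion (comap_mem_associatedPrimes hden x hx q.asIdeal hq) ⟨hq, rfl⟩
  refine (h1.image PrimeSpectrum.asIdeal).subset fun Q hQ => ⟨⟨Q, hQ.1.1⟩, hQ, rfl⟩

lemma exists_finset_forall_smul_sub_mem_satur {E C : Type*} [CommRing E] [IsDomain E]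
    [CommRing C] [IsDomain C] [Algebra E C] [Algebra.IsIntegral E C] [FaithfulSMul E C]
    [IsNoetherianRing E]
    (hden : ∀ c : C, ∃ l : E, l ≠ 0 ∧ ∃ l', algebraMap E C l' = algebraMap E C l * c)
    (x : E) (hx : x ≠ 0) (Q : PrimeSpectrum C)
    (hQ : Q.asIdeal ∈ (Ideal.span {algebraMap E C x}).minimalPrimes) (N : Set C) :
    ∃ G : Finset C, (G : Set C) ⊆ N ∧ ∀ c ∈ N, ∃ s : E, algebraMap E C s ∉ Q.asIdeal ∧
      ∃ z ∈ Submodule.span E (G : Set C),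
        s • c - z ∈ satur (Ideal.span {algebraMap E C x}) Q := by
  classical
  let p := Q.asIdeal.comap (algebraMap E C)
  let L := Localization p.primeCompl
  let CL := Localization (Algebra.algebraMapSubmonoid C p.primeCompl)
  have hMC : Algebra.algebraMapSubmonoid C p.primeCompl ≤ nonZeroDivisors C :=
    algebraMapSubmonoid_le_nonZeroDivisors_of_faithfulSMul C p.primeCompl_le_nonZeroDivisors
  have hiCL : Function.Injective (algebraMap C CL) := IsLocalization.injective CL hMC
  have hnL : IsNoetherianRing L := IsLocalization.isNoetherianRing p.primeCompl L inferInstance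
  have : IsLocalRing L := IsLocalization.AtPrime.isLocalRing L p
  have hmax : (p.map (algebraMap E L)).IsMaximal := by
    rw [IsLocalization.AtPrime.map_eq_maximalIdeal p L]
    infer_instance
  obtain ⟨QL, hQL1, hQL2⟩ := exists_localized_minimalPrime p L CL x Q hQ rfl
  let W := saturAll L (Ideal.span {algebraMap L CL (algebraMap E L x)}) {QL}
  have hlen : Module.length L (CL ⧸ W) ≠ ⊤ := by
    refine ne_top_of_le_ne_top (length_powTorsion_ne_top
      (N := L ⧸ Ideal.span {algebraMap E L x}) (p.map (algebraMap E L)))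
      (length_quotient_saturAll_localization_le (C := C) p L CL hden x hx _ fun q hq => ?_)
    rw [Finset.mem_singleton] at hq
    rw [hq]
    exact hQL2
  have hnoeth : IsNoetherian L (CL ⧸ W) :=
    (isFiniteLength_iff_isNoetherian_isArtinian.mp (Module.length_ne_top_iff.mp hlen)).1
  let φ : C →ₗ[E] CL ⧸ W :=
    (W.mkQ.restrictScalars E) ∘ₗ (IsScalarTower.toAlgHom E C CL).toLinearMap
  have hφ : ∀ d, φ d = 0 → d ∈ satur (Ideal.span {algebraMap E C x}) Q := by
    intro d hd
    have h1 : algebraMap C CL d ∈ W := (Submodule.Quotient.mk_eq_zero _).mp hd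
    obtain ⟨t, ht, htd⟩ := mem_saturAll.mp h1 QL (Finset.mem_singleton_self _)
    obtain ⟨w, hw⟩ := Ideal.mem_span_singleton.mp htd
    obtain ⟨⟨t0, u⟩, htu⟩ := IsLocalization.surj (Algebra.algebraMapSubmonoid C p.primeCompl) t
    obtain ⟨⟨w0, u'⟩, hwu⟩ := IsLocalization.surj (Algebra.algebraMapSubmonoid C p.primeCompl) w
    have hxx : algebraMap L CL (algebraMap E L x) = algebraMap C CL (algebraMap E C x) := by
      rw [← IsScalarTower.algebraMap_apply, ← IsScalarTower.algebraMap_apply]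
    have hdis := Set.disjoint_left.mp (disjoint_algebraMapSubmonoid_primeCompl p
      (Q := Q.asIdeal) rfl)
    refine ⟨t0 * u', fun h => (Q.isPrime.mem_or_mem h).elim (fun h2 => ht ?_) (hdis u'.2),
      Ideal.mem_span_singleton.mpr ⟨u * w0, hiCL ?_⟩⟩
    · rw [← hQL1, Ideal.mem_comap] at h2
      simp only at htu
      rw [← htu] at h2
      exact (Ideal.mul_unit_mem_iff_mem _ (IsLocalization.map_units CL u)).mp h2
    · simp only at htu hwu
      rw [map_mul, map_mul, map_mul, map_mul, ← htu, ← hwu, ← hxx]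
      linear_combination (algebraMap C CL u * algebraMap C CL u') * hw
  obtain ⟨G', hG'N, hG'⟩ := (Submodule.fg_span_iff_fg_span_finset_subset (φ '' N)).mp
    (IsNoetherian.noetherian (Submodule.span L (φ '' N)))
  obtain ⟨G, hGN, hG⟩ := Finset.subset_set_image_iff.mp hG'N
  refine ⟨G, hGN, fun c hc => ?_⟩
  have h1 : φ c ∈ Submodule.span L (φ '' (G : Set C)) := by
    have h2 : φ '' (G : Set C) = G' := by rw [← hG, Finset.coe_image]
    rw [h2, ← hG']
    exact Submodule.subset_span ⟨c, hc, rfl⟩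
  obtain ⟨s, hs⟩ := multiple_mem_span_of_mem_localization_span p.primeCompl L _ _ h1
  rw [Submodule.span_image] at hs
  obtain ⟨z, hz, hzs⟩ := hs
  refine ⟨s, s.2, z, hz, hφ _ ?_⟩
  rw [map_sub, map_smul, hzs]
  exact sub_self _

end LocalConsequences

section DiscreteValuation

lemma eq_of_le_of_mem_minimalPrimes_span_of_isIntegral {E C : Type*} [CommRing E] [IsDomain E]
    [CommRing C] [IsDomain C] [Algebra E C] [Algebra.IsIntegral E C] [FaithfulSMul E C]
    [IsNoetherianRing E] (x : E) (Q P : Ideal C)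
    (hQ : Q ∈ (Ideal.span {algebraMap E C x}).minimalPrimes) [hP : P.IsPrime] (hP0 : P ≠ ⊥)
    (hle : P ≤ Q) : P = Q := by
  classical
  have hQp : Q.IsPrime := hQ.1.1
  obtain ⟨G, hG⟩ := IsNoetherian.noetherian (Q.comap (algebraMap E C))
  have hwit : ∀ g : E, ∃ s w : C, ∃ a : ℕ, g ∈ G →
      s ∉ Q ∧ s * algebraMap E C g ^ a = algebraMap E C x * w := by
    intro g
    by_cases hg : g ∈ G
    swap
    · exact ⟨0, 0, 0, fun h => absurd h hg⟩
    obtain ⟨s, hs, a, ha⟩ := exists_mul_pow_mem_of_forall_prime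
      (Ideal.span {algebraMap E C x}) ⟨Q, hQp⟩ (algebraMap E C g) (fun P' hP' hxP hPQ => by
        have h1 : Q ≤ P' := hQ.2 ⟨hP', hxP⟩ hPQ
        apply h1
        have h2 : g ∈ Q.comap (algebraMap E C) := hG ▸ Submodule.subset_span hg
        exact h2)
    obtain ⟨w, hw⟩ := Ideal.mem_span_singleton.mp ha
    exact ⟨s, w, a, fun _ => ⟨hs, hw⟩⟩
  choose s w a hsw using hwit
  let V : Finset C := G.image s ∪ G.image w
  let D : Subalgebra E C := Algebra.adjoin E (V : Set C)
  have hVD : ∀ v ∈ V, v ∈ D := fun v hv => Algebra.subset_adjoin hv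
  have hsD : ∀ g ∈ G, s g ∈ D := fun g hg =>
    hVD _ (Finset.mem_union_left _ (Finset.mem_image_of_mem _ hg))
  have hwD : ∀ g ∈ G, w g ∈ D := fun g hg =>
    hVD _ (Finset.mem_union_right _ (Finset.mem_image_of_mem _ hg))
  have hDfg : (Subalgebra.toSubmodule D).FG := fg_adjoin_of_finite V.finite_toSet
    fun v _ => Algebra.IsIntegral.isIntegral v
  have hDfin : Module.Finite E D := Module.Finite.iff_fg.mpr hDfg
  have hDint : Algebra.IsIntegral E D := inferInstance
  have hDnoeth : IsNoetherianRing D := isNoetherian_of_tower E inferInstance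
  have hmin : Q.comap (algebraMap D C) ∈ (Ideal.span {algebraMap E D x}).minimalPrimes := by
    refine ⟨⟨inferInstance, ?_⟩, ?_⟩
    · rw [Ideal.span_singleton_le_iff_mem]
      exact hQ.1.2 (Ideal.mem_span_singleton_self _)
    · rintro p ⟨hp, hxp⟩ hpq
      rw [Ideal.span_singleton_le_iff_mem] at hxp
      have hmp : Q.comap (algebraMap E C) ≤ p.comap (algebraMap E D) := by
        rw [← hG, Ideal.submodule_span_eq, Ideal.span_le]
        intro g hg
        obtain ⟨h1, h2⟩ := hsw g hg
        have h3 : (⟨s g, hsD g hg⟩ : D) * algebraMap E D g ^ a g ∈ p := by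
          have h4 : (⟨s g, hsD g hg⟩ : D) * algebraMap E D g ^ a g =
              algebraMap E D x * ⟨w g, hwD g hg⟩ := Subtype.ext h2
          rw [h4]
          exact Ideal.mul_mem_right _ _ hxp
        exact hp.mem_of_pow_mem _ ((hp.mem_or_mem h3).resolve_left fun h5 => h1 (hpq h5))
      by_contra hne
      have hlt := Ideal.IsIntegral.comap_lt_comap (R := E) (lt_of_le_not_ge hpq hne)
      exact absurd hmp (not_le_of_gt hlt)
  by_contra hne
  have hlt := Ideal.IsIntegral.comap_lt_comap (R := E) (lt_of_le_of_ne hle hne)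
  have hP0' : P.comap (algebraMap D C) ≠ ⊥ := by
    intro h0
    apply hP0
    apply Ideal.eq_bot_of_comap_eq_bot (R := E)
    have h1 : P.comap (algebraMap E C) = (P.comap (algebraMap D C)).comap (algebraMap E D) := rfl
    rw [h1, h0, ← RingHom.ker_eq_comap_bot, (RingHom.injective_iff_ker_eq_bot _).mp]
    exact fun u v huv => FaithfulSMul.algebraMap_injective E C (congrArg Subtype.val huv)
  have heq := eq_of_le_of_mem_minimalPrimes_span _ _ (P.comap (algebraMap D C)) hmin hP0'
    (Ideal.comap_mono hle)
  have h2 : P.comap (algebraMap E C) = Q.comap (algebraMap E C) :=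
    congrArg (Ideal.comap (algebraMap E D)) heq
  exact hlt.ne h2

lemma isDiscreteValuationRing_localization_of_isIntegral {E C : Type*} [CommRing E] [IsDomain E]
    [CommRing C] [IsDomain C] [Algebra E C] [Algebra.IsIntegral E C] [FaithfulSMul E C]
    [IsNoetherianRing E] [IsIntegrallyClosed C]
    (hden : ∀ c : C, ∃ l : E, l ≠ 0 ∧ ∃ l', algebraMap E C l' = algebraMap E C l * c)
    (x : E) (hx : x ≠ 0) (Q : Ideal C) [hQp : Q.IsPrime]
    (hQ : Q ∈ (Ideal.span {algebraMap E C x}).minimalPrimes) :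
    IsDiscreteValuationRing (Localization.AtPrime Q) := by
  classical
  let R := Localization.AtPrime Q
  have hle : Q.primeCompl ≤ nonZeroDivisors C := Q.primeCompl_le_nonZeroDivisors
  have hxC : algebraMap E C x ≠ 0 := by
    rwa [Ne, FaithfulSMul.algebraMap_eq_zero_iff]
  have hxQ : algebraMap E C x ∈ Q := hQ.1.2 (Ideal.mem_span_singleton_self _)
  have hinj : Function.Injective (algebraMap C R) := IsLocalization.injective R hle
  have hprime : ∀ P : Ideal R, P.IsPrime → P ≠ ⊥ → P = IsLocalRing.maximalIdeal R := by
    intro P hP hP0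
    have h1 : P.comap (algebraMap C R) = Q := by
      refine eq_of_le_of_mem_minimalPrimes_span_of_isIntegral x Q _ hQ (fun h0 => hP0 ?_) ?_
      · rw [← IsLocalization.map_under Q.primeCompl R P, Ideal.under_def, h0, Ideal.map_bot]
      · refine (Ideal.comap_mono (IsLocalRing.le_maximalIdeal hP.ne_top)).trans ?_
        exact (IsLocalization.AtPrime.under_maximalIdeal R Q).le
    rw [← IsLocalization.map_under Q.primeCompl R P, Ideal.under_def, h1,
      Localization.AtPrime.map_eq_maximalIdeal]
  obtain ⟨G, hGQ, hG⟩ := exists_finset_forall_smul_sub_mem_satur hden x hx ⟨Q, hQp⟩ hQ (Q : Set C)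
  have hmaxfg : (IsLocalRing.maximalIdeal R).FG := by
    refine ⟨insert (algebraMap C R (algebraMap E C x)) (G.image (algebraMap C R)), ?_⟩
    apply le_antisymm
    · rw [Submodule.span_le]
      intro v hv
      rw [← Localization.AtPrime.map_eq_maximalIdeal]
      rw [Finset.coe_insert, Set.mem_insert_iff, Finset.coe_image] at hv
      rcases hv with rfl | ⟨g, hg, rfl⟩
      · exact Ideal.mem_map_of_mem _ hxQ
      · exact Ideal.mem_map_of_mem _ (hGQ hg)
    · rw [← Localization.AtPrime.map_eq_maximalIdeal, Ideal.map_le_iff_le_comap]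
      intro c hc
      rw [Ideal.mem_comap]
      obtain ⟨s, hs, z, hz, t, ht, htz⟩ := hG c hc
      obtain ⟨w, hw⟩ := Ideal.mem_span_singleton.mp htz
      have hu : IsUnit (algebraMap C R (t * algebraMap E C s)) :=
        IsLocalization.map_units R (⟨t * algebraMap E C s, fun h =>
          (hQp.mem_or_mem h).elim ht hs⟩ : Q.primeCompl)
      have hTx : algebraMap C R (algebraMap E C x) ∈ Ideal.span
          ((insert (algebraMap C R (algebraMap E C x)) (G.image (algebraMap C R)) : Finset R) :
            Set R) := Ideal.subset_span (Finset.mem_insert_self _ _)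
      have hTG : ∀ g ∈ G, algebraMap C R g ∈ Ideal.span
          ((insert (algebraMap C R (algebraMap E C x)) (G.image (algebraMap C R)) : Finset R) :
            Set R) := fun g hg =>
        Ideal.subset_span (Finset.mem_insert_of_mem (Finset.mem_image_of_mem _ hg))
      rw [← Ideal.mul_unit_mem_iff_mem _ hu, ← map_mul,
        show c * (t * algebraMap E C s) = t * z + algebraMap E C x * w by
          rw [← hw, Algebra.smul_def]; ring, map_add, map_mul, map_mul]
      refine Ideal.add_mem _ (Ideal.mul_mem_left _ _ ?_) (Ideal.mul_mem_right _ _ hTx)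
      clear htz hw
      induction hz using Submodule.span_induction with
      | mem g hg => exact hTG g hg
      | zero => simp
      | add u v _ _ hu hv => rw [map_add]; exact Ideal.add_mem _ hu hv
      | smul e u _ hu => rw [Algebra.smul_def, map_mul]; exact Ideal.mul_mem_left _ _ hu
  have hnoeth : IsNoetherianRing R := by
    refine IsNoetherianRing.of_prime fun P hP => ?_
    by_cases hP0 : P = ⊥
    · rw [hP0]; exact Submodule.fg_bot
    · rw [hprime P hP hP0]; exact hmaxfg
  have hnf : ¬ IsField R := by
    intro hf
    have h1 := (IsLocalRing.isField_iff_maximalIdeal_eq).mp hf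
    have h2 : algebraMap C R (algebraMap E C x) ∈ IsLocalRing.maximalIdeal R := by
      rw [← Localization.AtPrime.map_eq_maximalIdeal]
      exact Ideal.mem_map_of_mem _ hxQ
    rw [h1, Ideal.mem_bot] at h2
    exact hxC (hinj (h2.trans (map_zero _).symm))
  have hic : IsIntegrallyClosed R := isIntegrallyClosed_of_isLocalization R Q.primeCompl hle
  have htfae : IsDiscreteValuationRing R ↔
      (IsIntegrallyClosed R ∧ ∃! P : Ideal R, P ≠ ⊥ ∧ P.IsPrime) :=
    (IsDiscreteValuationRing.TFAE R hnf).out 0 3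
  rw [htfae]
  refine ⟨hic, IsLocalRing.maximalIdeal R, ⟨?_, inferInstance⟩, fun P hP => hprime P hP.2 hP.1⟩
  exact fun h => hnf (IsLocalRing.isField_iff_maximalIdeal_eq.mpr h)

end DiscreteValuation

section PrincipalCompleteness

lemma Submodule.mem_span_singleton_pow_smul_top {B M : Type*} [CommRing B] [AddCommGroup M]
    [Module B M] (x : B) (n : ℕ) (v : M) :
    v ∈ (Ideal.span {x} ^ n • ⊤ : Submodule B M) ↔ ∃ w : M, x ^ n • w = v := by
  rw [Ideal.span_singleton_pow, Submodule.ideal_span_singleton_smul,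
    Submodule.mem_smul_pointwise_iff_exists]
  simp

lemma isPrecomplete_span_singleton_pi {B ι : Type*} [CommRing B] [IsNoetherianRing B]
    (J : Ideal B) [hJ : IsAdicComplete J B] (x : B) (hx : x ∈ J) :
    IsPrecomplete (Ideal.span {x}) (ι → B) := by
  refine ⟨fun f hf => ?_⟩
  have hf' : ∀ {m n}, m ≤ n → ∃ w : ι → B, x ^ m • w = f m - f n := fun {m n} hmn =>
    (Submodule.mem_span_singleton_pow_smul_top x m _).mp (SModEq.sub_mem.mp (hf hmn))
  have h1 : ∀ i, ∃ l : B, ∀ n, f n i - l ∈ J ^ n := by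
    intro i
    obtain ⟨l, hl⟩ := IsPrecomplete.prec (I := J) (M := B) inferInstance
      (f := fun n => f n i) (fun {m n} hmn => by
        obtain ⟨w, hw⟩ := hf' hmn
        rw [SModEq.sub_mem, smul_eq_mul, Ideal.mul_top]
        rw [show f m i - f n i = x ^ m * w i from (congrFun hw i).symm]
        exact Ideal.mul_mem_right _ _ (Ideal.pow_mem_pow hx m))
    refine ⟨l, fun n => ?_⟩
    have := hl n
    rwa [SModEq.sub_mem, smul_eq_mul, Ideal.mul_top] at this
  choose l hl using h1
  refine ⟨l, fun n => ?_⟩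
  rw [SModEq.sub_mem, Submodule.mem_span_singleton_pow_smul_top]
  have h2 : ∀ i, f n i - l i ∈ Ideal.span {x ^ n} := by
    intro i
    have : IsHausdorff J (B ⧸ Ideal.span {x ^ n}) :=
      IsHausdorff.of_le_jacobson _ _ (IsAdicComplete.le_jacobson_bot J)
    rw [← Ideal.Quotient.eq_zero_iff_mem]
    refine IsHausdorff.haus (I := J) this _ fun N => ?_
    rw [SModEq.zero]
    obtain ⟨w, hw⟩ := hf' (le_max_left n N)
    have h3 : f n i - l i = x ^ n * w i + (f (max n N) i - l i) := by
      rw [show x ^ n * w i = f n i - f (max n N) i from congrFun hw i]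
      ring
    have h4 : f (max n N) i - l i ∈ J ^ N := Ideal.pow_le_pow_right (le_max_right _ _) (hl i _)
    have h5 : Ideal.Quotient.mk (Ideal.span {x ^ n}) (f n i - l i) =
        (f (max n N) i - l i) • (1 : B ⧸ Ideal.span {x ^ n}) := by
      rw [h3, map_add, map_mul, (Ideal.Quotient.eq_zero_iff_mem).mpr
        (Ideal.mem_span_singleton_self (x ^ n)), zero_mul, zero_add, Algebra.smul_def, mul_one]
      rfl
    rw [h5]
    exact Submodule.smul_mem_smul h4 trivial
  choose w hw using fun i => Ideal.mem_span_singleton'.mp (h2 i)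
  refine ⟨w, funext fun i => ?_⟩
  rw [Pi.smul_apply, Pi.sub_apply, ← hw i, smul_eq_mul, mul_comm]

lemma finite_of_finite_quotient_span {B C : Type*} [CommRing B] [IsNoetherianRing B]
    (J : Ideal B) [IsAdicComplete J B] (x : B) (hx : x ∈ J) [CommRing C] [Algebra B C]
    (hC : ∀ c : C, (∀ n, algebraMap B C x ^ n ∣ c) → c = 0)
    (hfin : Module.Finite B (C ⧸ Ideal.span {algebraMap B C x})) : Module.Finite B C := by
  obtain ⟨k, g, hg⟩ := Module.Finite.exists_fin (R := B)
    (M := C ⧸ Ideal.span {algebraMap B C x})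
  choose c hc using fun i => Ideal.Quotient.mk_surjective (g i)
  let f : (Fin k → B) →ₗ[B] C := Fintype.linearCombination B c
  have hpre : IsPrecomplete (Ideal.span {x}) (Fin k → B) := isPrecomplete_span_singleton_pi J x hx
  have hhaus : IsHausdorff (Ideal.span {x}) C := by
    refine ⟨fun v hv => hC v fun n => ?_⟩
    have := hv n
    rw [SModEq.zero, Submodule.mem_span_singleton_pow_smul_top] at this
    obtain ⟨w, rfl⟩ := this
    rw [Algebra.smul_def, map_pow]
    exact dvd_mul_right _ _
  refine Module.Finite.of_surjective f
    (surjective_of_mkQ_comp_surjective (I := Ideal.span {x}) fun v => ?_)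
  obtain ⟨v, rfl⟩ := Submodule.Quotient.mk_surjective _ v
  have h1 : (Ideal.Quotient.mk (Ideal.span {algebraMap B C x}) v) ∈
    Submodule.span B (Set.range g) := hg ▸ trivial
  obtain ⟨b, hb⟩ := (Submodule.mem_span_range_iff_exists_fun B).mp h1
  refine ⟨b, ?_⟩
  rw [LinearMap.comp_apply, Submodule.mkQ_apply, Submodule.Quotient.eq]
  have h2 : f b - v ∈ Ideal.span {algebraMap B C x} := by
    rw [← Ideal.Quotient.eq, ← hb, Fintype.linearCombination_apply, map_sum]
    refine Finset.sum_congr rfl fun i _ => ?_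
    rw [← hc i, Algebra.smul_def, map_mul, Algebra.smul_def]
    rfl
  obtain ⟨w, hw⟩ := Ideal.mem_span_singleton'.mp h2
  have h3 := (Submodule.mem_span_singleton_pow_smul_top (M := C) x 1 (f b - v)).mpr
    ⟨w, by rw [← hw, Algebra.smul_def, pow_one, mul_comm]⟩
  rwa [pow_one] at h3

end PrincipalCompleteness

section QuotientFinite

lemma isNoetherian_quotient_of_linearMap {E M W : Type*} [CommRing E] [AddCommGroup M]
    [Module E M] [AddCommGroup W] [Module E W] [IsNoetherian E W] (N N' : Submodule E M)
    (hle : N' ≤ N) (hN : IsNoetherian E (M ⧸ N)) (f : N →ₗ[E] W)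
    (hf : ∀ a : N, f a = 0 → (a : M) ∈ N') : IsNoetherian E (M ⧸ N') := by
  have h1 : IsNoetherian E (N ⧸ LinearMap.ker f) :=
    isNoetherian_of_linearEquiv f.quotKerEquivRange.symm
  refine isNoetherian_of_range_eq_ker
    ((LinearMap.ker f).liftQ (N'.mkQ ∘ₗ N.subtype) fun a ha => ?_)
    (Submodule.factor hle) ?_
  · rw [LinearMap.mem_ker, LinearMap.comp_apply, Submodule.mkQ_apply,
      Submodule.Quotient.mk_eq_zero]
    exact hf a ha
  · rw [Submodule.range_liftQ]
    ext v
    obtain ⟨v, rfl⟩ := Submodule.Quotient.mk_surjective _ v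
    rw [LinearMap.mem_ker]
    have h2 : Submodule.factor hle (Submodule.Quotient.mk v) = 0 ↔ v ∈ N := by
      rw [← Submodule.mkQ_apply, Submodule.factor_mk, Submodule.mkQ_apply,
        Submodule.Quotient.mk_eq_zero]
    rw [h2]
    constructor
    · rintro ⟨a, ha⟩
      rw [LinearMap.comp_apply, Submodule.mkQ_apply, Submodule.Quotient.eq] at ha
      have := N.sub_mem a.2 (hle ha)
      simpa using this
    · intro hv
      exact ⟨⟨v, hv⟩, rfl⟩

lemma finite_quotient_of_mem_minimalPrimes {E C : Type u} [CommRing E] [IsDomain E]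
    [CommRing C] [IsDomain C] [Algebra E C] [Algebra.IsIntegral E C] [FaithfulSMul E C]
    [IsNoetherianRing E]
    (hden : ∀ c : C, ∃ l : E, l ≠ 0 ∧ ∃ l', algebraMap E C l' = algebraMap E C l * c)
    (x : E) (hx : x ≠ 0) (Q : Ideal C) [hQp : Q.IsPrime]
    (hQ : Q ∈ (Ideal.span {algebraMap E C x}).minimalPrimes)
    (hind : ∀ (E' K' : Type u) [CommRing E'] [IsDomain E'] [Field K'] [Algebra E' K']
      [FaithfulSMul E' K'] [Algebra E E'] [Module.Finite E E'], algebraMap E E' x = 0 →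
      (∀ z : K', ∃ l : E', l ≠ 0 ∧ ∃ l', algebraMap E' K' l' = algebraMap E' K' l * z) →
      Module.Finite E' (integralClosure E' K')) :
    Module.Finite E (C ⧸ Q) := by
  classical
  obtain ⟨G, -, hG⟩ := exists_finset_forall_smul_sub_mem_satur hden x hx ⟨Q, hQp⟩ hQ Set.univ
  have hxQ : algebraMap E C x ∈ Q := hQ.1.2 (Ideal.mem_span_singleton_self _)
  let E' : Subalgebra E (C ⧸ Q) := Algebra.adjoin E ((G.image (Ideal.Quotient.mk Q) : Finset _) : Set _)
  let K' := FractionRing (C ⧸ Q)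
  have hInteg : Algebra.IsIntegral E (C ⧸ Q) := inferInstance
  have hE'fg : (Subalgebra.toSubmodule E').FG := fg_adjoin_of_finite (Finset.finite_toSet _)
    fun v _ => Algebra.IsIntegral.isIntegral v
  have hE'fin : Module.Finite E E' := Module.Finite.iff_fg.mpr hE'fg
  have hinj : Function.Injective (algebraMap E' K') := by
    rw [IsScalarTower.algebraMap_eq E' (C ⧸ Q) K']
    exact (IsFractionRing.injective (C ⧸ Q) K').comp Subtype.val_injective
  have hfaith : FaithfulSMul E' K' := (faithfulSMul_iff_algebraMap_injective E' K').mpr hinj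
  have hsm : ∀ c : C ⧸ Q, ∃ s : E', s ≠ 0 ∧ ∃ s' : E', (s' : C ⧸ Q) = s * c := by
    intro c
    obtain ⟨c, rfl⟩ := Ideal.Quotient.mk_surjective c
    obtain ⟨s, hs, z, hz, t, ht, htz⟩ := hG c trivial
    have h1 : s • c - z ∈ Q := by
      obtain ⟨w, hw⟩ := Ideal.mem_span_singleton.mp htz
      refine (hQp.mem_or_mem (x := t) ?_).resolve_left ht
      rw [hw]
      exact Ideal.mul_mem_right _ _ hxQ
    have h2 : Ideal.Quotient.mk Q z ∈ E' := by
      clear h1 htz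
      induction hz using Submodule.span_induction with
      | mem g hg => exact Algebra.subset_adjoin (Finset.mem_image_of_mem _ hg)
      | zero => rw [map_zero]; exact E'.zero_mem
      | add u v _ _ hu hv => rw [map_add]; exact E'.add_mem hu hv
      | smul e u _ hu =>
        exact E'.smul_mem hu e
    refine ⟨algebraMap E E' s, fun h => hs ?_, ⟨_, h2⟩, ?_⟩
    · rw [← Ideal.Quotient.eq_zero_iff_mem]
      exact congrArg Subtype.val h
    · rw [← Ideal.Quotient.eq] at h1
      have h3 : Ideal.Quotient.mk Q z = algebraMap E (C ⧸ Q) s * Ideal.Quotient.mk Q c := by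
        rw [← h1, Algebra.smul_def, map_mul]
        rfl
      exact h3
  have hden' : ∀ z : K', ∃ l : E', l ≠ 0 ∧
      ∃ l', algebraMap E' K' l' = algebraMap E' K' l * z := by
    intro z
    obtain ⟨c, d, hd, rfl⟩ := IsFractionRing.div_surjective (A := C ⧸ Q) z
    obtain ⟨s, hs, s', hs'⟩ := hsm c
    obtain ⟨r, hr, r', hr'⟩ := hsm d
    have hd0 : d ≠ 0 := nonZeroDivisors.ne_zero hd
    have hr'0 : r' ≠ 0 := by
      intro h
      rw [h] at hr'
      exact (mul_ne_zero (fun h' => hr (Subtype.ext h')) hd0) hr'.symm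
    refine ⟨s * r', mul_ne_zero hs hr'0, r * s', ?_⟩
    have hd1 : algebraMap (C ⧸ Q) K' d ≠ 0 := by
      rwa [Ne, FaithfulSMul.algebraMap_eq_zero_iff]
    rw [IsScalarTower.algebraMap_apply E' (C ⧸ Q) K', IsScalarTower.algebraMap_apply E' (C ⧸ Q) K',
      show algebraMap E' (C ⧸ Q) (r * s') = r * (s * c) by rw [← hs']; rfl,
      show algebraMap E' (C ⧸ Q) (s * r') = s * (r * d) by rw [← hr']; rfl]
    simp only [map_mul]
    rw [← mul_div_assoc, eq_div_iff hd1]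
    ring
  have hfin := hind E' K' (by
    apply Subtype.ext
    exact Ideal.Quotient.eq_zero_iff_mem.mpr hxQ) hden'
  have hnE' : IsNoetherianRing E' := isNoetherian_of_tower E inferInstance
  have hInteg' : ∀ c : C ⧸ Q, IsIntegral E' c := fun c =>
    (Algebra.IsIntegral.isIntegral (R := E) c).tower_top
  have hsmul : ∀ (a : E') (b : C ⧸ Q),
      algebraMap (C ⧸ Q) K' (a • b) = a • algebraMap (C ⧸ Q) K' b := fun a b => by
    rw [Algebra.smul_def, map_mul, ← IsScalarTower.algebraMap_apply, ← Algebra.smul_def]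
  let φ : (C ⧸ Q) →ₗ[E'] integralClosure E' K' :=
    { toFun := fun c => ⟨algebraMap (C ⧸ Q) K' c, (hInteg' c).algebraMap⟩
      map_add' := fun a b => Subtype.ext (map_add _ a b)
      map_smul' := fun a b => Subtype.ext (hsmul a b) }
  have hφ : Function.Injective φ := fun a b h =>
    IsFractionRing.injective (C ⧸ Q) K' (congrArg Subtype.val h)
  have hfin2 : Module.Finite E' (C ⧸ Q) := Module.Finite.of_injective φ hφ
  exact Module.Finite.trans E' (C ⧸ Q)

lemma exists_notMem_forall_mem_satur {E C : Type*} [CommRing E] [IsDomain E]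
    [CommRing C] [IsDomain C] [Algebra E C] [Algebra.IsIntegral E C] [FaithfulSMul E C]
    [IsNoetherianRing E]
    (hden : ∀ c : C, ∃ l : E, l ≠ 0 ∧ ∃ l', algebraMap E C l' = algebraMap E C l * c)
    (x : E) (hx : x ≠ 0) (Q : Ideal C) [hQp : Q.IsPrime]
    (hQ : Q ∈ (Ideal.span {algebraMap E C x}).minimalPrimes) :
    ∃ b ∉ Q, ∀ Q' ∈ (Ideal.span {algebraMap E C x}).minimalPrimes, Q' ≠ Q →
      ∃ s ∉ Q', s * b ∈ Ideal.span {algebraMap E C x} := by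
  classical
  have h1 : ∀ Q' : Ideal C, ∃ b ∉ Q, Q' ∈ (Ideal.span {algebraMap E C x}).minimalPrimes →
      Q' ≠ Q → ∃ s ∉ Q', s * b ∈ Ideal.span {algebraMap E C x} := by
    intro Q'
    by_cases hQ' : Q' ∈ (Ideal.span {algebraMap E C x}).minimalPrimes ∧ Q' ≠ Q
    swap
    · exact ⟨1, (Ideal.ne_top_iff_one _).mp hQp.ne_top, fun h h' => absurd ⟨h, h'⟩ hQ'⟩
    obtain ⟨y, hyQ', hyQ⟩ := SetLike.not_le_iff_exists.mp
      fun h => hQ'.2 (le_antisymm h (hQ.2 hQ'.1.1 h))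
    obtain ⟨s, hs, k, hk⟩ := exists_mul_pow_mem_of_forall_prime (Ideal.span {algebraMap E C x})
      ⟨Q', hQ'.1.1.1⟩ y fun P hP hxP hPQ => hQ'.1.2 ⟨hP, hxP⟩ hPQ hyQ'
    exact ⟨y ^ k, fun h => hyQ (hQp.mem_of_pow_mem _ h), fun _ _ => ⟨s, hs, hk⟩⟩
  choose b hb hb' using h1
  have hfin := finite_minimalPrimes_span hden x hx
  refine ⟨∏ Q' ∈ hfin.toFinset, b Q', fun h => ?_, fun Q' hQ' hne => ?_⟩
  · obtain ⟨Q', -, h'⟩ := (hQp.prod_mem_iff).mp h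
    exact hb Q' h'
  · obtain ⟨s, hs, hsb⟩ := hb' Q' hQ' hne
    refine ⟨s, hs, ?_⟩
    rw [← Finset.mul_prod_erase _ _ (hfin.mem_toFinset.mpr hQ'), ← mul_assoc]
    exact Ideal.mul_mem_right _ _ hsb

lemma isNoetherian_quotient_satur {E C : Type*} [CommRing E] [IsDomain E]
    [CommRing C] [IsDomain C] [Algebra E C] [Algebra.IsIntegral E C] [FaithfulSMul E C]
    [IsNoetherianRing E] [IsIntegrallyClosed C]
    (hden : ∀ c : C, ∃ l : E, l ≠ 0 ∧ ∃ l', algebraMap E C l' = algebraMap E C l * c)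
    (x : E) (hx : x ≠ 0) (Q : Ideal C) [hQp : Q.IsPrime]
    (hQ : Q ∈ (Ideal.span {algebraMap E C x}).minimalPrimes)
    (hstar : ∀ y : C, (∀ Q' ∈ (Ideal.span {algebraMap E C x}).minimalPrimes,
      ∃ s ∉ Q', s * y ∈ Ideal.span {algebraMap E C x}) → y ∈ Ideal.span {algebraMap E C x})
    (hfin : Module.Finite E (C ⧸ Q)) :
    IsNoetherian E (C ⧸ (satur (Ideal.span {algebraMap E C x}) ⟨Q, hQp⟩).restrictScalars E) := by
  classical
  let R := Localization.AtPrime Q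
  have hdvr : IsDiscreteValuationRing R :=
    isDiscreteValuationRing_localization_of_isIntegral hden x hx Q hQ
  have hle : Q.primeCompl ≤ nonZeroDivisors C := Q.primeCompl_le_nonZeroDivisors
  have hinj : Function.Injective (algebraMap C R) := IsLocalization.injective R hle
  have hxC : algebraMap E C x ≠ 0 := by
    rwa [Ne, FaithfulSMul.algebraMap_eq_zero_iff]
  have hmem : ∀ c : C, c ∈ Q ↔ algebraMap C R c ∈ IsLocalRing.maximalIdeal R := fun c =>
    (IsLocalization.AtPrime.to_map_mem_maximal_iff R Q c).symm
  obtain ⟨ϖ, hϖ⟩ := IsDiscreteValuationRing.exists_irreducible R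
  obtain ⟨⟨π, u⟩, hπ⟩ := IsLocalization.surj Q.primeCompl ϖ
  have hu := IsLocalization.map_units R u
  have hπirr : Irreducible (algebraMap C R π) := by
    simp only at hπ
    rw [← hπ]
    exact (irreducible_mul_isUnit hu).mpr hϖ
  have hmaxπ : IsLocalRing.maximalIdeal R = Ideal.span {algebraMap C R π} :=
    hπirr.maximalIdeal_eq
  obtain ⟨e, he⟩ := IsDiscreteValuationRing.associated_pow_irreducible
    (fun h => hxC (hinj (h.trans (map_zero _).symm))) hπirr
  have hsat : ∀ y : C, y ∈ satur (Ideal.span {algebraMap E C x}) ⟨Q, hQp⟩ ↔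
      algebraMap C R π ^ e ∣ algebraMap C R y := by
    intro y
    rw [← he.dvd_iff_dvd_left, ← Ideal.mem_span_singleton, ← Set.image_singleton (f := algebraMap C R),
      ← Ideal.map_span (algebraMap C R), IsLocalization.algebraMap_mem_map_algebraMap_iff Q.primeCompl]
    constructor
    · rintro ⟨t, ht, h⟩
      exact ⟨t, ht, h⟩
    · rintro ⟨t, ht, h⟩
      exact ⟨t, ht, h⟩
  obtain ⟨b, hbQ, hb⟩ := exists_notMem_forall_mem_satur hden x hx Q hQ
  have hbu : IsUnit (algebraMap C R b) :=
    IsLocalization.map_units R (⟨b, hbQ⟩ : Q.primeCompl)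
  let F : ℕ → Submodule E C := fun n =>
    ((Ideal.span {algebraMap C R π ^ n}).comap (algebraMap C R)).restrictScalars E
  have hF : ∀ n c, c ∈ F n ↔ algebraMap C R π ^ n ∣ algebraMap C R c := fun n c =>
    Ideal.mem_span_singleton
  have key : ∀ n ≤ e, IsNoetherian E (C ⧸ F n) := by
    intro n
    induction n with
    | zero =>
      intro _
      have : F 0 = ⊤ := by
        rw [eq_top_iff]
        intro c _
        rw [hF]
        simp
      have : Subsingleton (C ⧸ F 0) := Submodule.Quotient.subsingleton_iff.mpr this
      infer_instance
    | succ n ih =>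
      intro hn
      have hdvd : ∀ a : F n, ∃ w : C, algebraMap E C x * w = b * π ^ (e - n) * a := by
        intro a
        have h1 : b * π ^ (e - n) * a ∈ Ideal.span {algebraMap E C x} := by
          refine hstar _ fun Q' hQ' => ?_
          by_cases hne : Q' = Q
          · subst hne
            have h2 : b * π ^ (e - n) * a ∈ satur (Ideal.span {algebraMap E C x}) ⟨Q', hQp⟩ := by
              rw [hsat, map_mul, map_mul, map_pow, ← Nat.sub_add_cancel (Nat.le_of_succ_le hn),
                pow_add, Nat.add_sub_cancel]
              exact mul_dvd_mul (dvd_mul_left _ _) ((hF n a).mp a.2)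
            exact h2
          · obtain ⟨s, hs, hsb⟩ := hb Q' hQ' hne
            refine ⟨s, hs, ?_⟩
            rw [mul_assoc, ← mul_assoc]
            exact Ideal.mul_mem_right _ _ hsb
        obtain ⟨w, hw⟩ := Ideal.mem_span_singleton.mp h1
        exact ⟨w, hw.symm⟩
      choose w hw using hdvd
      let f : F n →ₗ[E] C :=
        { toFun := w
          map_add' := fun a a' => mul_left_cancel₀ hxC (by
            rw [mul_add, hw, hw, hw, Submodule.coe_add, mul_add])
          map_smul' := fun c a => mul_left_cancel₀ hxC (by
            rw [RingHom.id_apply, mul_smul_comm, hw, hw, Submodule.coe_smul, mul_smul_comm]) }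
      have hnQ : IsNoetherian E (C ⧸ Q) := isNoetherian_of_isNoetherianRing_of_finite E _
      refine isNoetherian_quotient_of_linearMap (W := C ⧸ Q) (F n) (F (n + 1)) (fun c hc => ?_)
        (ih (Nat.le_of_succ_le hn)) ((Q.mkQ.restrictScalars E) ∘ₗ f) fun a ha => ?_
      · rw [hF] at hc ⊢
        exact (pow_dvd_pow _ (Nat.le_succ n)).trans hc
      · have h1 : w a ∈ Q := (Submodule.Quotient.mk_eq_zero _).mp ha
        rw [hmem, hmaxπ, Ideal.mem_span_singleton] at h1
        have h2 := congrArg (algebraMap C R) (hw a)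
        have h3 : algebraMap C R π ^ e * algebraMap C R π ∣
            algebraMap C R (b * π ^ (e - n) * a) := by
          rw [← h2, map_mul]
          exact mul_dvd_mul he.symm.dvd h1
        rw [hF]
        have h4 : algebraMap C R π ^ (e - n) ≠ 0 := pow_ne_zero _ hπirr.ne_zero
        rw [map_mul, map_mul, mul_assoc, hbu.dvd_mul_left, map_pow, ← pow_succ,
          show e + 1 = (e - n) + (n + 1) by lia, pow_add, mul_dvd_mul_iff_left h4] at h3
        exact h3
  have hFe : F e = (satur (Ideal.span {algebraMap E C x}) ⟨Q, hQp⟩).restrictScalars E := by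
    ext c
    rw [hF]
    exact (hsat c).symm
  rw [← hFe]
  exact key e le_rfl

lemma isNoetherian_quotient_span {E C : Type*} [CommRing E] [IsDomain E]
    [CommRing C] [IsDomain C] [Algebra E C] [Algebra.IsIntegral E C] [FaithfulSMul E C]
    [IsNoetherianRing E] [IsIntegrallyClosed C]
    (hden : ∀ c : C, ∃ l : E, l ≠ 0 ∧ ∃ l', algebraMap E C l' = algebraMap E C l * c)
    (x : E) (hx : x ≠ 0)
    (hstar : ∀ y : C, (∀ Q' ∈ (Ideal.span {algebraMap E C x}).minimalPrimes,
      ∃ s ∉ Q', s * y ∈ Ideal.span {algebraMap E C x}) → y ∈ Ideal.span {algebraMap E C x})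
    (hfin : ∀ Q ∈ (Ideal.span {algebraMap E C x}).minimalPrimes, Module.Finite E (C ⧸ Q)) :
    IsNoetherian E (C ⧸ Ideal.span {algebraMap E C x}) := by
  let P := {Q : Ideal C // Q ∈ (Ideal.span {algebraMap E C x}).minimalPrimes}
  have hP : Finite P := finite_minimalPrimes_span hden x hx
  let s : P → Submodule E C := fun Q =>
    (satur (Ideal.span {algebraMap E C x}) ⟨Q.1, Q.2.1.1⟩).restrictScalars E
  have hs : ∀ Q, IsNoetherian E (C ⧸ s Q) := fun Q => by
    have : Q.1.IsPrime := Q.2.1.1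
    exact isNoetherian_quotient_satur hden x hx Q.1 Q.2 hstar (hfin Q.1 Q.2)
  let f : C →ₗ[E] (∀ Q, C ⧸ s Q) := LinearMap.pi fun Q => (s Q).mkQ
  have hker : LinearMap.ker f ≤ (Ideal.span {algebraMap E C x}).restrictScalars E := by
    intro y hy
    refine hstar y fun Q hQ => ?_
    have h1 := congrFun hy ⟨Q, hQ⟩
    exact (Submodule.Quotient.mk_eq_zero _).mp h1
  have h1 : IsNoetherian E (C ⧸ LinearMap.ker f) :=
    isNoetherian_of_linearEquiv f.quotKerEquivRange.symm
  let g : (C ⧸ LinearMap.ker f) →ₗ[E] (C ⧸ Ideal.span {algebraMap E C x}) :=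
    (LinearMap.ker f).liftQ (Ideal.Quotient.mkₐ E (Ideal.span {algebraMap E C x})).toLinearMap
      fun y hy => Ideal.Quotient.eq_zero_iff_mem.mpr (hker hy)
  refine isNoetherian_of_surjective g (LinearMap.range_eq_top.mpr fun v => ?_)
  obtain ⟨y, rfl⟩ := Ideal.Quotient.mk_surjective v
  exact ⟨Submodule.Quotient.mk y, rfl⟩

end QuotientFinite

section CompleteLocal

lemma eq_zero_of_forall_pow_dvd_of_isIntegral {E C : Type*} [CommRing E] [IsDomain E]
    [CommRing C] [IsDomain C] [Algebra E C] [Algebra.IsIntegral E C] [FaithfulSMul E C]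
    [IsNoetherianRing E] [IsIntegrallyClosed C]
    (hden : ∀ c : C, ∃ l : E, l ≠ 0 ∧ ∃ l', algebraMap E C l' = algebraMap E C l * c)
    (x : E) (hx : x ≠ 0) (hxu : ¬ IsUnit (algebraMap E C x)) (c : C)
    (hc : ∀ n, algebraMap E C x ^ n ∣ c) : c = 0 := by
  obtain ⟨Q, hQ⟩ := Ideal.nonempty_minimalPrimes (I := Ideal.span {algebraMap E C x})
    fun h => hxu (Ideal.span_singleton_eq_top.mp h)
  have hQp : Q.IsPrime := hQ.1.1
  have hdvr : IsDiscreteValuationRing (Localization.AtPrime Q) :=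
    isDiscreteValuationRing_localization_of_isIntegral hden x hx Q hQ
  have hinj : Function.Injective (algebraMap C (Localization.AtPrime Q)) :=
    IsLocalization.injective _ Q.primeCompl_le_nonZeroDivisors
  have h1 : algebraMap C (Localization.AtPrime Q) c ∈
      ⨅ n, IsLocalRing.maximalIdeal (Localization.AtPrime Q) ^ n := by
    rw [Submodule.mem_iInf]
    intro n
    obtain ⟨w, hw⟩ := hc n
    rw [hw, map_mul, map_pow]
    refine Ideal.mul_mem_right _ _ (Ideal.pow_mem_pow ?_ n)
    rw [← Localization.AtPrime.map_eq_maximalIdeal]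
    exact Ideal.mem_map_of_mem _ (hQ.1.2 (Ideal.mem_span_singleton_self _))
  rw [Ideal.iInf_pow_eq_bot_of_isLocalRing _ (Ideal.IsPrime.ne_top inferInstance),
    Ideal.mem_bot] at h1
  exact hinj (h1.trans (map_zero _).symm)

lemma not_isUnit_algebraMap_of_mem_jacobson {B C : Type*} [CommRing B] [CommRing C] [Nontrivial C]
    [Algebra B C] [Algebra.IsIntegral B C] (x : B) (hx : x ∈ Ideal.jacobson (⊥ : Ideal B)) :
    ¬ IsUnit (algebraMap B C x) := by
  intro hu
  obtain ⟨M, hM, hle⟩ := Ideal.exists_le_maximal (RingHom.ker (algebraMap B C))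
    (RingHom.ker_ne_top _)
  obtain ⟨Q, hQ, hQM⟩ := Ideal.exists_ideal_over_maximal_of_isIntegral M hle
  have hxM : x ∈ M := (Ideal.mem_sInf.mp hx) ⟨bot_le, hM⟩
  rw [← hQM, Ideal.mem_comap] at hxM
  exact hQ.ne_top (Ideal.eq_top_of_isUnit_mem _ hxM hu)

lemma finite_integralClosure_of_isAdicComplete {B : Type u} [CommRing B] [IsNoetherianRing B]
    (J : Ideal B) [hJm : J.IsMaximal] [hJ : IsAdicComplete J B] (a : Ideal B) :
    ∀ (E K : Type u) [CommRing E] [IsDomain E] [Field K] [Algebra E K] [FaithfulSMul E K]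
      [Algebra B E] [Module.Finite B E], RingHom.ker (algebraMap B E) = a →
      (∀ z : K, ∃ l : E, l ≠ 0 ∧ ∃ l', algebraMap E K l' = algebraMap E K l * z) →
      Module.Finite E (integralClosure E K) := by
  induction a using WellFoundedGT.induction with
  | ind a ih =>
  intro E K _ _ _ _ _ _ _ hker hdenK
  have hinjK : Function.Injective (algebraMap E K) := FaithfulSMul.algebraMap_injective E K
  by_cases hJa : J ≤ a
  · have hcomap : (⊥ : Ideal E).comap (algebraMap B E) = J := by
      rw [← RingHom.ker_eq_comap_bot, hker]
      refine (hJm.eq_of_le ?_ hJa).symm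
      rw [← hker]
      exact RingHom.ker_ne_top _
    have hmax : (⊥ : Ideal E).IsMaximal := by
      refine Ideal.isMaximal_of_isIntegral_of_isMaximal_comap (R := B) _ ?_
      rw [hcomap]
      exact hJm
    have hfield : IsField E := Ring.isField_iff_maximal_bot.mpr hmax
    refine Module.Finite.of_surjective (Algebra.linearMap E (integralClosure E K)) fun z => ?_
    obtain ⟨l, hl, l', hl'⟩ := hdenK z
    obtain ⟨m, hm⟩ := hfield.mul_inv_cancel hl
    refine ⟨m * l', Subtype.ext ?_⟩
    change algebraMap E K (m * l') = z
    rw [map_mul, hl', ← mul_assoc, ← map_mul, mul_comm m, hm, map_one, one_mul]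
  obtain ⟨x, hxJ, hxa⟩ := SetLike.not_le_iff_exists.mp hJa
  have hx : algebraMap B E x ≠ 0 := by
    rw [← hker, RingHom.mem_ker] at hxa
    exact hxa
  have hnE : IsNoetherianRing E := isNoetherian_of_tower B inferInstance
  let C := integralClosure E K
  have hinjC : Function.Injective (algebraMap E C) := fun u v huv =>
    hinjK (congrArg Subtype.val huv)
  have hfC : FaithfulSMul E C := (faithfulSMul_iff_algebraMap_injective E C).mpr hinjC
  have hdenC : ∀ c : C, ∃ l : E, l ≠ 0 ∧ ∃ l', algebraMap E C l' = algebraMap E C l * c := by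
    intro c
    obtain ⟨l, hl, l', hl'⟩ := hdenK c
    exact ⟨l, hl, l', Subtype.ext hl'⟩
  have hiC : Algebra.IsIntegral E C := inferInstance
  have halg : Algebra.IsAlgebraic E K := by
    refine ⟨fun z => ?_⟩
    obtain ⟨l, hl, l', hl'⟩ := hdenK z
    refine ⟨Polynomial.C l * X - Polynomial.C l', fun h => hl ?_, by simp [hl']⟩
    have := congrArg (fun p => coeff p 1) h
    simpa using this
  have hfrac : IsFractionRing C K := integralClosure.isFractionRing_of_algebraic
    ((injective_iff_map_eq_zero _).mp hinjK)
  have hic : IsIntegrallyClosed C := (isIntegrallyClosed_iff K).mpr fun {z} hz =>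
    ⟨⟨z, isIntegral_trans z hz⟩, rfl⟩
  let _ : Algebra B C := ((algebraMap E C).comp (algebraMap B E)).toAlgebra
  have htower : IsScalarTower B E C := IsScalarTower.of_algebraMap_eq' rfl
  have hBC : Algebra.IsIntegral B C := Algebra.IsIntegral.trans E
  have hxu : ¬ IsUnit (algebraMap E C (algebraMap B E x)) := by
    rw [← IsScalarTower.algebraMap_apply B E C]
    exact not_isUnit_algebraMap_of_mem_jacobson x (IsAdicComplete.le_jacobson_bot J hxJ)
  have hstar : ∀ y : C, (∀ Q' ∈ (Ideal.span {algebraMap E C (algebraMap B E x)}).minimalPrimes,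
      ∃ s ∉ Q', s * y ∈ Ideal.span {algebraMap E C (algebraMap B E x)}) →
      y ∈ Ideal.span {algebraMap E C (algebraMap B E x)} := fun y h =>
    mem_span_of_forall_minimalPrimes _ hx y h
  have hnoeth : IsNoetherian E (C ⧸ Ideal.span {algebraMap E C (algebraMap B E x)}) := by
    refine isNoetherian_quotient_span hdenC _ hx hstar fun Q hQ => ?_
    have hQp : Q.IsPrime := hQ.1.1
    refine finite_quotient_of_mem_minimalPrimes hdenC _ hx Q hQ ?_
    intro E' K' _ _ _ _ _ _ _ hxE' hden'
    let _ : Algebra B E' := ((algebraMap E E').comp (algebraMap B E)).toAlgebra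
    have htower' : IsScalarTower B E E' := IsScalarTower.of_algebraMap_eq' rfl
    have hfinE' : Module.Finite B E' := Module.Finite.trans E E'
    refine ih (RingHom.ker (algebraMap B E')) (SetLike.lt_iff_le_and_exists.mpr
      ⟨fun b hb => ?_, x, ?_, hxa⟩) E' K' rfl hden'
    · rw [← hker, RingHom.mem_ker] at hb
      rw [RingHom.mem_ker, IsScalarTower.algebraMap_apply B E E', hb, map_zero]
    · rw [RingHom.mem_ker, IsScalarTower.algebraMap_apply B E E', hxE']
  have hfinBC : Module.Finite B C := by
    refine finite_of_finite_quotient_span J x hxJ (fun c hc => ?_) ?_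
    · refine eq_zero_of_forall_pow_dvd_of_isIntegral hdenC _ hx hxu c fun n => ?_
      rw [← IsScalarTower.algebraMap_apply B E C]
      exact hc n
    · rw [IsScalarTower.algebraMap_apply B E C]
      have : Module.Finite E (C ⧸ Ideal.span {algebraMap E C (algebraMap B E x)}) := inferInstance
      exact Module.Finite.trans E _
  exact Module.Finite.of_restrictScalars_finite B E C

end CompleteLocal

section ReducedIntegralClosure

lemma mem_nonZeroDivisors_of_forall_minimalPrimes {B : Type*} [CommRing B] [IsReduced B] (x : B)
    (hx : ∀ p ∈ (⊥ : Ideal B).minimalPrimes, x ∉ p) : x ∈ nonZeroDivisors B := by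
  rw [mem_nonZeroDivisors_iff_right]
  intro z hz
  have h1 : z ∈ (⊥ : Ideal B).radical := by
    rw [← Ideal.sInf_minimalPrimes, Ideal.mem_sInf]
    intro p hp
    have hpp : p.IsPrime := hp.1.1
    exact (hpp.mem_or_mem (show z * x ∈ p by rw [hz]; exact p.zero_mem)).resolve_right (hx p hp)
  obtain ⟨n, hn⟩ := h1
  exact eq_zero_of_pow_eq_zero hn

lemma notMem_of_mem_nonZeroDivisors_of_mem_minimalPrimes {B : Type*} [CommRing B] (x : B)
    (hx : x ∈ nonZeroDivisors B) (p : Ideal B) (hp : p ∈ (⊥ : Ideal B).minimalPrimes) : x ∉ p := by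
  intro h
  have hpp : p.IsPrime := hp.1.1
  obtain ⟨s, hs, b, hsb⟩ := exists_mul_pow_mem_of_forall_prime ⊥ ⟨p, hpp⟩ x
    fun P hP h0 hle => hp.2 ⟨hP, h0⟩ hle h
  have := (mem_nonZeroDivisors_iff_right.mp (pow_mem hx b)) s hsb
  exact hs (this ▸ p.zero_mem)

lemma finite_integralClosure_localizationAway {B : Type u} [CommRing B] [IsNoetherianRing B]
    [IsReduced B] (x : B) (hx : x ∈ nonZeroDivisors B) (T : Type*) [CommRing T] [Algebra B T]
    [IsLocalization.Away x T]
    (hB : ∀ p ∈ (⊥ : Ideal B).minimalPrimes,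
      Module.Finite (B ⧸ p) (integralClosure (B ⧸ p) (FractionRing (B ⧸ p)))) :
    Module.Finite B (integralClosure B T) := by
  let P := {p : Ideal B // p ∈ (⊥ : Ideal B).minimalPrimes}
  have hPfin : Finite P := Ideal.finite_minimalPrimes_of_isNoetherianRing B ⊥
  have hPp : ∀ p : P, p.1.IsPrime := fun p => p.2.1.1
  let K : P → Type u := fun p => FractionRing (B ⧸ p.1)
  have hu : ∀ p : P, IsUnit (algebraMap B (K p) x) := by
    intro p
    rw [isUnit_iff_ne_zero, IsScalarTower.algebraMap_apply B (B ⧸ p.1) (K p), Ne,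
      FaithfulSMul.algebraMap_eq_zero_iff]
    exact fun h => notMem_of_mem_nonZeroDivisors_of_mem_minimalPrimes x hx p.1 p.2
      (Ideal.Quotient.eq_zero_iff_mem.mp h)
  let ρ : ∀ p : P, T →+* K p := fun p => IsLocalization.Away.lift x (hu p)
  have hρ : ∀ p b, ρ p (algebraMap B T b) = algebraMap B (K p) b := fun p b =>
    IsLocalization.Away.lift_eq x (hu p) b
  let ρ' : ∀ p : P, T →ₐ[B] K p := fun p => { ρ p with commutes' := hρ p }
  have hInteg : ∀ (p : P) (z : integralClosure B T), IsIntegral (B ⧸ p.1) (ρ p z) := fun p z =>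
    (z.2.map (ρ' p)).tower_top
  let f : integralClosure B T →ₗ[B] (∀ p : P, integralClosure (B ⧸ p.1) (K p)) :=
    LinearMap.pi fun p =>
      { toFun := fun z => ⟨ρ p z, hInteg p z⟩
        map_add' := fun a b => Subtype.ext (map_add (ρ p) _ _)
        map_smul' := fun c a => Subtype.ext (map_smul (ρ' p) c (a : T)) }
  have hf : Function.Injective f := by
    rw [injective_iff_map_eq_zero]
    intro z hz
    apply Subtype.ext
    obtain ⟨n, y, hy⟩ := IsLocalization.Away.surj x (z : T)
    have hxT : IsUnit (algebraMap B T x ^ n) := (IsLocalization.Away.algebraMap_isUnit x).pow n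
    have hy0 : y = 0 := by
      have h1 : y ∈ (⊥ : Ideal B).radical := by
        rw [← Ideal.sInf_minimalPrimes, Ideal.mem_sInf]
        intro p hp
        have h2 : ρ ⟨p, hp⟩ z = 0 := congrArg Subtype.val (congrFun hz ⟨p, hp⟩)
        have h3 := congrArg (ρ ⟨p, hp⟩) hy
        rw [map_mul, h2, zero_mul, hρ, IsScalarTower.algebraMap_apply B (B ⧸ p) (K ⟨p, hp⟩)] at h3
        have hpp : p.IsPrime := hp.1.1
        have h4 : algebraMap B (B ⧸ p) y = 0 :=
          (FaithfulSMul.algebraMap_eq_zero_iff (B ⧸ p) (FractionRing (B ⧸ p))).mp h3.symm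
        exact Ideal.Quotient.eq_zero_iff_mem.mp h4
      obtain ⟨k, hk⟩ := h1
      exact eq_zero_of_pow_eq_zero hk
    rw [hy0, map_zero] at hy
    exact (hxT.mul_left_eq_zero).mp hy
  have hfin : ∀ p : P, Module.Finite B (integralClosure (B ⧸ p.1) (K p)) := fun p => by
    have := hB p.1 p.2
    exact Module.Finite.trans (B ⧸ p.1) _
  exact Module.Finite.of_injective f hf

lemma exists_pow_mul_mem_range_of_isIntegral {B : Type u} [CommRing B] [IsNoetherianRing B]
    [IsReduced B] (J : Ideal B) [J.IsMaximal] [IsAdicComplete J B] (x : B)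
    (hx : x ∈ nonZeroDivisors B) (T : Type*) [CommRing T] [Algebra B T]
    [IsLocalization.Away x T] :
    ∃ k, ∀ z : T, IsIntegral B z → ∃ b, algebraMap B T b = algebraMap B T x ^ k * z := by
  have hfin : Module.Finite B (integralClosure B T) := by
    refine finite_integralClosure_localizationAway x hx T fun p hp => ?_
    have hpp : p.IsPrime := hp.1.1
    refine finite_integralClosure_of_isAdicComplete J _ (B ⧸ p) (FractionRing (B ⧸ p)) rfl
      fun z => ?_
    obtain ⟨c, d, hd, rfl⟩ := IsFractionRing.div_surjective (A := B ⧸ p) z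
    have hd0 : algebraMap (B ⧸ p) (FractionRing (B ⧸ p)) d ≠ 0 := by
      rw [Ne, FaithfulSMul.algebraMap_eq_zero_iff]
      exact nonZeroDivisors.ne_zero hd
    exact ⟨d, nonZeroDivisors.ne_zero hd, c, (mul_div_cancel₀ _ hd0).symm⟩
  have key : ∀ N : Submodule B T, N.FG → ∃ k, ∀ z ∈ N, ∃ b,
      algebraMap B T b = algebraMap B T x ^ k * z := by
    intro N hN
    induction N, hN using Submodule.fg_induction with
    | singleton v =>
      obtain ⟨k, y, hy⟩ := IsLocalization.Away.surj x v
      refine ⟨k, fun z hz => ?_⟩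
      obtain ⟨a, rfl⟩ := Submodule.mem_span_singleton.mp hz
      exact ⟨a * y, by rw [map_mul, ← hy, Algebra.smul_def]; ring⟩
    | sup a b ha hb iha ihb =>
      obtain ⟨k, hk⟩ := iha
      obtain ⟨l, hl⟩ := ihb
      refine ⟨k + l, fun z hz => ?_⟩
      obtain ⟨c, hc, d, hd, rfl⟩ := Submodule.mem_sup.mp hz
      obtain ⟨c', hc'⟩ := hk c hc
      obtain ⟨d', hd'⟩ := hl d hd
      refine ⟨x ^ l * c' + x ^ k * d', ?_⟩
      rw [map_add, map_mul, map_mul, hc', hd', map_pow, map_pow]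
      ring
  obtain ⟨k, hk⟩ := key (Subalgebra.toSubmodule (integralClosure B T))
    (Module.Finite.iff_fg.mp hfin)
  exact ⟨k, fun z hz => hk z hz⟩

end ReducedIntegralClosure

section ReesPowers

lemma coeff_mem_of_mem_maxHomIdeal_pow {A : Type*} [CommRing A] [IsLocalRing A] {I : Ideal A}
    (n : ℕ) (f : reesAlgebra I) (hf : f ∈ maxHomIdeal (reesAlgebra I) ^ n) (j : ℕ) :
    (f : A[X]).coeff j ∈ IsLocalRing.maximalIdeal A ^ (n - j) * I ^ j := by
  induction n generalizing f j with
  | zero =>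
    simpa using (mem_reesAlgebra_iff I (f : A[X])).mp f.2 j
  | succ n ih =>
    rw [pow_succ] at hf
    refine Submodule.mul_induction_on hf ?_ ?_
    · intro g hg h hh
      rw [MulMemClass.coe_mul, coeff_mul]
      refine Ideal.sum_mem _ fun p hp => ?_
      rw [Finset.HasAntidiagonal.mem_antidiagonal] at hp
      have h1 := ih g hg p.1
      rcases Nat.eq_zero_or_pos p.2 with h0 | h0
      · have h2 : (h : A[X]).coeff p.2 ∈ IsLocalRing.maximalIdeal A := by rw [h0]; exact hh
        have h3 := Ideal.mul_mem_mul h1 h2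
        have hpj : p.1 = j := by omega
        rw [hpj, mul_right_comm, ← pow_succ] at h3
        rw [hpj]
        exact Ideal.mul_mono_left (Ideal.pow_le_pow_right (by omega)) h3
      · have h2 := (mem_reesAlgebra_iff I (h : A[X])).mp h.2 p.2
        have h3 := Ideal.mul_mem_mul h1 h2
        rw [mul_assoc, ← pow_add, hp] at h3
        exact Ideal.mul_mono_left (Ideal.pow_le_pow_right (by omega)) h3
    · intro a b ha hb
      rw [AddMemClass.coe_add, coeff_add]
      exact Ideal.add_mem _ ha hb

lemma monomial_mem_maxHomIdeal_pow {A : Type*} [CommRing A] [IsLocalRing A] {I : Ideal A}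
    (k j : ℕ) (a : A) (ha : a ∈ IsLocalRing.maximalIdeal A ^ k * I ^ j) :
    ∃ f ∈ maxHomIdeal (reesAlgebra I) ^ (k + j), (f : A[X]) = monomial j a := by
  have hC : ∀ c ∈ IsLocalRing.maximalIdeal A ^ k,
      algebraMap A (reesAlgebra I) c ∈ maxHomIdeal (reesAlgebra I) ^ k := by
    have h1 : IsLocalRing.maximalIdeal A ≤
        (maxHomIdeal (reesAlgebra I)).comap (algebraMap A (reesAlgebra I)) := by
      intro c hc
      change ((algebraMap A (reesAlgebra I) c : reesAlgebra I) : A[X]).coeff 0 ∈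
        IsLocalRing.maximalIdeal A
      rw [Subalgebra.coe_algebraMap, Polynomial.algebraMap_apply, Algebra.algebraMap_self,
        RingHom.id_apply, coeff_C_zero]
      exact hc
    exact Ideal.pow_le_comap_pow h1 k
  have hI : ∀ (j : ℕ), ∀ b ∈ I ^ j,
      ∃ f ∈ maxHomIdeal (reesAlgebra I) ^ j, (f : A[X]) = monomial j b := by
    intro j
    induction j with
    | zero => exact fun b _ => ⟨algebraMap A _ b, by simp, rfl⟩
    | succ j ih =>
      intro b hb
      rw [pow_succ] at hb
      refine Submodule.mul_induction_on hb ?_ ?_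
      · intro c hc e he
        obtain ⟨f, hf, hfc⟩ := ih c hc
        have he' : monomial 1 e ∈ reesAlgebra I :=
          reesAlgebra.monomial_mem.mpr (by simpa using he)
        refine ⟨f * ⟨monomial 1 e, he'⟩, ?_, ?_⟩
        · rw [pow_succ]
          refine Ideal.mul_mem_mul hf ?_
          change (monomial 1 e).coeff 0 ∈ IsLocalRing.maximalIdeal A
          simp [coeff_monomial]
        · rw [MulMemClass.coe_mul, hfc, monomial_mul_monomial]
      · rintro x y ⟨f, hf, rfx⟩ ⟨g, hg, rgx⟩
        exact ⟨f + g, Ideal.add_mem _ hf hg, by simp [rfx, rgx]⟩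
  refine Submodule.mul_induction_on ha ?_ ?_
  · intro c hc b hb
    obtain ⟨f, hf, hfc⟩ := hI j b hb
    refine ⟨algebraMap A _ c * f, ?_, ?_⟩
    · rw [pow_add]
      exact Ideal.mul_mem_mul (hC c hc) hf
    · rw [MulMemClass.coe_mul, hfc, Subalgebra.coe_algebraMap, Polynomial.algebraMap_apply,
        Algebra.algebraMap_self, RingHom.id_apply, C_mul_monomial]
  · rintro x y ⟨f, hf, rfx⟩ ⟨g, hg, rgx⟩
    exact ⟨f + g, Ideal.add_mem _ hf hg, by simp [rfx, rgx]⟩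

lemma mem_maxHomIdeal_pow_iff {A : Type*} [CommRing A] [IsLocalRing A] {I : Ideal A}
    (n : ℕ) (f : reesAlgebra I) : f ∈ maxHomIdeal (reesAlgebra I) ^ n ↔
      ∀ j, (f : A[X]).coeff j ∈ IsLocalRing.maximalIdeal A ^ (n - j) * I ^ j := by
  refine ⟨coeff_mem_of_mem_maxHomIdeal_pow n f, fun h => ?_⟩
  choose g hg hgc using fun j => monomial_mem_maxHomIdeal_pow (n - j) j _ (h j)
  have hf : f = ∑ j ∈ (f : A[X]).support, g j := by
    apply Subtype.ext
    rw [AddSubmonoidClass.coe_finsetSum]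
    simp only [hgc]
    exact (f : A[X]).as_sum_support
  rw [hf]
  exact Ideal.sum_mem _ fun j _ => Ideal.pow_le_pow_right (by omega) (hg j)

lemma mem_pow_of_sq_mem_pow {A : Type*} [CommRing A] (m : Ideal A)
    (hred : IsReduced (AdicCompletion m A)) (a : ℕ → A) (h1 : ∀ n, a n - a (n + 1) ∈ m ^ n)
    (h2 : ∀ n, a n ^ 2 ∈ m ^ n) (n : ℕ) : a n ∈ m ^ n := by
  let s : AdicCompletion.AdicCauchySequence m A := AdicCompletion.AdicCauchySequence.mk m A a
    fun n => by rw [SModEq.sub_mem]; simpa using h1 n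
  have hs : (AdicCompletion.mk m A s) ^ 2 = 0 := by
    apply AdicCompletion.ext_evalₐ
    intro n
    rw [map_pow, AdicCompletion.evalₐ_mk, map_zero, ← map_pow, Ideal.Quotient.eq_zero_iff_mem]
    exact h2 n
  have h0 := congrArg (AdicCompletion.evalₐ m n) (pow_eq_zero_iff (two_ne_zero) |>.mp hs)
  rw [AdicCompletion.evalₐ_mk, map_zero, Ideal.Quotient.eq_zero_iff_mem] at h0
  exact h0

lemma coeff_mem_pow_of_sq_mem_maxHomIdeal_pow {A : Type*} [CommRing A] [IsLocalRing A]
    (hred : IsReduced (AdicCompletion (IsLocalRing.maximalIdeal A) A)) {I : Ideal A}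
    (r : ℕ → reesAlgebra I)
    (hsq : ∀ n, r n ^ 2 ∈ maxHomIdeal (reesAlgebra I) ^ n)
    (hsub : ∀ p q, p ≤ q → ∀ j, (r p : A[X]).coeff j - (r q : A[X]).coeff j ∈
      IsLocalRing.maximalIdeal A ^ (p - j) * I ^ j) (j n : ℕ) :
    (r (n + j) : A[X]).coeff j ∈ IsLocalRing.maximalIdeal A ^ n := by
  induction j using Nat.strong_induction_on generalizing n with
  | _ j ih =>
    have hdiff : ∀ n, (r (n + 2 * j) : A[X]).coeff j - (r (n + 1 + 2 * j) : A[X]).coeff j ∈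
        IsLocalRing.maximalIdeal A ^ n := by
      intro n
      have h0 := hsub (n + 2 * j) (n + 1 + 2 * j) (by omega) j
      have h1 := Ideal.mul_le_left h0
      have h2 : n ≤ n + 2 * j - j := by omega
      exact Ideal.pow_le_pow_right h2 h1
    have key := mem_pow_of_sq_mem_pow _ hred (fun n => (r (n + 2 * j) : A[X]).coeff j)
      hdiff ?_ n
    · have h3 := Ideal.mul_le_left (hsub (n + j) (n + 2 * j) (by omega) j)
      rw [Nat.add_sub_cancel] at h3
      have h4 := Ideal.add_mem _ h3 key
      rwa [sub_add_cancel] at h4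
    · intro n
      have h1 := Ideal.mul_le_left
        (coeff_mem_of_mem_maxHomIdeal_pow _ _ (hsq (n + 2 * j)) (2 * j))
      rw [SubmonoidClass.coe_pow, sq, coeff_mul, Nat.add_sub_cancel] at h1
      have hmem : (j, j) ∈ Finset.HasAntidiagonal.antidiagonal (2 * j) := by simp; omega
      rw [← Finset.add_sum_erase _ _ hmem] at h1
      have h2 : ∑ p ∈ (Finset.HasAntidiagonal.antidiagonal (2 * j)).erase (j, j),
          (r (n + 2 * j) : A[X]).coeff p.1 * (r (n + 2 * j) : A[X]).coeff p.2 ∈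
          IsLocalRing.maximalIdeal A ^ n := by
        refine Ideal.sum_mem _ fun p hp => ?_
        rw [Finset.mem_erase, Finset.HasAntidiagonal.mem_antidiagonal] at hp
        have hlt : p.1 < j ∨ p.2 < j := by
          by_contra hcon
          exact hp.1 (Prod.ext (by dsimp only; omega) (by dsimp only; omega))
        have small : ∀ i < j, (r (n + 2 * j) : A[X]).coeff i ∈
            IsLocalRing.maximalIdeal A ^ n := by
          intro i hi
          have := ih i hi (n + 2 * j - i)
          rw [Nat.sub_add_cancel (by omega)] at this
          exact Ideal.pow_le_pow_right (by omega) this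
        rcases hlt with hlt | hlt
        · exact Ideal.mul_mem_right _ _ (small _ hlt)
        · exact Ideal.mul_mem_left _ _ (small _ hlt)
      have h3 := (Ideal.add_mem_iff_left _ h2).mp h1
      simpa [sq] using h3

theorem isReduced_adicCompletion_reesAlgebra {A : Type*} [CommRing A] [IsNoetherianRing A]
    [IsLocalRing A] (hred : IsReduced (AdicCompletion (IsLocalRing.maximalIdeal A) A))
    (I : Ideal A) :
    IsReduced (AdicCompletion (maxHomIdeal (reesAlgebra I)) (reesAlgebra I)) := by
  rw [isReduced_iff_pow_one_lt 2 (by norm_num)]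
  intro b hb
  obtain ⟨r, rfl⟩ := AdicCompletion.mk_surjective _ _ b
  have hsq : ∀ n, r.1 n ^ 2 ∈ maxHomIdeal (reesAlgebra I) ^ n := by
    intro n
    have := congrArg (AdicCompletion.evalₐ _ n) hb
    rwa [map_pow, AdicCompletion.evalₐ_mk, map_zero, ← map_pow,
      Ideal.Quotient.eq_zero_iff_mem] at this
  have hsub : ∀ p q, p ≤ q → ∀ j, (r.1 p : A[X]).coeff j - (r.1 q : A[X]).coeff j ∈
      IsLocalRing.maximalIdeal A ^ (p - j) * I ^ j := by
    intro p q hpq j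
    have := r.2 hpq
    rw [SModEq.sub_mem] at this
    have h2 := coeff_mem_of_mem_maxHomIdeal_pow p _ (by simpa using this) j
    simpa using h2
  have hcoeff := coeff_mem_pow_of_sq_mem_maxHomIdeal_pow hred r.1 hsq hsub
  apply AdicCompletion.ext_evalₐ
  intro n
  rw [AdicCompletion.evalₐ_mk, map_zero, Ideal.Quotient.eq_zero_iff_mem]
  rw [mem_maxHomIdeal_pow_iff]
  intro j
  obtain ⟨k, hk⟩ := (IsLocalRing.maximalIdeal A).exists_pow_inf_eq_pow_smul (I ^ j : Ideal A)
  have hN : n ≤ n + k + j := by omega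
  have h1 : (r.1 (n + k + j) : A[X]).coeff j ∈ (IsLocalRing.maximalIdeal A ^ (n + k) • ⊤ ⊓ I ^ j : Ideal A) :=
    ⟨by simpa using hcoeff j (n + k), (mem_reesAlgebra_iff I _).mp (r.1 (n + k + j)).2 j⟩
  rw [hk (n + k) (by omega), Nat.add_sub_cancel] at h1
  have h2 : (r.1 (n + k + j) : A[X]).coeff j ∈ IsLocalRing.maximalIdeal A ^ (n - j) * I ^ j :=
    Ideal.mul_mono (Ideal.pow_le_pow_right (by omega)) inf_le_right h1
  have h4 := Ideal.add_mem _ (hsub n _ hN j) h2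
  simpa using h4

end ReesPowers

section ReesConductor

lemma isMaximal_maxHomIdeal {A : Type*} [CommRing A] [IsLocalRing A] {R : Type*} [CommRing R]
    [Algebra R A[X]] (S : Subalgebra R A[X]) (hC : ∀ a : A, C a ∈ S) :
    (maxHomIdeal S).IsMaximal := by
  rw [Ideal.isMaximal_iff]
  refine ⟨fun h => ?_, fun J x hJ hx hxJ => ?_⟩
  · have h1 : (1 : A[X]).coeff 0 ∈ IsLocalRing.maximalIdeal A := h
    rw [coeff_one_zero] at h1
    exact (Ideal.ne_top_iff_one _).mp (IsLocalRing.maximalIdeal.isMaximal A).ne_top h1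
  · have h1 : (x : A[X]).coeff 0 ∉ IsLocalRing.maximalIdeal A := hx
    rw [IsLocalRing.notMem_maximalIdeal] at h1
    obtain ⟨v, hv⟩ := h1.exists_left_inv
    have h2 : (1 - ⟨C v, hC v⟩ * x : S) ∈ maxHomIdeal S := by
      change (1 - C v * (x : A[X])).coeff 0 ∈ IsLocalRing.maximalIdeal A
      simp [hv]
    have h3 := J.add_mem (hJ h2) (J.mul_mem_left ⟨C v, hC v⟩ hxJ)
    rwa [sub_add_cancel] at h3

lemma isReduced_of_isReduced_adicCompletion {A : Type*} [CommRing A] (m : Ideal A)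
    [IsHausdorff m A] (hred : IsReduced (AdicCompletion m A)) : IsReduced A :=
  isReduced_of_injective (algebraMap A (AdicCompletion m A)) fun _ _ h =>
    AdicCompletion.of_injective m A h

lemma exists_mem_nonZeroDivisors_of_forall_minimalPrimes {A : Type*} [CommRing A]
    [IsNoetherianRing A] [IsReduced A] (I : Ideal A)
    (hI : ∀ p ∈ (⊥ : Ideal A).minimalPrimes, ¬ I ≤ p) : ∃ x ∈ I, x ∈ nonZeroDivisors A := by
  have hfin := Ideal.finite_minimalPrimes_of_isNoetherianRing A (⊥ : Ideal A)
  have h := (Ideal.subset_union_prime (s := hfin.toFinset) (f := id) ⊥ ⊥ (I := I)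
    (fun i hi _ _ => ((hfin.mem_toFinset).mp hi).1.1)).not.mpr (by
      rintro ⟨p, hp, hle⟩
      exact hI p ((hfin.mem_toFinset).mp hp) hle)
  rw [Set.not_subset] at h
  obtain ⟨x, hxI, hx⟩ := h
  refine ⟨x, hxI, mem_nonZeroDivisors_of_forall_minimalPrimes x fun p hp hxp => hx ?_⟩
  simp only [Set.mem_iUnion]
  exact ⟨p, by simpa using hp, hxp⟩

lemma algebraMap_mem_nonZeroDivisors_of_flat {R B : Type*} [CommRing R] [CommRing B] [Algebra R B]
    [Module.Flat R B] {r : R} (hr : r ∈ nonZeroDivisors R) :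
    algebraMap R B r ∈ nonZeroDivisors B := by
  rw [mem_nonZeroDivisors_iff_right]
  intro z hz
  apply (Module.Flat.isSMulRegular_of_nonZeroDivisors hr : IsSMulRegular B r)
  dsimp only
  rw [smul_zero, Algebra.smul_def, mul_comm, hz]

lemma mem_of_forall_mem_sup_pow {A : Type*} [CommRing A] [IsNoetherianRing A] [IsLocalRing A]
    (J : Ideal A) (z : A) (h : ∀ n, z ∈ J ⊔ IsLocalRing.maximalIdeal A ^ n) : z ∈ J := by
  have hH : IsHausdorff (IsLocalRing.maximalIdeal A) (A ⧸ J) := inferInstance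
  rw [← Ideal.Quotient.eq_zero_iff_mem]
  refine hH.haus _ fun n => ?_
  rw [SModEq.zero]
  obtain ⟨a, ha, b, hb, rfl⟩ := Submodule.mem_sup.mp (h n)
  rw [map_add, Ideal.Quotient.eq_zero_iff_mem.mpr ha, zero_add]
  have h2 := Submodule.smul_mem_smul hb (Submodule.mem_top : (1 : A ⧸ J) ∈ (⊤ : Submodule A (A ⧸ J)))
  rwa [Algebra.smul_def, mul_one] at h2

lemma exists_ringHom_extending_reesAlgebra {A T : Type*} [CommRing A] [CommRing T] {I : Ideal A}
    (ψ : reesAlgebra I →+* T) (x : A) (hx : x ∈ I)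
    (hu : IsUnit (ψ (algebraMap A (reesAlgebra I) x))) :
    ∃ φ : A[X] →+* T, ∀ f : reesAlgebra I, φ (f : A[X]) = ψ f := by
  have hmon : ∀ a ∈ I, monomial 1 a ∈ reesAlgebra I := fun a ha =>
    reesAlgebra.monomial_mem.mpr (by simpa using ha)
  obtain ⟨v, hv⟩ := hu.exists_left_inv
  let φ : A[X] →+* T := eval₂RingHom (ψ.comp (algebraMap A (reesAlgebra I)))
    (v * ψ ⟨monomial 1 x, hmon x hx⟩)
  refine ⟨φ, ?_⟩
  suffices h : ∀ f : A[X], f ∈ Algebra.adjoin A (Submodule.map (monomial 1 : A →ₗ[A] A[X]) I : Set A[X]) →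
      ∀ hf : f ∈ reesAlgebra I, φ f = ψ ⟨f, hf⟩ from
    fun f => h f (by rw [adjoin_monomial_eq_reesAlgebra]; exact f.2) f.2
  intro f hf
  induction hf using Algebra.adjoin_induction with
  | mem f hf =>
    obtain ⟨a, ha, rfl⟩ := hf
    intro h
    have h1 : φ (monomial 1 a) = ψ (algebraMap A _ a) * (v * ψ ⟨monomial 1 x, hmon x hx⟩) := by
      simp [φ, eval₂_monomial]
    have h2 : algebraMap A (reesAlgebra I) a * ⟨monomial 1 x, hmon x hx⟩ =
        algebraMap A (reesAlgebra I) x * ⟨monomial 1 a, h⟩ := by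
      apply Subtype.ext
      rw [MulMemClass.coe_mul, MulMemClass.coe_mul, Subalgebra.coe_algebraMap,
        Subalgebra.coe_algebraMap, Polynomial.algebraMap_apply, Polynomial.algebraMap_apply]
      simp only [Algebra.algebraMap_self, RingHom.id_apply, C_mul_monomial]
      rw [mul_comm]
    have h3 := congrArg ψ h2
    rw [map_mul, map_mul] at h3
    calc φ (monomial 1 a) = v * (ψ (algebraMap A _ a) * ψ ⟨monomial 1 x, hmon x hx⟩) := by
          rw [h1]; ring
      _ = (v * ψ (algebraMap A _ x)) * ψ ⟨monomial 1 a, h⟩ := by rw [h3]; ring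
      _ = _ := by rw [hv, one_mul]
  | algebraMap a =>
    intro h
    have : φ (algebraMap A A[X] a) = ψ (algebraMap A _ a) := by
      simp [φ]
    exact this
  | add f g hf hg ihf ihg =>
    intro h
    rw [adjoin_monomial_eq_reesAlgebra] at hf hg
    rw [map_add, ihf hf, ihg hg, ← map_add]
    rfl
  | mul f g hf hg ihf ihg =>
    intro h
    rw [adjoin_monomial_eq_reesAlgebra] at hf hg
    rw [map_mul, ihf hf, ihg hg, ← map_mul]
    rfl

lemma isIntegral_map_of_comp_eq {R B T P : Type*} [CommRing R] [CommRing B] [CommRing T]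
    [CommRing P] [Algebra R B] [Algebra B T] [Algebra R P] (φ : P →+* T)
    (h : ∀ r, φ (algebraMap R P r) = algebraMap B T (algebraMap R B r)) {c : P}
    (hc : IsIntegral R c) : IsIntegral B (φ c) := by
  obtain ⟨p, hp, h0⟩ := hc
  refine ⟨p.map (algebraMap R B), hp.map _, ?_⟩
  have h' : (algebraMap B T).comp (algebraMap R B) = φ.comp (algebraMap R P) :=
    RingHom.ext fun r => (h r).symm
  rw [eval₂_map, h', ← hom_eval₂, h0, map_zero]

lemma algebraMap_mem_nonZeroDivisors_reesAlgebra {A : Type*} [CommRing A] (I : Ideal A) {x : A}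
    (hx : x ∈ nonZeroDivisors A) :
    algebraMap A (reesAlgebra I) x ∈ nonZeroDivisors (reesAlgebra I) := by
  rw [mem_nonZeroDivisors_iff_right]
  intro z hz
  apply Subtype.ext
  ext i
  have h1 := congrArg (fun f : reesAlgebra I => (f : A[X]).coeff i) hz
  simp only [MulMemClass.coe_mul, Subalgebra.coe_algebraMap, Polynomial.algebraMap_apply,
    Algebra.algebraMap_self, RingHom.id_apply, coeff_mul_C, ZeroMemClass.coe_zero,
    coeff_zero] at h1
  simpa using (mem_nonZeroDivisors_iff_right.mp hx) _ h1

theorem exists_nonZeroDivisor_forall_C_mul_mem_reesAlgebra {A : Type*} [CommRing A]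
    [IsNoetherianRing A] [IsLocalRing A]
    (hred : IsReduced (AdicCompletion (IsLocalRing.maximalIdeal A) A))
    (I : Ideal A) (hI : ∀ p ∈ (⊥ : Ideal A).minimalPrimes, ¬ I ≤ p) :
    ∃ w ∈ nonZeroDivisors A, ∀ c : A[X], IsIntegral (reesAlgebra I) c →
      C w * c ∈ reesAlgebra I := by
  have hA : IsReduced A := isReduced_of_isReduced_adicCompletion _ hred
  obtain ⟨x, hxI, hx⟩ := exists_mem_nonZeroDivisors_of_forall_minimalPrimes I hI
  have hCx := algebraMap_mem_nonZeroDivisors_reesAlgebra I hx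
  have hMmax : (maxHomIdeal (reesAlgebra I)).IsMaximal :=
    isMaximal_maxHomIdeal _ fun a => (reesAlgebra I).algebraMap_mem a
  let R := reesAlgebra I
  let M : Ideal R := maxHomIdeal (reesAlgebra I)
  let B := AdicCompletion M R
  have hB : IsNoetherianRing B := isNoetherianRing_adicCompletion M
  have hBred : IsReduced B := isReduced_adicCompletion_reesAlgebra hred I
  have hfg : M.FG := IsNoetherian.noetherian M
  let J : Ideal B := M.map (algebraMap R B)
  have hJc : IsAdicComplete J B := AdicCompletion.isAdicComplete_self M hfg
  have hJm : J.IsMaximal := AdicCompletion.isMaximal_map_of_le M M le_rfl hfg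
  let xB : B := algebraMap R B (algebraMap A R x)
  have hxB : xB ∈ nonZeroDivisors B := algebraMap_mem_nonZeroDivisors_of_flat hCx
  let T := Localization.Away xB
  obtain ⟨k, hk⟩ := exists_pow_mul_mem_range_of_isIntegral J xB hxB T
  obtain ⟨φ, hφ⟩ := exists_ringHom_extending_reesAlgebra
    ((algebraMap B T).comp (algebraMap R B)) x hxI
    (IsLocalization.Away.algebraMap_isUnit xB)
  have hinj : Function.Injective (algebraMap B T) :=
    IsLocalization.injective T (Submonoid.powers_le.mpr hxB)
  refine ⟨x ^ k, pow_mem hx k, fun c hc => ?_⟩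
  obtain ⟨b, hb⟩ := hk (φ c) (isIntegral_map_of_comp_eq φ hφ hc)
  have hy : C (x ^ c.natDegree) * c ∈ reesAlgebra I := by
    rw [mem_reesAlgebra_iff]
    intro i
    rw [coeff_C_mul]
    by_cases hi : i ≤ c.natDegree
    · exact Ideal.mul_mem_right _ _ (Ideal.pow_le_pow_right hi (Ideal.pow_mem_pow hxI _))
    · rw [coeff_eq_zero_of_natDegree_lt (by omega), mul_zero]
      exact zero_mem _
  have hbB : xB ^ c.natDegree * b = xB ^ k * algebraMap R B ⟨_, hy⟩ := by
    apply hinj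
    have h1 := hφ ⟨_, hy⟩
    have h2 : φ (C (x ^ c.natDegree)) = algebraMap B T xB ^ c.natDegree := by
      have := hφ (algebraMap A R (x ^ c.natDegree))
      rw [map_pow (algebraMap A R) x, map_pow (RingHom.comp _ _)] at this
      rw [← map_pow (algebraMap A R) x] at this
      exact this
    rw [RingHom.comp_apply, map_mul, h2] at h1
    rw [map_mul, map_mul, ← h1, hb, map_pow, map_pow]
    ring
  rw [mem_reesAlgebra_iff]
  intro i
  rw [coeff_C_mul]
  have key : x ^ c.natDegree * (x ^ k * c.coeff i) ∈ Ideal.span {x ^ c.natDegree} * I ^ i := by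
    apply mem_of_forall_mem_sup_pow
    intro n
    obtain ⟨r, hr⟩ := Ideal.Quotient.mk_surjective (AdicCompletion.evalₐ M (n + i) b)
    have h1 := congrArg (AdicCompletion.evalₐ M (n + i)) hbB
    have hev : ∀ s : R, AdicCompletion.evalₐ M (n + i) (algebraMap R B s) =
        Ideal.Quotient.mk (M ^ (n + i)) s := fun s => AlgHom.commutes _ s
    rw [map_mul, map_mul, map_pow, map_pow, hev, hev, ← hr, eq_comm] at h1
    replace h1 : algebraMap A R x ^ k * ⟨_, hy⟩ - algebraMap A R x ^ c.natDegree * r ∈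
        M ^ (n + i) := by
      rw [← Ideal.Quotient.eq, map_mul, map_mul, map_pow (Ideal.Quotient.mk _),
        map_pow (Ideal.Quotient.mk _)]
      exact h1
    have h2 := coeff_mem_of_mem_maxHomIdeal_pow _ _ h1 i
    have h3 : (((algebraMap A R x ^ k * ⟨_, hy⟩ - algebraMap A R x ^ c.natDegree * r : R) :
        A[X])).coeff i = x ^ c.natDegree * (x ^ k * c.coeff i) -
          x ^ c.natDegree * (r : A[X]).coeff i := by
      have h4 : ((algebraMap A R x ^ k * ⟨_, hy⟩ - algebraMap A R x ^ c.natDegree * r : R) :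
        A[X]) = C (x ^ k) * (C (x ^ c.natDegree) * c) - C (x ^ c.natDegree) * (r : A[X]) := by
        rw [← map_pow, ← map_pow]
        rfl
      rw [h4, coeff_sub, coeff_C_mul, coeff_C_mul, coeff_C_mul]
      ring
    have h5 : x ^ c.natDegree * (r : A[X]).coeff i ∈ Ideal.span {x ^ c.natDegree} * I ^ i :=
      Ideal.mul_mem_mul (Ideal.mem_span_singleton_self _) ((mem_reesAlgebra_iff I _).mp r.2 i)
    rw [h3, Nat.add_sub_cancel] at h2
    have h6 := Ideal.mul_le_left h2
    rw [← sub_add_cancel (x ^ c.natDegree * (x ^ k * c.coeff i))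
      (x ^ c.natDegree * (r : A[X]).coeff i), add_comm]
    exact Submodule.add_mem_sup h5 h6
  obtain ⟨z, hz, hzeq⟩ := Ideal.mem_span_singleton_mul.mp key
  rw [(mul_cancel_left_mem_nonZeroDivisors (pow_mem hx c.natDegree)).mp hzeq] at hz
  exact hz

end ReesConductor

section LengthGrowth

lemma length_le_add_of_exact {R N' N N'' : Type*} [CommRing R] [AddCommGroup N'] [Module R N']
    [AddCommGroup N] [Module R N] [AddCommGroup N''] [Module R N''] (f : N' →ₗ[R] N)
    (g : N →ₗ[R] N'') (h : Function.Exact f g) :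
    Module.length R N ≤ Module.length R N' + Module.length R N'' := by
  rw [Module.length_eq_add_of_exact (LinearMap.ker g).subtype g.rangeRestrict
    (Submodule.injective_subtype _) g.surjective_rangeRestrict (by
      intro x
      rw [← Subtype.coe_inj]
      simp)]
  refine add_le_add ?_ (Module.length_le_of_injective _ (Submodule.injective_subtype _))
  have hr : LinearMap.ker g = LinearMap.range f := h.linearMap_ker_eq
  rw [hr]
  exact Module.length_le_of_surjective _ f.surjective_rangeRestrict

lemma length_quotient_sup_span_pow_le {R : Type*} [CommRing R] (a : Ideal R) (y : R) (i : ℕ) :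
    Module.length R (R ⧸ (a ⊔ Ideal.span {y ^ i})) ≤
      i * Module.length R (R ⧸ (a ⊔ Ideal.span {y})) := by
  induction i with
  | zero =>
    have : Subsingleton (R ⧸ (a ⊔ Ideal.span {y ^ 0})) := by
      rw [Ideal.Quotient.subsingleton_iff]
      simp
    rw [Module.length_eq_zero]
    exact zero_le
  | succ i ih =>
    let f : (R ⧸ (a ⊔ Ideal.span {y})) →ₗ[R] (R ⧸ (a ⊔ Ideal.span {y ^ (i + 1)})) :=
      Submodule.mapQ _ _ (LinearMap.mulLeft R (y ^ i)) (by
        refine sup_le (fun x hx => ?_) ?_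
        · exact Ideal.mul_mem_left _ _ (Ideal.mem_sup_left hx)
        · rw [Ideal.span_singleton_le_iff_mem]
          change y ^ i * y ∈ a ⊔ Ideal.span {y ^ (i + 1)}
          rw [← pow_succ]
          exact Ideal.mem_sup_right (Ideal.mem_span_singleton_self _))
    have hle : a ⊔ Ideal.span {y ^ (i + 1)} ≤ a ⊔ Ideal.span {y ^ i} :=
      sup_le_sup_left (Ideal.span_singleton_le_span_singleton.mpr (pow_dvd_pow _ (by omega))) _
    let g : (R ⧸ (a ⊔ Ideal.span {y ^ (i + 1)})) →ₗ[R] (R ⧸ (a ⊔ Ideal.span {y ^ i})) :=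
      Submodule.factor hle
    have hex : Function.Exact f g := by
      intro z
      obtain ⟨z, rfl⟩ := Submodule.Quotient.mk_surjective _ z
      constructor
      · intro hz
        have hz' : z ∈ a ⊔ Ideal.span {y ^ i} := (Submodule.Quotient.mk_eq_zero _).mp hz
        obtain ⟨b, hb, e, he, rfl⟩ := Submodule.mem_sup.mp hz'
        obtain ⟨r, rfl⟩ := Ideal.mem_span_singleton'.mp he
        refine ⟨Submodule.Quotient.mk r, ?_⟩
        change Submodule.Quotient.mk (y ^ i * r) = _
        rw [Submodule.Quotient.eq]
        have : y ^ i * r - (b + r * y ^ i) = -b := by ring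
        rw [this]
        exact neg_mem (Ideal.mem_sup_left hb)
      · rintro ⟨r, hr⟩
        rw [← hr]
        obtain ⟨r, rfl⟩ := Submodule.Quotient.mk_surjective _ r
        change Submodule.Quotient.mk (y ^ i * r) = _
        rw [Submodule.Quotient.mk_eq_zero]
        exact Ideal.mul_mem_right _ _ (Ideal.mem_sup_right (Ideal.mem_span_singleton_self _))
    refine (length_le_add_of_exact f g hex).trans ?_
    rw [Nat.cast_succ, add_mul, one_mul, add_comm]
    exact add_le_add_left ih _

lemma length_quotient_sup_pow_le {R : Type*} [CommRing R] (M : Ideal R) (n : ℕ) (s : Finset R)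
    (hs : ∀ y ∈ s, y ∈ M) (a : Ideal R) :
    Module.length R (R ⧸ (a ⊔ M ^ n)) ≤
      (n ^ s.card : ℕ) * Module.length R (R ⧸ (a ⊔ Ideal.span (s : Set R) ⊔ M ^ n)) := by
  classical
  induction s using Finset.induction_on generalizing a with
  | empty => rw [Finset.coe_empty, Ideal.span_empty, sup_bot_eq, Finset.card_empty, pow_zero,
      Nat.cast_one, one_mul]
  | insert y s hy ih =>
    have h1 := length_quotient_sup_span_pow_le (a ⊔ M ^ n) y n
    have e1 : a ⊔ M ^ n ⊔ Ideal.span {y ^ n} = a ⊔ M ^ n := by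
      rw [sup_eq_left, Ideal.span_singleton_le_iff_mem]
      exact Ideal.mem_sup_right (Ideal.pow_mem_pow (hs y (Finset.mem_insert_self _ _)) n)
    have e2 : a ⊔ M ^ n ⊔ Ideal.span {y} = a ⊔ Ideal.span {y} ⊔ M ^ n := sup_right_comm _ _ _
    rw [e1, e2] at h1
    have h2 := ih (fun z hz => hs z (Finset.mem_insert_of_mem hz)) (a ⊔ Ideal.span {y})
    have e3 : a ⊔ Ideal.span {y} ⊔ Ideal.span (s : Set R) ⊔ M ^ n =
        a ⊔ Ideal.span ((insert y s : Finset R) : Set R) ⊔ M ^ n := by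
      rw [Finset.coe_insert, Ideal.span_insert, sup_assoc a]
    rw [e3] at h2
    refine h1.trans ?_
    rw [Finset.card_insert_of_notMem hy, pow_succ, mul_comm (n ^ _), Nat.cast_mul, mul_assoc]
    gcongr

lemma span_singleton_sup_pow_eq_top {R : Type*} [CommRing R] (M : Ideal R) [hM : M.IsMaximal]
    (s : R) (hs : s ∉ M) (n : ℕ) : Ideal.span {s} ⊔ M ^ n = ⊤ := by
  have h1 : IsCoprime (Ideal.span {s}) M := by
    rw [Ideal.isCoprime_iff_sup_eq]
    refine hM.1.2 _ (lt_of_le_of_ne le_sup_right fun h => hs ?_)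
    rw [h]
    exact Ideal.mem_sup_left (Ideal.mem_span_singleton_self s)
  exact Ideal.isCoprime_iff_sup_eq.mp h1.pow_right

lemma exists_pow_le_sup_pow_of_mem_minimalPrimes {R : Type*} [CommRing R] [IsNoetherianRing R]
    (M : Ideal R) [hM : M.IsMaximal] (J : Ideal R) (h : M ∈ J.minimalPrimes) :
    ∃ k, ∀ n, M ^ k ≤ J ⊔ M ^ n := by
  let q : PrimeSpectrum R := ⟨M, hM.isPrime⟩
  have hrad : M ≤ (satur J q).radical := by
    intro y hy
    obtain ⟨s, hs, b, hb⟩ := exists_mul_pow_mem_of_forall_prime J q y fun P hP hJP hPM =>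
      h.2 ⟨hP, hJP⟩ hPM hy
    exact ⟨b, s, hs, hb⟩
  obtain ⟨k, hk⟩ := Ideal.exists_pow_le_of_le_radical_of_fg hrad (IsNoetherian.noetherian M)
  obtain ⟨s, hs, hsv⟩ := exists_notMem_forall_mul_mem_of_le_satur J q (M ^ k)
    (IsNoetherian.noetherian _) hk
  refine ⟨k, fun n v hv => ?_⟩
  have htop : Ideal.span {s} ⊔ M ^ n = ⊤ :=
    span_singleton_sup_pow_eq_top M s hs n
  obtain ⟨a, ha, b, hb, hab⟩ := Submodule.mem_sup.mp ((Ideal.eq_top_iff_one _).mp htop)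
  obtain ⟨r, rfl⟩ := Ideal.mem_span_singleton'.mp ha
  have e : v = r * (s * v) + b * v := by
    rw [← mul_assoc, ← add_mul, hab, one_mul]
  rw [e]
  exact Submodule.add_mem_sup (J.mul_mem_left _ (hsv v hv)) (Ideal.mul_mem_right _ _ hb)

theorem exists_forall_length_quotient_span_sup_pow_mul_le {R : Type*} [CommRing R]
    [IsNoetherianRing R] (M : Ideal R) [hM : M.IsMaximal] (w : R) (hw : w ∈ nonZeroDivisors R)
    (d : ℕ) (hd : (d : WithBot ℕ∞) = ringKrullDim R) :
    ∃ D : ℕ, ∀ n : ℕ, Module.length R (R ⧸ (Ideal.span {w} ⊔ M ^ n)) * n ≤ (D * n ^ d : ℕ) := by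
  classical
  by_cases hwM : w ∈ M
  · have hle : Ideal.span {w} ≤ M := (Ideal.span_singleton_le_iff_mem M).mpr hwM
    let B := R ⧸ Ideal.span {w}
    let P : Ideal B := M.map (Ideal.Quotient.mk (Ideal.span {w}))
    have hcP : P.comap (Ideal.Quotient.mk (Ideal.span {w})) = M := Ideal.comap_map_mk hle
    have hP : P.IsPrime := Ideal.isPrime_map_quotientMk_of_isPrime hle
    obtain ⟨s, hPs, hs⟩ := Ideal.exists_finset_card_eq_height_of_isNoetherianRing P
    have hdim : s.card + 1 ≤ d := by
      have h1 : (P.height : WithBot ℕ∞) ≤ ringKrullDim B :=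
        Ideal.height_le_ringKrullDim_of_ne_top hP.ne_top
      have h2 := ringKrullDim_quotient_succ_le_of_nonZeroDivisor hw
      rw [← hd] at h2
      have h3 := (add_le_add_left h1 1).trans h2
      rw [← hs] at h3
      exact_mod_cast h3
    let t : Finset R := s.image (Function.surjInv Ideal.Quotient.mk_surjective)
    have ht : (Ideal.span (t : Set R)).map (Ideal.Quotient.mk (Ideal.span {w})) =
        Ideal.span (s : Set B) := by
      rw [Ideal.map_span, Finset.coe_image, ← Set.image_comp]
      congr 1
      have hid : (Ideal.Quotient.mk (Ideal.span {w})) ∘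
          Function.surjInv Ideal.Quotient.mk_surjective = id :=
        _root_.funext fun b => Function.surjInv_eq Ideal.Quotient.mk_surjective b
      rw [hid, Set.image_id]
    have hmin : M ∈ (Ideal.span {w} ⊔ Ideal.span (t : Set R)).minimalPrimes := by
      rw [← Ideal.comap_map_quotientMk, ht,
        Ideal.comap_minimalPrimes_eq_of_surjective Ideal.Quotient.mk_surjective]
      exact ⟨P, hPs, hcP⟩
    have htM : ∀ y ∈ t, y ∈ M := fun y hy =>
      hmin.1.2 (Ideal.mem_sup_right (Ideal.subset_span hy))
    obtain ⟨k, hk⟩ := exists_pow_le_sup_pow_of_mem_minimalPrimes M _ hmin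
    have hK : Module.length R (R ⧸ M ^ k) ≠ ⊤ := by
      refine length_ne_top_of_pow_le_annihilator M k fun a ha v => ?_
      obtain ⟨v, rfl⟩ := Ideal.Quotient.mk_surjective v
      rw [Algebra.smul_def, Ideal.Quotient.algebraMap_eq, ← map_mul,
        Ideal.Quotient.eq_zero_iff_mem]
      exact Ideal.mul_mem_right _ _ ha
    obtain ⟨K, hKe⟩ := ENat.ne_top_iff_exists.mp hK
    refine ⟨K, fun n => ?_⟩
    rcases Nat.eq_zero_or_pos n with rfl | hn
    · simp
    have h1 := length_quotient_sup_pow_le M n t htM (Ideal.span {w})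
    have h2 : Module.length R (R ⧸ (Ideal.span {w} ⊔ Ideal.span (t : Set R) ⊔ M ^ n)) ≤ K := by
      rw [hKe]
      exact Module.length_le_of_surjective (Submodule.factor (hk n))
        (Submodule.factor_surjective (hk n))
    have h3 : n ^ t.card * K * n ≤ K * n ^ d := by
      have : n ^ (t.card + 1) ≤ n ^ d :=
        Nat.pow_le_pow_right hn ((add_le_add_left Finset.card_image_le 1).trans hdim)
      calc n ^ t.card * K * n = K * n ^ (t.card + 1) := by ring
        _ ≤ _ := Nat.mul_le_mul_left _ this
    calc _ ≤ ((n ^ t.card : ℕ) : ℕ∞) * K * n := by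
          gcongr
          exact h1.trans (by gcongr)
      _ = ((n ^ t.card * K * n : ℕ) : ℕ∞) := by push_cast; rfl
      _ ≤ _ := by exact_mod_cast h3
  · refine ⟨0, fun n => ?_⟩
    have htop : Ideal.span {w} ⊔ M ^ n = ⊤ :=
      span_singleton_sup_pow_eq_top M w hwM n
    have : Subsingleton (R ⧸ (Ideal.span {w} ⊔ M ^ n)) := Ideal.Quotient.subsingleton_iff.mpr htop
    rw [Module.length_eq_zero]
    simp

end LengthGrowth

section CompareMultiplicity

lemma ModuleLengthIs.length_eq {R Z : Type*} [CommRing R] [AddCommGroup Z] [Module R Z] {l : ℕ}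
    (h : ModuleLengthIs R Z l) : Module.length R Z = l := by
  obtain ⟨s, h1, h2, rfl⟩ := h
  exact (Module.length_compositionSeries s h1 h2).symm

lemma exists_moduleLengthIs {R Z : Type*} [CommRing R] [AddCommGroup Z] [Module R Z]
    (h : Module.length R Z ≠ ⊤) : ∃ l, ModuleLengthIs R Z l := by
  obtain ⟨s, h1, h2⟩ := isFiniteLength_iff_exists_compositionSeries.mp (Module.length_ne_top_iff.mp h)
  exact ⟨s.length, s, h1, h2, rfl⟩

lemma length_quotient_pow_smul_top_ne_top {R : Type*} [CommRing R] [IsNoetherianRing R]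
    (M : Ideal R) [M.IsMaximal] (n : ℕ) :
    Module.length R (R ⧸ (M ^ n • ⊤ : Submodule R R)) ≠ ⊤ := by
  refine length_ne_top_of_pow_le_annihilator M n fun a ha v => ?_
  obtain ⟨v, rfl⟩ := Submodule.Quotient.mk_surjective _ v
  rw [← Submodule.Quotient.mk_smul, Submodule.Quotient.mk_eq_zero]
  exact Submodule.smul_mem_smul ha Submodule.mem_top

lemma restrictScalars_covBy {R S Z : Type*} [CommRing R] [CommRing S] [Algebra R S]
    [AddCommGroup Z] [Module R Z] [Module S Z] [IsScalarTower R S Z] (N : Ideal S)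
    (hres : ∀ s : S, ∃ r : R, s - algebraMap R S r ∈ N) (n : ℕ)
    (hn : ∀ a ∈ N ^ n, ∀ z : Z, a • z = 0) {P Q : Submodule S Z} (h : P ⋖ Q) :
    P.restrictScalars R ⋖ Q.restrictScalars R := by
  have hle : P ≤ Q := h.le
  have hNQ : N • Q ≤ P := by
    have h1 : P ≤ P ⊔ N • Q := le_sup_left
    have h2 : P ⊔ N • Q ≤ Q := sup_le hle Submodule.smul_le_right
    rcases h.eq_or_eq h1 h2 with h3 | h3
    · exact le_sup_right.trans h3.le
    · have h4 : ∀ k : ℕ, Q ≤ P ⊔ N ^ k • Q := by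
        intro k
        induction k with
        | zero => simp
        | succ k ih =>
          refine ih.trans (sup_le le_sup_left ?_)
          calc N ^ k • Q = N ^ k • (P ⊔ N • Q) := by rw [h3]
            _ = N ^ k • P ⊔ N ^ (k + 1) • Q := by
              rw [Submodule.smul_sup, pow_succ, Submodule.mul_smul]
            _ ≤ _ := sup_le_sup_right Submodule.smul_le_right _
      have h5 : N ^ n • Q = ⊥ := by
        rw [eq_bot_iff, Submodule.smul_le]
        intro a ha z _
        exact (hn a ha z)
      have h6 := h4 n
      rw [h5, sup_bot_eq] at h6
      exact absurd h.lt (not_lt_of_ge h6)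
  refine ⟨h.lt, fun L hPL hLQ => ?_⟩
  let L' : Submodule S Z :=
    { L with
      smul_mem' := by
        intro s l hl
        obtain ⟨r, hr⟩ := hres s
        have h1 : s • l = (s - algebraMap R S r) • l + r • l := by
          rw [sub_smul, algebraMap_smul, sub_add_cancel]
        rw [h1]
        exact L.add_mem (hPL.le (hNQ (Submodule.smul_mem_smul hr (hLQ.le hl))))
          (L.smul_mem r hl) }
  exact h.2 (c := L') hPL hLQ

lemma ModuleLengthIs.restrictScalars {R S Z : Type*} [CommRing R] [CommRing S] [Algebra R S]
    [AddCommGroup Z] [Module R Z] [Module S Z] [IsScalarTower R S Z] (N : Ideal S)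
    (hres : ∀ s : S, ∃ r : R, s - algebraMap R S r ∈ N) (n : ℕ)
    (hn : ∀ a ∈ N ^ n, ∀ z : Z, a • z = 0) {l : ℕ} (h : ModuleLengthIs S Z l) :
    ModuleLengthIs R Z l := by
  obtain ⟨s, h1, h2, rfl⟩ := h
  refine ⟨s.map ⟨Submodule.restrictScalars R, restrictScalars_covBy N hres n hn⟩, ?_, ?_, rfl⟩
  · rw [RelSeries.head_map, h1]
    rfl
  · rw [RelSeries.last_map, h2]
    rfl

lemma length_le_card_mul_of_forall_smul_eq_zero {R Z : Type*} [CommRing R] [AddCommGroup Z]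
    [Module R Z] (K : Ideal R) (hK : ∀ a ∈ K, ∀ z : Z, a • z = 0) {g : ℕ} (v : Fin g → Z)
    (hv : Submodule.span R (Set.range v) = ⊤) :
    Module.length R Z ≤ g * Module.length R (R ⧸ K) := by
  let u : Fin g → (R ⧸ K) →ₗ[R] Z := fun i =>
    Submodule.liftQ K (LinearMap.toSpanSingleton R Z (v i)) fun a ha => hK a ha _
  have hsurj : Function.Surjective (LinearMap.lsum R (fun _ : Fin g => R ⧸ K) R u) := by
    rw [← LinearMap.range_eq_top, eq_top_iff, ← hv, Submodule.span_le]
    rintro _ ⟨i, rfl⟩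
    refine ⟨Pi.single i (Submodule.Quotient.mk 1), ?_⟩
    rw [LinearMap.lsum_piSingle]
    change (1 : R) • v i = v i
    exact one_smul _ _
  refine (Module.length_le_of_surjective _ hsurj).trans ?_
  rw [Module.length_pi_of_fintype]
  simp

lemma length_quotient_pow_compare {R S : Type*} [CommRing R] [CommRing S] [Algebra R S]
    (M : Ideal R) (N : Ideal S) (hMN : M ≤ N.comap (algebraMap R S)) (μ : S →ₗ[R] R)
    (hμ : Function.Injective μ) (hN : ∀ n, ∀ s ∈ N ^ n, μ s ∈ M ^ n) {g : ℕ} (v : Fin g → S)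
    (hv : Submodule.span R (Set.range v) = ⊤) (n : ℕ) :
    Module.length R (S ⧸ (N ^ n • ⊤ : Submodule S S)) ≤
        Module.length R (R ⧸ (M ^ n • ⊤ : Submodule R R)) +
          g * Module.length R (R ⧸ (Ideal.span {μ 1} ⊔ M ^ n)) ∧
      Module.length R (R ⧸ (M ^ n • ⊤ : Submodule R R)) ≤
        Module.length R (S ⧸ (N ^ n • ⊤ : Submodule S S)) +
          Module.length R (R ⧸ (Ideal.span {μ 1} ⊔ M ^ n)) := by
  have hMn : M ^ n ≤ (N ^ n).comap (algebraMap R S) :=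
    (Ideal.pow_right_mono hMN n).trans (Ideal.le_comap_pow _ n)
  have hsmulS : ∀ s : S, s ∈ (N ^ n • ⊤ : Submodule S S) ↔ s ∈ N ^ n := by simp
  have hsmulR : ∀ r : R, r ∈ (M ^ n • ⊤ : Submodule R R) ↔ r ∈ M ^ n := by simp
  have hμa : ∀ r, μ (algebraMap R S r) = r * μ 1 := fun r => by
    rw [Algebra.algebraMap_eq_smul_one, map_smul, smul_eq_mul]
  have hμs : ∀ s, algebraMap R S (μ s) = μ 1 • s := fun s => by
    apply hμ
    rw [hμa, map_smul, smul_eq_mul, mul_comm]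
  constructor
  · let f : (R ⧸ (M ^ n • ⊤ : Submodule R R)) →ₗ[R] (S ⧸ (N ^ n • ⊤ : Submodule S S)) :=
      Submodule.liftQ _ (((N ^ n • ⊤ : Submodule S S).mkQ.restrictScalars R) ∘ₗ
        (Algebra.linearMap R S)) (fun r hr => by
          rw [LinearMap.mem_ker]
          change Submodule.Quotient.mk (algebraMap R S r) = _
          rw [Submodule.Quotient.mk_eq_zero, hsmulS]
          exact hMn ((hsmulR r).mp hr))
    refine (length_le_add_of_exact f (LinearMap.range f).mkQ (by
      intro z
      rw [Submodule.mkQ_apply, Submodule.Quotient.mk_eq_zero]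
      rfl)).trans (add_le_add_right ?_ _)
    let p : S →ₗ[R] ((S ⧸ (N ^ n • ⊤ : Submodule S S)) ⧸ LinearMap.range f) :=
      (LinearMap.range f).mkQ ∘ₗ ((N ^ n • ⊤ : Submodule S S).mkQ.restrictScalars R)
    have hp : Function.Surjective p :=
      (Submodule.mkQ_surjective _).comp (Submodule.mkQ_surjective (N ^ n • ⊤ : Submodule S S))
    have hpr : ∀ r, p (algebraMap R S r) = 0 := fun r => by
      change Submodule.Quotient.mk _ = _
      rw [Submodule.Quotient.mk_eq_zero]
      exact ⟨Submodule.Quotient.mk r, rfl⟩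
    have hpN : ∀ s ∈ N ^ n, p s = 0 := fun s hs => by
      have : ((N ^ n • ⊤ : Submodule S S).mkQ.restrictScalars R) s = 0 :=
        (Submodule.Quotient.mk_eq_zero _).mpr ((hsmulS s).mpr hs)
      rw [LinearMap.comp_apply, this, map_zero]
    refine length_le_card_mul_of_forall_smul_eq_zero _ (fun a ha z => ?_) (p ∘ v) ?_
    · obtain ⟨s, rfl⟩ := hp z
      obtain ⟨b, hb, e, he, rfl⟩ := Submodule.mem_sup.mp ha
      obtain ⟨r, rfl⟩ := Ideal.mem_span_singleton'.mp hb
      rw [← map_smul, add_smul, map_add, mul_smul, map_smul, ← hμs, hpr, smul_zero, zero_add]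
      exact (congrArg p (Algebra.smul_def e s)).trans
        (hpN _ (Ideal.mul_mem_right _ _ (hMn he)))
    · rw [Set.range_comp, ← Submodule.map_span, hv, Submodule.map_top]
      exact LinearMap.range_eq_top.mpr hp
  · let f : (S ⧸ (N ^ n • ⊤ : Submodule S S)) →ₗ[R] (R ⧸ (M ^ n • ⊤ : Submodule R R)) :=
      Submodule.liftQ ((N ^ n • ⊤ : Submodule S S).restrictScalars R)
        ((M ^ n • ⊤ : Submodule R R).mkQ ∘ₗ μ) (fun s hs => by
          rw [LinearMap.mem_ker]
          change Submodule.Quotient.mk (μ s) = _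
          rw [Submodule.Quotient.mk_eq_zero, hsmulR]
          exact hN n s ((hsmulS s).mp hs))
    refine (length_le_add_of_exact f (LinearMap.range f).mkQ (by
      intro z
      rw [Submodule.mkQ_apply, Submodule.Quotient.mk_eq_zero]
      rfl)).trans (add_le_add_right ?_ _)
    let p : R →ₗ[R] ((R ⧸ (M ^ n • ⊤ : Submodule R R)) ⧸ LinearMap.range f) :=
      (LinearMap.range f).mkQ ∘ₗ (M ^ n • ⊤ : Submodule R R).mkQ
    have hp : Function.Surjective p :=
      (Submodule.mkQ_surjective _).comp (Submodule.mkQ_surjective _)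
    have hker : Ideal.span {μ 1} ⊔ M ^ n ≤ LinearMap.ker p := by
      refine sup_le ?_ fun r hr => ?_
      · rw [Ideal.span_singleton_le_iff_mem, LinearMap.mem_ker]
        change Submodule.Quotient.mk _ = _
        rw [Submodule.Quotient.mk_eq_zero]
        exact ⟨Submodule.Quotient.mk 1, rfl⟩
      · have : (M ^ n • ⊤ : Submodule R R).mkQ r = 0 :=
          (Submodule.Quotient.mk_eq_zero _).mpr ((hsmulR r).mpr hr)
        rw [LinearMap.mem_ker, LinearMap.comp_apply, this, map_zero]
    refine Module.length_le_of_surjective (Submodule.liftQ _ p hker) ?_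
    intro z
    obtain ⟨r, rfl⟩ := hp z
    exact ⟨Submodule.Quotient.mk r, rfl⟩

lemma tendsto_iff_of_forall_mul_le (d D : ℕ) (c c' : ℕ → ℕ) (e : ℝ)
    (h : ∀ n, c n * n ≤ c' n * n + D * n ^ d) (h' : ∀ n, c' n * n ≤ c n * n + D * n ^ d) :
    Filter.Tendsto (fun n : ℕ => (Nat.factorial d : ℝ) / (n : ℝ) ^ d * (c n : ℝ))
      Filter.atTop (nhds e) ↔
    Filter.Tendsto (fun n : ℕ => (Nat.factorial d : ℝ) / (n : ℝ) ^ d * (c' n : ℝ))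
      Filter.atTop (nhds e) := by
  apply tendsto_iff_of_dist
  refine squeeze_zero' (g := fun n : ℕ => (Nat.factorial d * D : ℝ) / n)
    (Filter.Eventually.of_forall fun _ => dist_nonneg) ?_ (tendsto_const_div_atTop_nhds_zero_nat _)
  filter_upwards [Filter.eventually_gt_atTop 0] with n hn
  have hn' : (0 : ℝ) < n := by exact_mod_cast hn
  have h1 : ((c n : ℝ) - c' n) * n ≤ D * (n : ℝ) ^ d := by
    have : (c n * n : ℝ) ≤ c' n * n + D * (n : ℝ) ^ d := by exact_mod_cast h n
    linarith
  have h2 : ((c' n : ℝ) - c n) * n ≤ D * (n : ℝ) ^ d := by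
    have : (c' n * n : ℝ) ≤ c n * n + D * (n : ℝ) ^ d := by exact_mod_cast h' n
    linarith
  have h3 : |(c n : ℝ) - c' n| * n ≤ D * (n : ℝ) ^ d := by
    rcases abs_cases ((c n : ℝ) - c' n) with ⟨ha, _⟩ | ⟨ha, _⟩
    · rw [ha]; exact h1
    · rw [ha]; linarith
  rw [Real.dist_eq, ← mul_sub, abs_mul, abs_of_nonneg (by positivity), div_mul_eq_mul_div,
    div_le_div_iff₀ (by positivity) hn', mul_assoc, mul_assoc]
  exact mul_le_mul_of_nonneg_left h3 (by positivity)

theorem isHSMultiplicity_iff_of_linearMap {R S : Type*} [CommRing R] [IsNoetherianRing R]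
    [CommRing S] [Algebra R S] (M : Ideal R) [M.IsMaximal] (N : Ideal S) [N.IsMaximal]
    (hMN : M ≤ N.comap (algebraMap R S))
    (hres : ∀ s : S, ∃ r : R, s - algebraMap R S r ∈ N) (μ : S →ₗ[R] R)
    (hμ : Function.Injective μ) (hμ1 : μ 1 ∈ nonZeroDivisors R)
    (hN : ∀ n, ∀ s ∈ N ^ n, μ s ∈ M ^ n)
    (d : ℕ) (hd : (d : WithBot ℕ∞) = ringKrullDim R) (e : ℝ) :
    IsHSMultiplicity S N S d e ↔ IsHSMultiplicity R M R d e := by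
  have hfin : Module.Finite R S := Module.Finite.of_injective μ hμ
  have hS : IsNoetherianRing S := IsNoetherianRing.of_finite R S
  obtain ⟨g, v, hv⟩ := Submodule.fg_iff_exists_fin_generating_family.mp hfin.fg_top
  obtain ⟨D, hD⟩ := exists_forall_length_quotient_span_sup_pow_mul_le M (μ 1) hμ1 d hd
  have key : ∀ c c' : ℕ → ℕ, (∀ n, ModuleLengthIs S (S ⧸ (N ^ n • ⊤ : Submodule S S)) (c n)) →
      (∀ n, ModuleLengthIs R (R ⧸ (M ^ n • ⊤ : Submodule R R)) (c' n)) →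
      (Filter.Tendsto (fun n : ℕ => (Nat.factorial d : ℝ) / (n : ℝ) ^ d * (c n : ℝ))
        Filter.atTop (nhds e) ↔
      Filter.Tendsto (fun n : ℕ => (Nat.factorial d : ℝ) / (n : ℝ) ^ d * (c' n : ℝ))
        Filter.atTop (nhds e)) := by
    intro c c' hc hc'
    have hlen : ∀ n, Module.length R (S ⧸ (N ^ n • ⊤ : Submodule S S)) = c n := fun n =>
      ((hc n).restrictScalars N hres n fun a ha z => by
        obtain ⟨z, rfl⟩ := Submodule.Quotient.mk_surjective _ z
        rw [← Submodule.Quotient.mk_smul, Submodule.Quotient.mk_eq_zero]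
        exact Submodule.smul_mem_smul ha Submodule.mem_top).length_eq
    refine tendsto_iff_of_forall_mul_le d ((g + 1) * D) c c' e (fun n => ?_) fun n => ?_
    · have h1 := (length_quotient_pow_compare M N hMN μ hμ hN v hv n).1
      rw [hlen, (hc' n).length_eq] at h1
      have h2 : (c n * n : ℕ∞) ≤ c' n * n + g * (D * n ^ d : ℕ) := by
        calc (c n * n : ℕ∞) ≤ _ := mul_le_mul_left h1 _
          _ = c' n * n + g * (Module.length R (R ⧸ (Ideal.span {μ 1} ⊔ M ^ n)) * n) := by
            rw [add_mul, mul_assoc]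
          _ ≤ _ := by gcongr; exact hD n
      have h3 : c n * n ≤ c' n * n + g * (D * n ^ d) := by exact_mod_cast h2
      nlinarith [Nat.zero_le (D * n ^ d)]
    · have h1 := (length_quotient_pow_compare M N hMN μ hμ hN v hv n).2
      rw [hlen, (hc' n).length_eq] at h1
      have h2 : (c' n * n : ℕ∞) ≤ c n * n + (D * n ^ d : ℕ) := by
        calc (c' n * n : ℕ∞) ≤ _ := mul_le_mul_left h1 _
          _ = c n * n + Module.length R (R ⧸ (Ideal.span {μ 1} ⊔ M ^ n)) * n := add_mul _ _ _
          _ ≤ _ := by gcongr; exact hD n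
      have h3 : c' n * n ≤ c n * n + D * n ^ d := by exact_mod_cast h2
      nlinarith [Nat.zero_le (g * (D * n ^ d))]
  constructor
  · rintro ⟨c, hc, ht⟩
    choose c' hc' using fun n => exists_moduleLengthIs (length_quotient_pow_smul_top_ne_top M n)
    exact ⟨c', hc', (key c c' hc hc').mp ht⟩
  · rintro ⟨c', hc', ht⟩
    choose c hc using fun n => exists_moduleLengthIs (length_quotient_pow_smul_top_ne_top N n)
    exact ⟨c, hc, (key c c' hc hc').mpr ht⟩

end CompareMultiplicity

section IntegralClosureRees

lemma C_mul_cancel {A : Type*} [CommRing A] {w : A} (hw : w ∈ nonZeroDivisors A) {f g : A[X]}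
    (h : C w * f = C w * g) : f = g := by
  ext i
  have h1 := congrArg (fun f : A[X] => f.coeff i) h
  simp only [coeff_C_mul] at h1
  exact (mul_cancel_left_mem_nonZeroDivisors hw).mp h1

lemma isIntegral_of_forall_C_mul_pow_mem {A : Type*} [CommRing A] [IsNoetherianRing A]
    (I : Ideal A) {w : A} (hw : w ∈ nonZeroDivisors A) (g : A[X])
    (h : ∀ n : ℕ, C w * g ^ n ∈ reesAlgebra I) : IsIntegral (reesAlgebra I) g := by
  have hmem : ∀ c ∈ Algebra.adjoin (reesAlgebra I) {g}, C w * c ∈ reesAlgebra I := by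
    intro c hc
    rw [Algebra.adjoin_singleton_eq_range_aeval] at hc
    obtain ⟨p, rfl⟩ := hc
    change C w * aeval g p ∈ _
    rw [aeval_eq_sum_range, Finset.mul_sum]
    refine sum_mem fun i _ => ?_
    rw [Algebra.smul_def, mul_left_comm]
    exact mul_mem (p.coeff i).2 (h i)
  let ν : Algebra.adjoin (reesAlgebra I) {g} →ₗ[reesAlgebra I] reesAlgebra I :=
    { toFun := fun c => ⟨C w * (c : A[X]), hmem c c.2⟩
      map_add' := fun a b => Subtype.ext (mul_add _ _ _)
      map_smul' := fun r a => Subtype.ext (by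
        change C w * ((r : A[X]) * (a : A[X])) = (r : A[X]) * (C w * (a : A[X]))
        ring) }
  have hν : Function.Injective ν := fun a b hab =>
    Subtype.ext (C_mul_cancel hw (congrArg Subtype.val hab))
  have hfin : Module.Finite (reesAlgebra I) (Algebra.adjoin (reesAlgebra I) {g}) :=
    Module.Finite.of_injective ν hν
  have h1 : IsIntegral (reesAlgebra I)
      (⟨g, Algebra.self_mem_adjoin_singleton _ g⟩ : Algebra.adjoin (reesAlgebra I) {g}) :=
    Algebra.IsIntegral.isIntegral _
  exact h1.map (Algebra.adjoin (reesAlgebra I) {g}).val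

lemma monomial_coeff_mem_integralClosure {A : Type*} [CommRing A] [IsNoetherianRing A]
    (I : Ideal A) {w : A} (hw : w ∈ nonZeroDivisors A)
    (h : ∀ c : A[X], IsIntegral (reesAlgebra I) c → C w * c ∈ reesAlgebra I)
    (f : A[X]) (hf : f ∈ integralClosure (reesAlgebra I) A[X]) (j : ℕ) :
    monomial j (f.coeff j) ∈ integralClosure (reesAlgebra I) A[X] := by
  induction hn : f.support.card generalizing f with
  | zero =>
    have : f = 0 := by simpa using hn
    simp [this]
  | succ n ih =>
    have hlead : monomial f.natDegree f.leadingCoeff ∈ integralClosure (reesAlgebra I) A[X] := by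
      refine isIntegral_of_forall_C_mul_pow_mem I hw _ fun k => ?_
      have h1 := (mem_reesAlgebra_iff I _).mp (h _ (IsIntegral.pow hf k)) (f.natDegree * k)
      rw [coeff_C_mul, mul_comm f.natDegree, coeff_pow_mul_natDegree] at h1
      rw [monomial_pow, C_mul_monomial, mul_comm f.natDegree]
      exact reesAlgebra.monomial_mem.mpr h1
    have herase : f.eraseLead ∈ integralClosure (reesAlgebra I) A[X] := by
      rw [← self_sub_monomial_natDegree_leadingCoeff]
      exact sub_mem hf hlead
    rcases eq_or_ne j f.natDegree with rfl | hj
    · exact hlead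
    · have h2 := ih _ herase (card_support_eraseLead' hn)
      rwa [eraseLead_coeff_of_ne _ hj] at h2

/-- The ideal of coefficients of degree-`j` monomials lying in a subalgebra containing the
constants. -/
def monomialIdeal {A : Type*} [CommRing A] {R : Type*} [CommRing R] [Algebra R A[X]]
    (S : Subalgebra R A[X]) (hC : ∀ a : A, C a ∈ S) (j : ℕ) : Ideal A where
  carrier := {c | monomial j c ∈ S}
  zero_mem' := by simp
  add_mem' := fun {a b} ha hb => by
    change monomial j (a + b) ∈ S
    rw [map_add]
    exact add_mem ha hb
  smul_mem' := fun a c hc => by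
    change monomial j (a * c) ∈ S
    rw [← C_mul_monomial]
    exact mul_mem (hC a) hc

lemma coeff_mem_of_mem_maxHomIdeal_pow_of_graded {A : Type*} [CommRing A] [IsLocalRing A]
    {R : Type*} [CommRing R] [Algebra R A[X]] (S : Subalgebra R A[X]) (hC : ∀ a : A, C a ∈ S)
    (hS : ∀ f ∈ S, ∀ j, monomial j (f.coeff j) ∈ S)
    (n : ℕ) (f : S) (hf : f ∈ maxHomIdeal S ^ n) (j : ℕ) :
    (f : A[X]).coeff j ∈ IsLocalRing.maximalIdeal A ^ (n - j) * monomialIdeal S hC j := by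
  have hmul : ∀ i j, monomialIdeal S hC i * monomialIdeal S hC j ≤ monomialIdeal S hC (i + j) := by
    intro i j
    rw [Ideal.mul_le]
    intro a ha b hb
    change monomial (i + j) (a * b) ∈ S
    rw [← monomial_mul_monomial]
    exact mul_mem ha hb
  induction n generalizing f j with
  | zero =>
    rw [Nat.zero_sub, pow_zero, Ideal.one_eq_top, Ideal.top_mul]
    exact hS f f.2 j
  | succ n ih =>
    rw [pow_succ] at hf
    refine Submodule.mul_induction_on hf ?_ ?_
    · intro g hg h hh
      rw [MulMemClass.coe_mul, coeff_mul]
      refine Ideal.sum_mem _ fun p hp => ?_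
      rw [Finset.HasAntidiagonal.mem_antidiagonal] at hp
      have h1 := ih g hg p.1
      rcases Nat.eq_zero_or_pos p.2 with h0 | h0
      · have h2 : (h : A[X]).coeff p.2 ∈ IsLocalRing.maximalIdeal A := by rw [h0]; exact hh
        have h3 := Ideal.mul_mem_mul h1 h2
        have hpj : p.1 = j := by omega
        rw [hpj, mul_right_comm, ← pow_succ] at h3
        rw [hpj]
        exact Ideal.mul_mono_left (Ideal.pow_le_pow_right (by omega)) h3
      · have h2 : (h : A[X]).coeff p.2 ∈ monomialIdeal S hC p.2 := hS h h.2 p.2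
        have h3 := Ideal.mul_mem_mul h1 h2
        rw [mul_assoc] at h3
        have h4 := hmul p.1 p.2
        rw [hp] at h4
        exact Ideal.mul_mono (Ideal.pow_le_pow_right (by omega)) h4 h3
    · intro a b ha hb
      rw [AddMemClass.coe_add, coeff_add]
      exact Ideal.add_mem _ ha hb

theorem isHSMultiplicity_subalgebra_iff_of_linearMap {A R : Type*} [CommRing A] [CommRing R]
    [IsNoetherianRing R] [Algebra R A[X]] (S : Subalgebra R A[X]) (M : Ideal R) (hM : M.IsMaximal)
    (N : Ideal S) (hN : N.IsMaximal) (hMN : ∀ r ∈ M, algebraMap R S r ∈ N)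
    (hres : ∀ s : S, ∃ r : R, s - algebraMap R S r ∈ N) (μ : S →ₗ[R] R)
    (hμ : Function.Injective μ) (hμ1 : μ 1 ∈ nonZeroDivisors R)
    (hμN : ∀ n, ∀ s ∈ N ^ n, μ s ∈ M ^ n)
    (d : ℕ) (hd : (d : WithBot ℕ∞) = ringKrullDim R) (e : ℝ) :
    IsHSMultiplicity S N S d e ↔ IsHSMultiplicity R M R d e :=
  isHSMultiplicity_iff_of_linearMap M N hMN hres μ hμ hμ1 hμN d hd e

theorem isHSMultiplicity_subalgebra_iff_reesAlgebra {A : Type*} [CommRing A] [IsNoetherianRing A]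
    [IsLocalRing A] (I : Ideal A) (S : Subalgebra (reesAlgebra I) A[X])
    (hS : ∀ f ∈ S, ∀ j, monomial j (f.coeff j) ∈ S) {w : A} (hw : w ∈ nonZeroDivisors A)
    (hwc : ∀ c ∈ S, C w * c ∈ reesAlgebra I) (d : ℕ)
    (hd : (d : WithBot ℕ∞) = ringKrullDim (reesAlgebra I)) (e : ℝ) :
    IsHSMultiplicity S (maxHomIdeal S) S d e ↔
      IsHSMultiplicity (reesAlgebra I) (maxHomIdeal (reesAlgebra I)) (reesAlgebra I) d e := by
  have hCR : ∀ a : A, C a ∈ reesAlgebra I := fun a => (reesAlgebra I).algebraMap_mem a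
  have hCS : ∀ a : A, C a ∈ S := fun a => S.algebraMap_mem ⟨C a, hCR a⟩
  have hM : (maxHomIdeal (reesAlgebra I)).IsMaximal := isMaximal_maxHomIdeal _ hCR
  have hN : (maxHomIdeal S).IsMaximal := isMaximal_maxHomIdeal _ hCS
  obtain ⟨μ, hμw⟩ : ∃ μ : S →ₗ[reesAlgebra I] reesAlgebra I,
      ∀ s : S, (μ s : A[X]) = C w * (s : A[X]) := by
    refine ⟨
      { toFun := fun c => ⟨C w * (c : A[X]), hwc c c.2⟩
        map_add' := fun a b => Subtype.ext (mul_add _ _ _)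
        map_smul' := fun r a => Subtype.ext ?_ }, fun s => rfl⟩
    change C w * ((r : A[X]) * (a : A[X])) = (r : A[X]) * (C w * (a : A[X]))
    ring
  have hμ : Function.Injective μ := fun a b hab => by
    apply Subtype.ext
    apply C_mul_cancel hw
    rw [← hμw, ← hμw, hab]
  have hμ1 : μ 1 ∈ nonZeroDivisors (reesAlgebra I) := by
    have h1 : μ 1 = algebraMap A (reesAlgebra I) w :=
      Subtype.ext ((hμw 1).trans (mul_one _))
    rw [h1]
    exact algebraMap_mem_nonZeroDivisors_reesAlgebra I hw
  have hMN : maxHomIdeal (reesAlgebra I) ≤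
      (maxHomIdeal S).comap (algebraMap (reesAlgebra I) S) := fun r hr => hr
  have hres : ∀ s : S, ∃ r : reesAlgebra I, s - algebraMap _ S r ∈ maxHomIdeal S := by
    refine fun s => ⟨⟨C ((s : A[X]).coeff 0), hCR _⟩, ?_⟩
    change ((s : A[X]) - C ((s : A[X]).coeff 0)).coeff 0 ∈ IsLocalRing.maximalIdeal A
    simp
  have hpow : ∀ n, ∀ s ∈ maxHomIdeal S ^ n, μ s ∈ maxHomIdeal (reesAlgebra I) ^ n := by
    intro n s hs
    rw [mem_maxHomIdeal_pow_iff]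
    intro j
    rw [hμw, coeff_C_mul]
    have h1 := coeff_mem_of_mem_maxHomIdeal_pow_of_graded _ hCS hS n s hs j
    have h2 := Ideal.mul_mem_mul (Ideal.mem_span_singleton_self w) h1
    rw [mul_left_comm] at h2
    refine Ideal.mul_mono_right ?_ h2
    rw [Ideal.span_singleton_mul_le_iff]
    intro c hc
    have h3 := hwc _ hc
    rw [C_mul_monomial] at h3
    exact reesAlgebra.monomial_mem.mp h3
  exact isHSMultiplicity_subalgebra_iff_of_linearMap S _ hM _ hN hMN hres μ hμ hμ1 hpow d hd e

end IntegralClosureRees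

/-- For an analytically unramified Noetherian local ring `A` and an ideal `I` of positive
height (contained in no minimal prime of `A`), the Rees algebra `𝔯(I;A) = A[It]` and its
integral closure in `A[t]` have the same multiplicity with respect to their respective
maximal homogeneous ideals. -/
theorem mult_integralClosure_reesAlgebra_eq {A : Type*} [CommRing A] [IsNoetherianRing A]
    [IsLocalRing A]
    (hred : IsReduced (AdicCompletion (IsLocalRing.maximalIdeal A) A))
    (I : Ideal A) (hI : ∀ p ∈ (⊥ : Ideal A).minimalPrimes, ¬ I ≤ p)
    (d : ℕ)
    (hd : (d : WithBot ℕ∞) = ringKrullDim (reesAlgebra I))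
    (hd' : (d : WithBot ℕ∞) = ringKrullDim (integralClosure (reesAlgebra I) A[X]))
    (e : ℝ) :
    IsHSMultiplicity (integralClosure (reesAlgebra I) A[X])
        (maxHomIdeal (integralClosure (reesAlgebra I) A[X]))
        (integralClosure (reesAlgebra I) A[X]) d e ↔
      IsHSMultiplicity (reesAlgebra I) (maxHomIdeal (reesAlgebra I)) (reesAlgebra I) d e := by
  obtain ⟨w, hw, hwc⟩ := exists_nonZeroDivisor_forall_C_mul_mem_reesAlgebra hred I hI
  exact isHSMultiplicity_subalgebra_iff_reesAlgebra I _
    (monomial_coeff_mem_integralClosure I hw hwc) hw hwc d hd e
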